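/- arXiv:0902.3190 — 4 statements merged into one kernel-verified Lean document; each statement's English description precedes it below -/
import Mathlib

section
/- The polynomial zeta function ζ^{(0)}_P(s) = Σ_{k=0}^∞ P(k)^{−s} extends holomorphically to 0, and every holomorphic extension Z of ζ^{(0)}_P to an open connected set containing 0 and the half-plane {s : Re s > 1} satisfies Z(0) = 1/2 − (1/n) · a_{n−1}/a_n. -/
/-- The polynomial `P(x) = aₙ xⁿ + ⋯ + a₁ x + a₀` evaluated at a real point. -/
noncomputable def Pval (n : ℕ) (a : ℕ → ℝ) (x : ℝ) : ℝ :=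
  ∑ i ∈ Finset.range (n + 1), a i * x ^ i

/-- The polynomial zeta function `ζ^{(0)}_P(s) = Σ_{k=0}^∞ P(k)^{−s}`,
with `P(k)^{−s} = exp(−s · log P(k))` (real logarithm). -/
noncomputable def polyZeta0 (n : ℕ) (a : ℕ → ℝ) (s : ℂ) : ℂ :=
  ∑' k : ℕ, Complex.exp (-s * (Real.log (Pval n a k) : ℂ))

section

open Filter Topology Polynomial

theorem isBigO_eval_of_coeff_zero {f : ℝ[X]} (hf : f.coeff 0 = 0) :
    (fun x : ℝ => f.eval x) =O[𝓝 0] (fun x : ℝ => x) := by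
  have h := (f.differentiable.differentiableAt (x := (0 : ℝ))).isBigO_sub
  simpa [← coeff_zero_eq_eval_zero, hf] using h

theorem exists_polynomial_log_approx {Q : ℝ[X]} (hQ : Q.coeff 0 = 1) (N : ℕ) :
    ∃ p : ℝ[X], p.coeff 0 = 0 ∧ p.coeff 1 = Q.coeff 1 ∧
      (fun x : ℝ => Real.log (Q.eval x) - p.eval x) =O[𝓝 0] (fun x : ℝ => x ^ (N + 2)) := by
  have h1 : (1 - Q).coeff 0 = 0 := by simp [hQ]
  have h1' : (1 - Q).eval 0 = 0 := by rw [← coeff_zero_eq_eval_zero, h1]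
  refine ⟨-∑ i ∈ Finset.range (N + 1), C ((1 : ℝ) / (i + 1)) * (1 - Q) ^ (i + 1), ?_, ?_, ?_⟩
  · simp [coeff_zero_eq_eval_zero, eval_finsetSum, -eval_sub, h1']
  · have hd (f : ℝ[X]) : f.coeff 1 = f.derivative.eval 0 := by
      rw [← coeff_zero_eq_eval_zero, coeff_derivative]; simp
    rw [hd, hd]
    have h2 : Q.eval 0 = 1 := by rw [← coeff_zero_eq_eval_zero, hQ]
    simp [eval_finsetSum, Finset.sum_range_succ', derivative_pow, h2]
  · have hO := isBigO_eval_of_coeff_zero h1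
    have ht : Tendsto (fun x : ℝ => (1 - Q).eval x) (𝓝 0) (𝓝 0) := by
      have := (1 - Q).continuous.tendsto 0
      rwa [h1'] at this
    refine Asymptotics.IsBigO.trans ?_ (hO.pow (N + 2))
    refine Asymptotics.IsBigO.of_bound 2 ?_
    filter_upwards [ht.abs.eventually_lt_const (show |(0 : ℝ)| < 1 / 2 by norm_num)] with x hx
    have h3 := Real.abs_log_sub_add_sum_range_le (x := (1 - Q).eval x) (by linarith) (N + 1)
    have h4 : 1 - (1 - Q).eval x = Q.eval x := by simp
    rw [h4] at h3
    have h5 : Real.log (Q.eval x) - eval x (-∑ i ∈ Finset.range (N + 1),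
        C ((1 : ℝ) / (i + 1)) * (1 - Q) ^ (i + 1)) =
        (∑ i ∈ Finset.range (N + 1), ((1 - Q).eval x) ^ (i + 1) / ((i : ℝ) + 1)) +
          Real.log (Q.eval x) := by
      simp only [eval_neg, eval_finsetSum, eval_mul, eval_C, eval_pow]
      rw [sub_neg_eq_add, add_comm]
      congr 1
      exact Finset.sum_congr rfl fun i _ => by ring
    rw [h5, Real.norm_eq_abs, norm_pow, Real.norm_eq_abs]
    refine h3.trans ?_
    rw [div_le_iff₀ (by linarith)]
    have : 0 ≤ |(1 - Q).eval x| ^ (N + 2) := by positivity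
    change |(1 - Q).eval x| ^ (N + 2) ≤ _
    nlinarith

theorem exists_abs_eval_le {p : ℝ[X]} (hp : p.coeff 0 = 0) :
    ∃ M, 0 ≤ M ∧ ∀ t : ℝ, 0 ≤ t → t ≤ 1 → |p.eval t| ≤ M * t := by
  obtain ⟨q, rfl⟩ := X_dvd_iff.mpr hp
  obtain ⟨M, hM⟩ := (isCompact_Icc (a := (0 : ℝ)) (b := 1)).exists_bound_of_continuousOn
    q.continuous.continuousOn
  refine ⟨|M|, abs_nonneg _, fun t h0 h1 => ?_⟩
  rw [eval_mul, eval_X, abs_mul, abs_of_nonneg h0, mul_comm]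
  exact mul_le_mul_of_nonneg_right ((hM t ⟨h0, h1⟩).trans (le_abs_self _)) h0

/-- The error made by truncating the expansion of `exp (-s * l)` in powers of an approximation `y`
of `l`. -/
noncomputable def expRemainder (N : ℕ) (y l : ℝ) (s : ℂ) : ℂ :=
  Complex.exp (-s * l) - ∑ m ∈ Finset.range N, (-s) ^ m / m.factorial * (y : ℂ) ^ m

theorem expRemainder_zero {N : ℕ} (hN : N ≠ 0) (y l : ℝ) : expRemainder N y l 0 = 0 := by
  obtain ⟨N, rfl⟩ := Nat.exists_eq_succ_of_ne_zero hN
  simp [expRemainder, Finset.sum_range_succ']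

theorem differentiable_expRemainder (N : ℕ) (y l : ℝ) :
    Differentiable ℂ (expRemainder N y l) := by
  unfold expRemainder
  fun_prop

theorem norm_expRemainder_le {N : ℕ} {y l t B C M : ℝ} {s : ℂ} (hs : ‖s‖ ≤ B) (hC : 0 ≤ C)
    (ht0 : 0 ≤ t) (ht1 : t ≤ 1) (hy : |y| ≤ M * t) (hl : |l - y| ≤ C * t ^ N) (hM : 0 ≤ M) :
    ‖expRemainder N y l s‖ ≤
      (Real.exp (B * M) * (B * C * Real.exp (B * C)) + (B * M) ^ N * Real.exp (B * M)) * t ^ N := by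
  have hB : 0 ≤ B := (norm_nonneg s).trans hs
  have h1 : expRemainder N y l s = Complex.exp (-s * y) * (Complex.exp (-s * (l - y : ℝ)) - 1)
      + (Complex.exp (-s * y) - ∑ m ∈ Finset.range N, (-s * y) ^ m / m.factorial) := by
    have : ∑ m ∈ Finset.range N, (-s * y) ^ m / (m.factorial : ℂ) =
        ∑ m ∈ Finset.range N, (-s) ^ m / m.factorial * (y : ℂ) ^ m :=
      Finset.sum_congr rfl fun m _ => by rw [mul_pow]; ring
    have he : -s * (y : ℂ) + -s * ((l - y : ℝ) : ℂ) = -s * l := by push_cast; ring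
    rw [this, expRemainder, mul_sub, ← Complex.exp_add, he]
    ring
  have hsy : ‖-s * (y : ℂ)‖ ≤ B * M * t := by
    rw [norm_mul, norm_neg, Complex.norm_real, Real.norm_eq_abs, mul_assoc]
    exact mul_le_mul hs hy (abs_nonneg _) hB
  have hsy' : ‖-s * (y : ℂ)‖ ≤ B * M :=
    hsy.trans (mul_le_of_le_one_right (by positivity) ht1)
  have hsl : ‖-s * ((l - y : ℝ) : ℂ)‖ ≤ B * C * t ^ N := by
    rw [norm_mul, norm_neg, Complex.norm_real, Real.norm_eq_abs, mul_assoc]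
    exact mul_le_mul hs hl (abs_nonneg _) hB
  have hsl' : ‖-s * ((l - y : ℝ) : ℂ)‖ ≤ B * C :=
    hsl.trans (mul_le_of_le_one_right (by positivity) (pow_le_one₀ ht0 ht1))
  have h2 : ‖Complex.exp (-s * y)‖ ≤ Real.exp (B * M) :=
    (Complex.norm_exp_le_exp_norm _).trans (Real.exp_le_exp.mpr hsy')
  have h3 : ‖Complex.exp (-s * (l - y : ℝ)) - 1‖ ≤ B * C * t ^ N * Real.exp (B * C) := by
    have := Complex.norm_exp_sub_sum_le_norm_mul_exp (-s * (l - y : ℝ)) 1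
    simp only [Finset.range_one, Finset.sum_singleton, pow_zero, Nat.factorial_zero, Nat.cast_one,
      div_one, pow_one] at this
    exact this.trans (mul_le_mul hsl (Real.exp_le_exp.mpr hsl') (Real.exp_pos _).le
      (by positivity))
  have h4 : ‖Complex.exp (-s * y) - ∑ m ∈ Finset.range N, (-s * y) ^ m / m.factorial‖ ≤
      (B * M * t) ^ N * Real.exp (B * M) :=
    (Complex.norm_exp_sub_sum_le_norm_mul_exp _ N).trans
      (mul_le_mul (pow_le_pow_left₀ (norm_nonneg _) hsy N) (Real.exp_le_exp.mpr hsy')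
        (Real.exp_pos _).le (by positivity))
  rw [h1]
  refine (norm_add_le _ _).trans ?_
  rw [norm_mul]
  refine (add_le_add (mul_le_mul h2 h3 (norm_nonneg _) (Real.exp_pos _).le) h4).trans
    (le_of_eq ?_)
  rw [mul_pow (B * M) t]
  ring

theorem tendsto_mul_riemannZeta {n : ℕ} (hn : n ≠ 0) (j : ℕ) :
    Tendsto (fun s : ℂ => s * riemannZeta (n * s + j)) (𝓝[≠] 0)
      (𝓝 (if j = 1 then 1 / (n : ℂ) else 0)) := by
  have hn' : (n : ℂ) ≠ 0 := by exact_mod_cast hn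
  split_ifs with hj
  · subst hj
    have h1 : Tendsto (fun s : ℂ => (n : ℂ) * s + (1 : ℕ)) (𝓝[≠] 0) (𝓝[≠] 1) := by
      refine tendsto_nhdsWithin_iff.mpr ⟨?_, ?_⟩
      · have : Continuous fun s : ℂ => (n : ℂ) * s + (1 : ℕ) := by fun_prop
        have := this.tendsto 0
        simp only [mul_zero, zero_add, Nat.cast_one] at this
        simpa using this.mono_left nhdsWithin_le_nhds
      · filter_upwards [self_mem_nhdsWithin] with s hs
        simpa [hn'] using hs
    have h2 := (riemannZeta_residue_one.comp h1).div_const (n : ℂ)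
    refine h2.congr fun s => ?_
    simp only [Function.comp, Nat.cast_one, add_sub_cancel_right]
    field_simp
  · have h1 : ContinuousAt (fun s : ℂ => s * riemannZeta (n * s + j)) 0 := by
      have : DifferentiableAt ℂ riemannZeta (n * 0 + j) :=
        differentiableAt_riemannZeta (by simpa using hj)
      refine continuousAt_id.mul (ContinuousAt.comp (f := fun s : ℂ => (n : ℂ) * s + j)
        this.continuousAt (by fun_prop))
    have h2 := h1.tendsto.mono_left (nhdsWithin_le_nhds (s := {0}ᶜ))
    simpa using h2

/-- The part of the zeta series left over after the terms expressible through `riemannZeta`. -/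
noncomputable def zetaRemainder (n N : ℕ) (p : ℝ[X]) (l : ℕ → ℝ) (s : ℂ) : ℂ :=
  ∑' k : ℕ, Complex.exp (-(n * s) * Real.log (k + 1)) *
    expRemainder N (p.eval (1 / (k + 1 : ℝ))) (l k) s

theorem exists_norm_zetaRemainder_term_le {n N : ℕ} {p : ℝ[X]} {l : ℕ → ℝ} (hp : p.coeff 0 = 0)
    (hl : (fun k : ℕ => l k - p.eval (1 / (k + 1 : ℝ))) =O[atTop]
      fun k : ℕ => (1 / (k + 1 : ℝ)) ^ N) (B : ℝ) :
    ∃ D : ℝ, ∀ k : ℕ, ∀ s : ℂ, ‖s‖ ≤ B → 2 < n * s.re + N →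
      ‖Complex.exp (-(n * s) * Real.log (k + 1)) *
        expRemainder N (p.eval (1 / (k + 1 : ℝ))) (l k) s‖ ≤ D * (1 / ((k + 1 : ℕ) : ℝ) ^ 2) := by
  obtain ⟨C, hC, hlC⟩ := Asymptotics.bound_of_isBigO_nat_atTop hl
  obtain ⟨M, hM, hpM⟩ := exists_abs_eval_le hp
  refine ⟨Real.exp (B * M) * (B * C * Real.exp (B * C)) + (B * M) ^ N * Real.exp (B * M),
    fun k s hs hsN => ?_⟩
  have hk : (0 : ℝ) < k + 1 := by positivity
  have ht0 : (0 : ℝ) ≤ 1 / (k + 1) := by positivity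
  have ht1 : 1 / ((k : ℝ) + 1) ≤ 1 := by
    rw [div_le_one hk]; linarith [(Nat.cast_nonneg k : (0 : ℝ) ≤ k)]
  have hB : 0 ≤ B := (norm_nonneg s).trans hs
  have hlk : |l k - p.eval (1 / (k + 1 : ℝ))| ≤ C * (1 / (k + 1 : ℝ)) ^ N := by
    have h := hlC (x := k) (by positivity)
    rwa [Real.norm_eq_abs, Real.norm_eq_abs, abs_of_nonneg (pow_nonneg ht0 N)] at h
  have h1 := norm_expRemainder_le hs hC.le ht0 ht1 (hpM _ ht0 ht1) hlk hM
  set D := Real.exp (B * M) * (B * C * Real.exp (B * C)) + (B * M) ^ N * Real.exp (B * M)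
  have hD : 0 ≤ D := by positivity
  have hpow (m : ℕ) : (1 / (k + 1 : ℝ)) ^ m = Real.exp (-m * Real.log (k + 1)) := by
    rw [neg_mul, Real.exp_neg, mul_comm, Real.exp_mul, Real.exp_log hk, Real.rpow_natCast,
      one_div, inv_pow]
  have h2 : ‖Complex.exp (-(n * s) * Real.log (k + 1))‖ =
      Real.exp (-(n * s.re) * Real.log (k + 1)) := by
    rw [Complex.norm_exp]
    simp
  rw [norm_mul, h2]
  refine (mul_le_mul_of_nonneg_left h1 (Real.exp_pos _).le).trans ?_
  rw [mul_left_comm]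
  refine mul_le_mul_of_nonneg_left ?_ hD
  rw [Nat.cast_add_one, ← one_div_pow, hpow, hpow, ← Real.exp_add, Real.exp_le_exp]
  have hlog : 0 ≤ Real.log (k + 1) :=
    Real.log_nonneg (by linarith [(Nat.cast_nonneg k : (0 : ℝ) ≤ k)])
  push_cast
  nlinarith

theorem summable_const_mul_one_div_succ_sq (D : ℝ) :
    Summable fun k : ℕ => D * (1 / ((k + 1 : ℕ) : ℝ) ^ 2) :=
  ((summable_nat_add_iff 1).mpr (Real.summable_one_div_nat_pow.mpr one_lt_two)).mul_left D

theorem isOpen_two_lt_re (n N : ℕ) : IsOpen {s : ℂ | 2 < n * s.re + N} :=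
  isOpen_lt continuous_const (by fun_prop)

theorem differentiableOn_zetaRemainder {n N : ℕ} {p : ℝ[X]} {l : ℕ → ℝ} (hp : p.coeff 0 = 0)
    (hl : (fun k : ℕ => l k - p.eval (1 / (k + 1 : ℝ))) =O[atTop]
      fun k : ℕ => (1 / (k + 1 : ℝ)) ^ N) :
    DifferentiableOn ℂ (zetaRemainder n N p l) {s : ℂ | 2 < n * s.re + N} := by
  intro s hs
  obtain ⟨D, hD⟩ := exists_norm_zetaRemainder_term_le (n := n) hp hl (‖s‖ + 1)
  have hopen : IsOpen (Metric.ball (0 : ℂ) (‖s‖ + 1) ∩ {s : ℂ | 2 < n * s.re + N}) :=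
    Metric.isOpen_ball.inter (isOpen_two_lt_re n N)
  have h := Complex.differentiableOn_tsum_of_summable_norm
    (F := fun (k : ℕ) s => Complex.exp (-(n * s) * Real.log (k + 1)) *
        expRemainder N (p.eval (1 / (k + 1 : ℝ))) (l k) s)
    (summable_const_mul_one_div_succ_sq D)
    (fun k => by
      have := differentiable_expRemainder N (p.eval (1 / (k + 1 : ℝ))) (l k)
      exact Differentiable.differentiableOn (by fun_prop)) hopen
    (fun k w hw => hD k w (mem_ball_zero_iff.mp hw.1).le hw.2)
  exact (h.differentiableAt (hopen.mem_nhds ⟨by simp, hs⟩)).differentiableWithinAt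

theorem summable_zetaRemainder {n N : ℕ} {p : ℝ[X]} {l : ℕ → ℝ} (hp : p.coeff 0 = 0)
    (hl : (fun k : ℕ => l k - p.eval (1 / (k + 1 : ℝ))) =O[atTop]
      fun k : ℕ => (1 / (k + 1 : ℝ)) ^ N) {s : ℂ} (hs : 2 < n * s.re + N) :
    Summable fun k : ℕ => Complex.exp (-(n * s) * Real.log (k + 1)) *
      expRemainder N (p.eval (1 / (k + 1 : ℝ))) (l k) s := by
  obtain ⟨D, hD⟩ := exists_norm_zetaRemainder_term_le (n := n) hp hl ‖s‖
  exact Summable.of_norm_bounded (summable_const_mul_one_div_succ_sq D)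
    fun k => hD k s le_rfl hs

theorem zetaRemainder_zero {n N : ℕ} (hN : N ≠ 0) (p : ℝ[X]) (l : ℕ → ℝ) :
    zetaRemainder n N p l 0 = 0 := by
  simp [zetaRemainder, expRemainder_zero hN]

/-- The combination of values of `riemannZeta` attached to the coefficients of a polynomial:
the analytic continuation of `∑ k ≥ 1, k ^ (-w) * f (1 / k)`. -/
noncomputable def zetaComb (J : ℕ) (f : ℝ[X]) (w : ℂ) : ℂ :=
  ∑ j ∈ Finset.range J, (f.coeff j : ℂ) * riemannZeta (w + j)

theorem hasSum_zetaComb {J : ℕ} {f : ℝ[X]} (hJ : f.natDegree < J) {w : ℂ} (hw : 1 < w.re) :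
    HasSum (fun k : ℕ => Complex.exp (-w * Real.log (k + 1)) * ((f.eval (1 / (k + 1 : ℝ)) : ℝ) : ℂ))
      (zetaComb J f w) := by
  have h1 (j : ℕ) : HasSum (fun k : ℕ => (f.coeff j : ℂ) *
      (Complex.exp (-w * Real.log (k + 1)) * (((1 / (k + 1 : ℝ)) ^ j : ℝ) : ℂ)))
      ((f.coeff j : ℂ) * riemannZeta (w + j)) := by
    refine HasSum.mul_left _ ?_
    have hwj : 1 < (w + j).re := by
      simp only [Complex.add_re, Complex.natCast_re]
      linarith [(Nat.cast_nonneg j : (0 : ℝ) ≤ j)]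
    have hs : Summable fun k : ℕ => 1 / ((k : ℂ) + 1) ^ (w + j) := by
      have := (summable_nat_add_iff 1).mpr (Complex.summable_one_div_nat_cpow.mpr hwj)
      simpa using this
    have h := hs.hasSum
    rw [← zeta_eq_tsum_one_div_nat_add_one_cpow hwj] at h
    refine h.congr_fun fun k => ?_
    have hk : (k : ℂ) + 1 ≠ 0 := by exact_mod_cast k.succ_ne_zero
    have hlog : ((Real.log (k + 1) : ℝ) : ℂ) = Complex.log ((k : ℂ) + 1) := by
      rw [Complex.ofReal_log (by positivity)]; simp
    rw [Complex.cpow_add _ _ hk, Complex.cpow_natCast, Complex.cpow_def_of_ne_zero hk, hlog,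
      neg_mul, Complex.exp_neg, mul_comm w]
    push_cast
    rw [one_div_pow]
    field_simp
  have h2 := hasSum_sum (s := Finset.range J) fun j _ => h1 j
  refine h2.congr_fun fun k => ?_
  rw [eval_eq_sum_range' hJ]
  push_cast
  rw [Finset.mul_sum]
  exact Finset.sum_congr rfl fun j _ => by ring

theorem tendsto_mul_zetaComb {n J : ℕ} (hn : n ≠ 0) {f : ℝ[X]} (hJ : f.natDegree < J) :
    Tendsto (fun s : ℂ => s * zetaComb J f (n * s)) (𝓝[≠] 0) (𝓝 (f.coeff 1 / n)) := by
  have h : Tendsto (fun s : ℂ => ∑ j ∈ Finset.range J,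
      (f.coeff j : ℂ) * (s * riemannZeta (n * s + j))) (𝓝[≠] 0)
      (𝓝 (∑ j ∈ Finset.range J, (f.coeff j : ℂ) * (if j = 1 then 1 / (n : ℂ) else 0))) :=
    tendsto_finsetSum _ fun j _ => (tendsto_mul_riemannZeta hn j).const_mul _
  have h2 : ∑ j ∈ Finset.range J, (f.coeff j : ℂ) * (if j = 1 then 1 / (n : ℂ) else 0) =
      f.coeff 1 / n := by
    simp only [mul_ite, mul_zero, Finset.sum_ite_eq', Finset.mem_range]
    split_ifs with hJ1
    · ring
    · rw [coeff_eq_zero_of_natDegree_lt (by omega)]; simp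
  rw [h2] at h
  refine h.congr fun s => ?_
  rw [zetaComb, Finset.mul_sum]
  exact Finset.sum_congr rfl fun j _ => by ring

theorem tendsto_zetaComb_one {n J : ℕ} (hJ : 0 < J) :
    Tendsto (fun s : ℂ => zetaComb J 1 (n * s)) (𝓝[≠] 0) (𝓝 (-1 / 2)) := by
  have h1 : (fun s : ℂ => zetaComb J 1 (n * s)) = fun s : ℂ => riemannZeta (n * s) := by
    funext s
    rw [zetaComb, Finset.sum_eq_single_of_mem 0 (Finset.mem_range.mpr hJ)]
    · simp
    · intro j _ hj
      simp [coeff_one, hj]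
  have h2 : ContinuousAt (fun s : ℂ => riemannZeta (n * s)) 0 := by
    have : DifferentiableAt ℂ riemannZeta (n * 0) := differentiableAt_riemannZeta (by simp)
    exact ContinuousAt.comp (f := fun s : ℂ => (n : ℂ) * s) this.continuousAt (by fun_prop)
  rw [h1]
  have h3 := h2.tendsto.mono_left (nhdsWithin_le_nhds (s := {0}ᶜ))
  simpa [riemannZeta_zero] using h3

/-- The candidate for the continuation of the shifted polynomial zeta function, to the right of
`re s = (2 - N) / n`. -/
noncomputable def shiftedZeta (n N J : ℕ) (p : ℝ[X]) (l : ℕ → ℝ) (s : ℂ) : ℂ :=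
  (∑ m ∈ Finset.range N, (-s) ^ m / m.factorial * zetaComb J (p ^ m) (n * s)) +
    zetaRemainder n N p l s

theorem hasSum_shiftedZeta {n N J : ℕ} {p : ℝ[X]} {l : ℕ → ℝ} (hp : p.coeff 0 = 0)
    (hl : (fun k : ℕ => l k - p.eval (1 / (k + 1 : ℝ))) =O[atTop]
      fun k : ℕ => (1 / (k + 1 : ℝ)) ^ N) (hN : 1 ≤ N)
    (hJ : ∀ m < N, (p ^ m).natDegree < J) {s : ℂ} (hs : 1 < n * s.re) :
    HasSum (fun k : ℕ => Complex.exp (-(n * s) * Real.log (k + 1)) * Complex.exp (-s * l k))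
      (shiftedZeta n N J p l s) := by
  have hN' : (1 : ℝ) ≤ N := by exact_mod_cast hN
  have h1 := (summable_zetaRemainder (n := n) hp hl (s := s) (by linarith)).hasSum
  have h2 : HasSum (fun k : ℕ => ∑ m ∈ Finset.range N, (-s) ^ m / m.factorial *
      (Complex.exp (-(n * s) * Real.log (k + 1)) * (((p ^ m).eval (1 / (k + 1 : ℝ)) : ℝ) : ℂ)))
      (∑ m ∈ Finset.range N, (-s) ^ m / m.factorial * zetaComb J (p ^ m) (n * s)) :=
    hasSum_sum fun m hm =>
      (hasSum_zetaComb (hJ m (Finset.mem_range.mp hm)) (by simpa using hs)).mul_left _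
  refine (h2.add h1).congr_fun fun k => ?_
  rw [expRemainder, mul_sub, Finset.mul_sum]
  have : ∀ m ∈ Finset.range N, (-s) ^ m / (m.factorial : ℂ) *
      (Complex.exp (-(n * s) * Real.log (k + 1)) * (((p ^ m).eval (1 / (k + 1 : ℝ)) : ℝ) : ℂ)) =
      Complex.exp (-(n * s) * Real.log (k + 1)) *
        ((-s) ^ m / m.factorial * ((p.eval (1 / (k + 1 : ℝ)) : ℝ) : ℂ) ^ m) := fun m _ => by
    rw [eval_pow]; push_cast; ring
  rw [Finset.sum_congr rfl this]
  ring

theorem tendsto_shiftedZeta {n N J : ℕ} {p : ℝ[X]} {l : ℕ → ℝ} (hp : p.coeff 0 = 0)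
    (hl : (fun k : ℕ => l k - p.eval (1 / (k + 1 : ℝ))) =O[atTop]
      fun k : ℕ => (1 / (k + 1 : ℝ)) ^ N) (hn : n ≠ 0) (hN : 3 ≤ N)
    (hJ : ∀ m < N, (p ^ m).natDegree < J) :
    Tendsto (shiftedZeta n N J p l) (𝓝[≠] 0) (𝓝 (-1 / 2 - p.coeff 1 / n)) := by
  obtain ⟨K, rfl⟩ := Nat.exists_eq_add_of_le' hN
  have hr : Tendsto (zetaRemainder n (K + 3) p l) (𝓝[≠] 0) (𝓝 0) := by
    have h0 : (0 : ℂ) ∈ {s : ℂ | 2 < n * s.re + (K + 3 : ℕ)} := by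
      simp only [Set.mem_ofPred_eq, Complex.zero_re, mul_zero, zero_add]
      exact_mod_cast Nat.lt_of_lt_of_le (by norm_num) hN
    have h := ((differentiableOn_zetaRemainder (n := n) hp hl).differentiableAt
      ((isOpen_two_lt_re n (K + 3)).mem_nhds h0)).continuousAt.tendsto
    rw [zetaRemainder_zero (by omega)] at h
    exact h.mono_left nhdsWithin_le_nhds
  have hid : Tendsto (fun s : ℂ => s) (𝓝[≠] 0) (𝓝 0) :=
    tendsto_id.mono_left nhdsWithin_le_nhds
  have hm (m : ℕ) (hm : m + 2 < K + 3) : Tendsto (fun s : ℂ => (-s) ^ (m + 2) /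
      ((m + 2).factorial : ℂ) * zetaComb J (p ^ (m + 2)) (n * s)) (𝓝[≠] 0) (𝓝 0) := by
    have h := ((hid.neg.pow (m + 1)).div_const ((m + 2).factorial : ℂ)).mul
      (tendsto_mul_zetaComb hn (hJ (m + 2) hm)).neg
    simp only [neg_zero, ne_eq, Nat.add_eq_zero_iff, one_ne_zero, and_false, not_false_eq_true,
      zero_pow, zero_div, zero_mul] at h
    refine h.congr fun s => ?_
    ring
  have h1 := tendsto_mul_zetaComb hn (hJ 1 (by omega))
  have h0 := tendsto_zetaComb_one (n := n) (J := J) ((Nat.zero_le _).trans_lt (hJ 0 (by omega)))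
  have hsum : Tendsto (fun s : ℂ => ∑ m ∈ Finset.range (K + 1), (-s) ^ (m + 2) /
      ((m + 2).factorial : ℂ) * zetaComb J (p ^ (m + 2)) (n * s)) (𝓝[≠] 0) (𝓝 0) := by
    simpa using tendsto_finsetSum (Finset.range (K + 1)) fun m hm' =>
      hm m (by have := Finset.mem_range.mp hm'; omega)
  have h := ((hsum.add h1.neg).add h0).add hr
  rw [pow_one] at h
  have hv : (0 : ℂ) + -(p.coeff 1 / n) + -1 / 2 + 0 = -1 / 2 - p.coeff 1 / n := by ring
  rw [hv] at h
  refine h.congr fun s => ?_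
  rw [shiftedZeta, Finset.sum_range_succ' _ (K + 2), Finset.sum_range_succ' _ (K + 1)]
  simp

theorem differentiableAt_shiftedZeta {n N J : ℕ} {p : ℝ[X]} {l : ℕ → ℝ} (hp : p.coeff 0 = 0)
    (hl : (fun k : ℕ => l k - p.eval (1 / (k + 1 : ℝ))) =O[atTop]
      fun k : ℕ => (1 / (k + 1 : ℝ)) ^ N) {s : ℂ} (hs : 2 < n * s.re + N)
    (hs' : ∀ j : ℕ, (n : ℂ) * s + j ≠ 1) :
    DifferentiableAt ℂ (shiftedZeta n N J p l) s := by
  have h1 := (differentiableOn_zetaRemainder (n := n) hp hl).differentiableAt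
      ((isOpen_two_lt_re n N).mem_nhds hs)
  have h2 (j : ℕ) : DifferentiableAt ℂ (fun s : ℂ => riemannZeta (n * s + j)) s :=
    DifferentiableAt.comp (f := fun s : ℂ => (n : ℂ) * s + j) s
      (differentiableAt_riemannZeta (hs' j)) (by fun_prop)
  have h3 (f : ℝ[X]) : DifferentiableAt ℂ (fun s : ℂ => zetaComb J f (n * s)) s := by
    unfold zetaComb
    fun_prop
  unfold shiftedZeta
  fun_prop

/-- The product of `(s - 1)` and `riemannZeta s`, with its removable singularity removed. -/
noncomputable def zetaNumerator : ℂ → ℂ :=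
  Function.update (fun s => (s - 1) * riemannZeta s) 1 1

theorem differentiable_zetaNumerator : Differentiable ℂ zetaNumerator := by
  have h (s : ℂ) (hs : s ≠ 1) : DifferentiableAt ℂ zetaNumerator s := by
    have h1 : DifferentiableAt ℂ (fun s => (s - 1) * riemannZeta s) s :=
      (by fun_prop : DifferentiableAt ℂ (fun s : ℂ => s - 1) s).mul
        (differentiableAt_riemannZeta hs)
    refine h1.congr_of_eventuallyEq ?_
    filter_upwards [isOpen_ne.mem_nhds hs] with w hw
    exact Function.update_of_ne hw _ _
  intro s
  by_cases hs : s = 1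
  · subst hs
    refine (Complex.analyticAt_of_differentiable_on_punctured_nhds_of_continuousAt ?_
      ?_).differentiableAt
    · filter_upwards [self_mem_nhdsWithin] with w hw using h w hw
    · exact continuousAt_update_same.mpr riemannZeta_residue_one
  · exact h s hs

theorem exists_mul_shiftedZeta_eq {n N : ℕ} (J : ℕ) {p : ℝ[X]} {l : ℕ → ℝ} (hp : p.coeff 0 = 0)
    (hl : (fun k : ℕ => l k - p.eval (1 / (k + 1 : ℝ))) =O[atTop]
      fun k : ℕ => (1 / (k + 1 : ℝ)) ^ N) :
    ∃ G : ℂ → ℂ, DifferentiableOn ℂ G {s : ℂ | 2 < n * s.re + N} ∧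
      ∀ s : ℂ, (∀ j : ℕ, (n : ℂ) * s + j ≠ 1) →
        (∏ j ∈ Finset.range J, (n * s + j - 1)) * shiftedZeta n N J p l s = G s := by
  have hG (j : ℕ) : Differentiable ℂ fun s : ℂ => zetaNumerator (n * s + j) :=
    differentiable_zetaNumerator.comp (by fun_prop)
  have hR := differentiableOn_zetaRemainder (n := n) hp hl
  refine ⟨fun s => (∑ m ∈ Finset.range N, (-s) ^ m / m.factorial *
    ∑ j ∈ Finset.range J, ((p ^ m).coeff j : ℂ) *
      ((∏ i ∈ (Finset.range J).erase j, (n * s + i - 1)) * zetaNumerator (n * s + j))) +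
    (∏ j ∈ Finset.range J, (n * s + j - 1)) * zetaRemainder n N p l s, ?_, fun s hs => ?_⟩
  · have h1 : Differentiable ℂ fun s : ℂ => (∑ m ∈ Finset.range N, (-s) ^ m / m.factorial *
        ∑ j ∈ Finset.range J, ((p ^ m).coeff j : ℂ) *
        ((∏ i ∈ (Finset.range J).erase j, (n * s + i - 1)) * zetaNumerator (n * s + j))) := by
      fun_prop
    have h2 : Differentiable ℂ fun s : ℂ => ∏ j ∈ Finset.range J, (n * s + j - 1) := by
      fun_prop
    exact h1.differentiableOn.add (h2.differentiableOn.mul hR)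
  · simp only [shiftedZeta, zetaComb]
    rw [mul_add, Finset.mul_sum]
    congr 1
    refine Finset.sum_congr rfl fun m _ => ?_
    rw [mul_left_comm, Finset.mul_sum]
    congr 1
    refine Finset.sum_congr rfl fun j hj => ?_
    rw [zetaNumerator, Function.update_of_ne (hs j), ← Finset.mul_prod_erase _ _ hj]
    ring

theorem mul_add_natCast_ne_one_of_one_lt_re {n : ℕ} (hn : 1 ≤ n) {s : ℂ} (hs : 1 < s.re) (j : ℕ) :
    (n : ℂ) * s + j ≠ 1 := by
  intro h
  have h1 := congrArg Complex.re h
  simp only [Complex.add_re, Complex.mul_re, Complex.natCast_re, Complex.natCast_im, zero_mul,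
    sub_zero, Complex.one_re] at h1
  have h2 : (1 : ℝ) ≤ n := by exact_mod_cast hn
  nlinarith [(Nat.cast_nonneg j : (0 : ℝ) ≤ j)]

theorem mul_add_natCast_ne_one_of_norm_lt {n : ℕ} {s : ℂ} (hs0 : s ≠ 0)
    (hn : 1 ≤ n) (hs : ‖s‖ < 1 / (2 * n)) (j : ℕ) : (n : ℂ) * s + j ≠ 1 := by
  intro h
  have hn0 : (0 : ℝ) < n := by exact_mod_cast hn
  have h1 : (n : ℂ) * s = ((1 - j : ℤ) : ℂ) := by push_cast; linear_combination h
  have h2 : ‖(n : ℂ) * s‖ < 1 := by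
    rw [norm_mul, Complex.norm_natCast]
    rw [lt_div_iff₀ (by positivity)] at hs
    nlinarith [norm_nonneg s]
  rw [h1, Complex.norm_intCast] at h2
  have h3 : (1 - j : ℤ) = 0 := Int.abs_lt_one_iff.mp (by exact_mod_cast h2)
  rw [h3] at h1
  have hn' : (n : ℂ) ≠ 0 := by exact_mod_cast hn0.ne'
  simp [hn', hs0] at h1

theorem mul_add_natCast_ne_one_of_im_pos {n : ℕ} (hn : 1 ≤ n) {s : ℂ} (hs : 0 < s.im) (j : ℕ) :
    (n : ℂ) * s + j ≠ 1 := by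
  intro h
  have h1 := congrArg Complex.im h
  have h2 : (0 : ℝ) < n := by exact_mod_cast hn
  simp only [Complex.add_im, Complex.mul_im, Complex.natCast_re, Complex.natCast_im, zero_mul,
    Complex.one_im, add_zero] at h1
  exact (mul_pos h2 hs).ne' h1

theorem Pval_ne_zero {n : ℕ} {a : ℕ → ℝ} (han : 0 < a n) {x : Fin n → ℂ}
    (hfact : ∀ z : ℂ, (∑ i ∈ Finset.range (n + 1), (a i : ℂ) * z ^ i)
      = (a n : ℂ) * ∏ i : Fin n, (z - x i))
    (hre : ∀ i, (x i).re < 0) {t : ℝ} (ht : 0 ≤ t) : Pval n a t ≠ 0 := by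
  intro h
  have h1 := hfact t
  have h2 : ∑ i ∈ Finset.range (n + 1), (a i : ℂ) * (t : ℂ) ^ i = (Pval n a t : ℂ) := by
    rw [Pval]; push_cast; rfl
  rw [h2, h, Complex.ofReal_zero, eq_comm, mul_eq_zero, Complex.ofReal_eq_zero] at h1
  obtain ⟨i, -, hi⟩ := Finset.prod_eq_zero_iff.mp (h1.resolve_left han.ne')
  have h3 := hre i
  rw [← sub_eq_zero.mp hi, Complex.ofReal_re] at h3
  exact h3.not_ge ht

/-- The reversed and normalised polynomial `P (1 / t) * t ^ n / aₙ`. -/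
noncomputable def reversedPoly (n : ℕ) (a : ℕ → ℝ) : ℝ[X] :=
  ∑ i ∈ Finset.range (n + 1), C (a (n - i) / a n) * X ^ i

theorem coeff_reversedPoly {n : ℕ} (a : ℕ → ℝ) {i : ℕ} (hi : i ≤ n) :
    (reversedPoly n a).coeff i = a (n - i) / a n := by
  simp only [reversedPoly, finsetSum_coeff, coeff_C_mul_X_pow]
  rw [Finset.sum_ite_eq, if_pos (Finset.mem_range.mpr (by omega))]

theorem Pval_eq_reversedPoly {n : ℕ} {a : ℕ → ℝ} (han : a n ≠ 0) {x : ℝ} (hx : x ≠ 0) :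
    Pval n a x = a n * x ^ n * (reversedPoly n a).eval (1 / x) := by
  rw [Pval, ← Finset.sum_range_reflect, reversedPoly, eval_finsetSum, Finset.mul_sum]
  refine Finset.sum_congr rfl fun i hi => ?_
  have hin : i ≤ n := by have := Finset.mem_range.mp hi; omega
  rw [Nat.add_sub_cancel, eval_C_mul, eval_pow, eval_X]
  have : x ^ n = x ^ (n - i) * x ^ i := by rw [← pow_add, Nat.sub_add_cancel hin]
  rw [this, one_div_pow]
  field_simp

theorem log_Pval_succ {n : ℕ} {a : ℕ → ℝ} (han : 0 < a n)
    (hP : ∀ t : ℝ, 0 ≤ t → Pval n a t ≠ 0) (k : ℕ) :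
    Real.log (Pval n a ((k + 1 : ℕ) : ℝ)) = Real.log (a n) + n * Real.log (k + 1) +
      Real.log ((reversedPoly n a).eval (1 / (k + 1 : ℝ))) := by
  have hk : (k : ℝ) + 1 ≠ 0 := by positivity
  have h := hP ((k + 1 : ℕ) : ℝ) (Nat.cast_nonneg _)
  rw [Nat.cast_add_one] at h ⊢
  rw [Pval_eq_reversedPoly han.ne' hk] at h ⊢
  rw [Real.log_mul (left_ne_zero_of_mul h) (right_ne_zero_of_mul h),
    Real.log_mul han.ne' (pow_ne_zero n hk), Real.log_pow]

theorem polyZeta0_eq_of_hasSum {n : ℕ} {a : ℕ → ℝ} (han : 0 < a n)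
    (hP : ∀ t : ℝ, 0 ≤ t → Pval n a t ≠ 0) {s Y : ℂ}
    (h : HasSum (fun k : ℕ => Complex.exp (-(n * s) * Real.log (k + 1)) * Complex.exp (-s *
      Real.log ((reversedPoly n a).eval (1 / (k + 1 : ℝ))))) Y) :
    polyZeta0 n a s = Complex.exp (-s * Real.log (Pval n a 0)) +
      Complex.exp (-s * Real.log (a n)) * Y := by
  have h1 : HasSum (fun k : ℕ => Complex.exp (-s * (Real.log (Pval n a ((k + 1 : ℕ) : ℝ)) : ℂ)))
      (Complex.exp (-s * Real.log (a n)) * Y) := by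
    refine (h.mul_left _).congr_fun fun k => ?_
    rw [log_Pval_succ han hP, ← Complex.exp_add, ← Complex.exp_add]
    congr 1
    push_cast
    ring
  have h2 := HasSum.zero_add
    (f := fun k : ℕ => Complex.exp (-s * (Real.log (Pval n a (k : ℝ)) : ℂ))) h1
  rw [polyZeta0, h2.tsum_eq, Nat.cast_zero]

/-- Local analytic data for the polynomial zeta function on the half-plane `2 < n * re s + N`. -/
theorem exists_polyZeta0_continuation {n : ℕ} (hn : 1 ≤ n) {a : ℕ → ℝ} (han : 0 < a n)
    (hP : ∀ t : ℝ, 0 ≤ t → Pval n a t ≠ 0) {N : ℕ} (hN : 3 ≤ N) :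
    ∃ F D H : ℂ → ℂ, (∀ s : ℂ, 1 < s.re → F s = polyZeta0 n a s) ∧
      Tendsto F (𝓝[≠] 0) (𝓝 (1 / 2 - 1 / n * (a (n - 1) / a n))) ∧
      (∀ s : ℂ, 2 < n * s.re + N → (∀ j : ℕ, (n : ℂ) * s + j ≠ 1) → DifferentiableAt ℂ F s) ∧
      Differentiable ℂ D ∧ DifferentiableOn ℂ H {s : ℂ | 2 < n * s.re + N} ∧
      ∀ s : ℂ, (∀ j : ℕ, (n : ℂ) * s + j ≠ 1) → D s ≠ 0 ∧ D s * F s = H s := by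
  obtain ⟨K, rfl⟩ := Nat.exists_eq_add_of_le' hN
  have hn1 : (1 : ℝ) ≤ n := by exact_mod_cast hn
  have hQ : (reversedPoly n a).coeff 0 = 1 := by
    rw [coeff_reversedPoly a (Nat.zero_le n), Nat.sub_zero, div_self han.ne']
  obtain ⟨p, hp0, hp1, hpO⟩ := exists_polynomial_log_approx hQ (K + 1)
  rw [coeff_reversedPoly a hn] at hp1
  have hl := hpO.comp_tendsto (tendsto_one_div_add_atTop_nhds_zero_nat (𝕜 := ℝ))
  simp only [Function.comp_def] at hl
  set l : ℕ → ℝ := fun k => Real.log ((reversedPoly n a).eval (1 / (k + 1 : ℝ)))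
  set J := (K + 3) * p.natDegree + 1
  have hJ : ∀ m < K + 3, (p ^ m).natDegree < J := fun m hm =>
    Nat.lt_succ_of_le (natDegree_pow_le.trans (Nat.mul_le_mul_right _ hm.le))
  obtain ⟨G, hG, hGF⟩ := exists_mul_shiftedZeta_eq (n := n) J hp0 hl
  have hE (c : ℝ) : Differentiable ℂ fun s : ℂ => Complex.exp (-s * c) := by fun_prop
  have hD : Differentiable ℂ fun s : ℂ => ∏ j ∈ Finset.range J, (n * s + j - 1) := by fun_prop
  refine ⟨fun s => Complex.exp (-s * Real.log (Pval n a 0)) +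
      Complex.exp (-s * Real.log (a n)) * shiftedZeta n (K + 3) J p l s,
    fun s => ∏ j ∈ Finset.range J, (n * s + j - 1),
    fun s => (∏ j ∈ Finset.range J, (n * s + j - 1)) * Complex.exp (-s * Real.log (Pval n a 0)) +
      Complex.exp (-s * Real.log (a n)) * G s, fun s hs => ?_, ?_, fun s hs hs' => ?_, hD, ?_,
    fun s hs => ⟨?_, ?_⟩⟩
  · exact (polyZeta0_eq_of_hasSum han hP (hasSum_shiftedZeta hp0 hl (by omega) hJ
      (by nlinarith))).symm
  · have hE0 (c : ℝ) : Tendsto (fun s : ℂ => Complex.exp (-s * c)) (𝓝[≠] 0) (𝓝 1) := by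
      have h := (hE c).continuous.tendsto 0
      simp only [neg_zero, zero_mul, Complex.exp_zero] at h
      exact h.mono_left nhdsWithin_le_nhds
    have h := (hE0 (Real.log (Pval n a 0))).add ((hE0 (Real.log (a n))).mul
      (tendsto_shiftedZeta hp0 hl (Nat.one_le_iff_ne_zero.mp hn) hN hJ))
    have hv : (1 : ℂ) + 1 * (-1 / 2 - (p.coeff 1 : ℝ) / n) =
        1 / 2 - 1 / n * (a (n - 1) / a n) := by
      rw [hp1]; push_cast; ring
    rwa [hv] at h
  · exact (hE _ s).add ((hE _ s).mul (differentiableAt_shiftedZeta hp0 hl hs hs'))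
  · exact (hD.mul (hE _)).differentiableOn.add ((hE _).differentiableOn.mul hG)
  · exact Finset.prod_ne_zero_iff.mpr fun j _ => sub_ne_zero.mpr (hs j)
  · simp only [← hGF s hs]
    ring

theorem exists_isPreconnected_subset_halfPlane {n : ℕ} (hn : 1 ≤ n) {U : Set ℂ} (hU : IsOpen U)
    (hUc : IsConnected U) {z w : ℂ} (hz : z ∈ U) (hw : w ∈ U) :
    ∃ (N : ℕ) (V : Set ℂ), 3 ≤ N ∧ IsOpen V ∧ IsPreconnected V ∧ z ∈ V ∧ w ∈ V ∧ V ⊆ U ∧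
      V ⊆ {s : ℂ | 2 < n * s.re + N} := by
  have hn1 : (1 : ℝ) ≤ n := by exact_mod_cast hn
  obtain ⟨γ, hγ⟩ := ((hU.isConnected_iff_isPathConnected).mp hUc).joinedIn z hz w hw
  obtain ⟨M, hM⟩ := (isCompact_range γ.continuous).exists_bound_of_continuousOn
    (f := fun s : ℂ => (n : ℝ) * s.re) (by fun_prop)
  obtain ⟨K, hK⟩ := exists_nat_gt M
  have hsub : Set.range γ ⊆ U ∩ {s : ℂ | 2 < n * s.re + (K + 3 : ℕ)} := by
    rintro _ ⟨t, rfl⟩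
    refine ⟨hγ t, ?_⟩
    have h1 := (abs_le.mp (hM (γ t) ⟨t, rfl⟩)).1
    simp only [Set.mem_ofPred_eq, Nat.cast_add, Nat.cast_ofNat]
    linarith
  have hz' : z ∈ Set.range γ := ⟨0, γ.source⟩
  have hw' : w ∈ Set.range γ := ⟨1, γ.target⟩
  refine ⟨K + 3, connectedComponentIn (U ∩ {s : ℂ | 2 < n * s.re + (K + 3 : ℕ)}) z,
    by omega, (hU.inter (isOpen_two_lt_re n (K + 3))).connectedComponentIn,
    isPreconnected_connectedComponentIn, mem_connectedComponentIn (hsub hz'),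
    (isPreconnected_range γ.continuous).subset_connectedComponentIn hz' hsub hw',
    (connectedComponentIn_subset _ _).trans Set.inter_subset_left,
    (connectedComponentIn_subset _ _).trans Set.inter_subset_right⟩

theorem eventually_mul_add_natCast_ne_one {n : ℕ} (hn : 1 ≤ n) :
    ∀ᶠ s : ℂ in 𝓝[≠] 0, ∀ j : ℕ, (n : ℂ) * s + j ≠ 1 := by
  have hn0 : (0 : ℝ) < n := by exact_mod_cast hn
  filter_upwards [self_mem_nhdsWithin, nhdsWithin_le_nhds
    (Metric.ball_mem_nhds (0 : ℂ) (show (0 : ℝ) < 1 / (2 * n) by positivity))] with s hs hs'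
  exact mul_add_natCast_ne_one_of_norm_lt hs hn (mem_ball_zero_iff.mp hs')

theorem polyZeta0_continuation_apply_zero {n : ℕ} (hn : 1 ≤ n) {a : ℕ → ℝ} (han : 0 < a n)
    (hP : ∀ t : ℝ, 0 ≤ t → Pval n a t ≠ 0) {U : Set ℂ} {Z : ℂ → ℂ} (hU : IsOpen U)
    (hUc : IsConnected U) (h0 : (0 : ℂ) ∈ U) (hU1 : {s : ℂ | 1 < s.re} ⊆ U)
    (hZ : DifferentiableOn ℂ Z U) (hZP : ∀ s : ℂ, 1 < s.re → Z s = polyZeta0 n a s) :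
    Z 0 = 1 / 2 - 1 / n * (a (n - 1) / a n) := by
  have h2 : (2 : ℂ) ∈ {s : ℂ | 1 < s.re} := by simp
  obtain ⟨N, V, hN, hV, hVc, hV0, hV2, hVU, hVN⟩ :=
    exists_isPreconnected_subset_halfPlane hn hU hUc h0 (hU1 h2)
  obtain ⟨F, D, H, hF, hF0, -, hD, hH, hDF⟩ := exists_polyZeta0_continuation hn han hP hN
  have hev : (fun s => D s * Z s) =ᶠ[𝓝 2] H := by
    filter_upwards [(isOpen_lt continuous_const Complex.continuous_re).mem_nhds h2] with s hs
    rw [hZP s hs, ← hF s hs]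
    exact (hDF s (mul_add_natCast_ne_one_of_one_lt_re hn hs)).2
  have heq := AnalyticOnNhd.eqOn_of_preconnected_of_eventuallyEq
    ((hD.differentiableOn.mul (hZ.mono hVU)).analyticOnNhd hV)
    ((hH.mono hVN).analyticOnNhd hV) hVc hV2 hev
  have hZ0 : Tendsto Z (𝓝[≠] 0) (𝓝 (Z 0)) :=
    ((hZ.differentiableAt (hU.mem_nhds h0)).continuousAt.tendsto).mono_left nhdsWithin_le_nhds
  refine tendsto_nhds_unique hZ0 (hF0.congr' ?_)
  filter_upwards [eventually_mul_add_natCast_ne_one hn,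
    nhdsWithin_le_nhds (hV.mem_nhds hV0)] with s hs hsV
  exact mul_left_cancel₀ (hDF s hs).1 ((hDF s hs).2.trans (heq hsV).symm)

theorem isConnected_ball_union_halfPlanes {r : ℝ} (hr : 0 < r) :
    IsConnected (Metric.ball (0 : ℂ) r ∪ ({s : ℂ | 0 < s.im} ∩ {s : ℂ | -r < s.re}) ∪
      {s : ℂ | 1 < s.re}) := by
  refine IsConnected.union ?_ (IsConnected.union ?_ (Metric.isConnected_ball hr) ?_) ?_
  · exact ⟨⟨2, 1⟩, Or.inr ⟨by simp, by simp; linarith⟩, by simp⟩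
  · refine ⟨⟨0, r / 2⟩, ?_, by simp [hr], by simp [hr]⟩
    rw [mem_ball_zero_iff]
    have : (⟨0, r / 2⟩ : ℂ) = ((r / 2 : ℝ) : ℂ) * Complex.I := by
      apply Complex.ext <;> simp
    rw [this, norm_mul, Complex.norm_I, mul_one, Complex.norm_real, Real.norm_eq_abs,
      abs_of_pos (by positivity)]
    linarith
  · exact ((convex_halfSpace_im_gt 0).inter (convex_halfSpace_re_gt (-r))).isConnected
      ⟨⟨0, 1⟩, by simp, by simp [hr]⟩
  · exact (convex_halfSpace_re_gt 1).isConnected ⟨2, by simp⟩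

theorem exists_polyZeta0_continuation_to_zero {n : ℕ} (hn : 1 ≤ n) {a : ℕ → ℝ} (han : 0 < a n)
    (hP : ∀ t : ℝ, 0 ≤ t → Pval n a t ≠ 0) :
    ∃ U : Set ℂ, ∃ Z : ℂ → ℂ, IsOpen U ∧ IsConnected U ∧ (0 : ℂ) ∈ U ∧
      {s : ℂ | 1 < s.re} ⊆ U ∧ DifferentiableOn ℂ Z U ∧
      ∀ s : ℂ, 1 < s.re → Z s = polyZeta0 n a s := by
  have hn0 : (0 : ℝ) < n := by exact_mod_cast hn
  have hr : (0 : ℝ) < 1 / (2 * n) := by positivity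
  obtain ⟨F, -, -, hF, hF0, hFd, -⟩ := exists_polyZeta0_continuation hn han hP le_rfl
  have hne (s : ℂ) (hs : 1 < s.re) : s ≠ 0 := by
    rintro rfl
    simp at hs
    linarith
  have hZd (s : ℂ) (hs : 2 < n * s.re + (3 : ℕ)) (hs0 : s ≠ 0)
      (hs' : ∀ j : ℕ, (n : ℂ) * s + j ≠ 1) : DifferentiableAt ℂ
        (Function.update F 0 (1 / 2 - 1 / n * (a (n - 1) / a n))) s := by
    refine (hFd s hs hs').congr_of_eventuallyEq ?_
    filter_upwards [isOpen_ne.mem_nhds hs0] with w hw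
    exact Function.update_of_ne hw _ _
  have hre (s : ℂ) (hs : -(1 / (2 * n)) < s.re) : 2 < n * s.re + (3 : ℕ) := by
    have : -(1 / 2 : ℝ) < n * s.re := by
      have h := mul_lt_mul_of_pos_left hs hn0
      have h' : (n : ℝ) * -(1 / (2 * n)) = -(1 / 2) := by field_simp
      rwa [h'] at h
    push_cast
    linarith
  have hball (s : ℂ) (hs : s ∈ Metric.ball (0 : ℂ) (1 / (2 * n))) : -(1 / (2 * n)) < s.re :=
    (abs_lt.mp ((Complex.abs_re_le_norm s).trans_lt (mem_ball_zero_iff.mp hs))).1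
  refine ⟨_, Function.update F 0 (1 / 2 - 1 / n * (a (n - 1) / a n)), ?_,
    isConnected_ball_union_halfPlanes hr, Or.inl (Or.inl (Metric.mem_ball_self hr)),
    Set.subset_union_right, fun s hs => DifferentiableAt.differentiableWithinAt ?_,
    fun s hs => ?_⟩
  · exact (Metric.isOpen_ball.union ((isOpen_lt continuous_const Complex.continuous_im).inter
      (isOpen_lt continuous_const Complex.continuous_re))).union
      (isOpen_lt continuous_const Complex.continuous_re)
  · rcases hs with (hs | ⟨hs, hs'⟩) | hs
    · by_cases hs0 : s = 0
      · subst hs0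
        refine (Complex.analyticAt_of_differentiable_on_punctured_nhds_of_continuousAt ?_
          (continuousAt_update_same.mpr hF0)).differentiableAt
        filter_upwards [eventually_mul_add_natCast_ne_one hn, self_mem_nhdsWithin,
          nhdsWithin_le_nhds (Metric.ball_mem_nhds (0 : ℂ) hr)] with w hw hw0 hwr
        exact hZd w (hre w (hball w hwr)) hw0 hw
      · exact hZd s (hre s (hball s hs)) hs0
          (mul_add_natCast_ne_one_of_norm_lt hs0 hn (mem_ball_zero_iff.mp hs))
    · refine hZd s (hre s hs') ?_ (mul_add_natCast_ne_one_of_im_pos hn hs)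
      rintro rfl
      simp at hs
    · refine hZd s (hre s ?_) (hne s hs) (mul_add_natCast_ne_one_of_one_lt_re hn hs)
      have : (1 : ℝ) < s.re := hs
      linarith
  · rw [Function.update_of_ne (hne s hs), hF s hs]

end

/-- `ζ^{(0)}_P` extends holomorphically to `0`, and every holomorphic extension `Z` to an
open connected set containing `0` and `{s : Re s > 1}` satisfies
`Z(0) = 1/2 − (1/n)·a_{n−1}/aₙ`. -/
theorem polyZeta_zero_value_at_zero
    (n : ℕ) (hn : 1 ≤ n) (a : ℕ → ℝ) (han : 0 < a n) (ha0 : a 0 ≠ 0)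
    (x : Fin n → ℂ)
    (hfact : ∀ z : ℂ, (∑ i ∈ Finset.range (n + 1), (a i : ℂ) * z ^ i)
      = (a n : ℂ) * ∏ i : Fin n, (z - x i))
    (hre : ∀ i, (x i).re < 0) :
    (∃ U : Set ℂ, ∃ Z : ℂ → ℂ, IsOpen U ∧ IsConnected U ∧ (0 : ℂ) ∈ U ∧
        {s : ℂ | 1 < s.re} ⊆ U ∧ DifferentiableOn ℂ Z U ∧
        ∀ s : ℂ, 1 < s.re → Z s = polyZeta0 n a s) ∧
    (∀ U : Set ℂ, ∀ Z : ℂ → ℂ, IsOpen U → IsConnected U → (0 : ℂ) ∈ U →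
        {s : ℂ | 1 < s.re} ⊆ U → DifferentiableOn ℂ Z U →
        (∀ s : ℂ, 1 < s.re → Z s = polyZeta0 n a s) →
        Z 0 = 1 / 2 - (1 / (n : ℂ)) * ((a (n - 1) : ℂ) / (a n : ℂ))) := by
  have hP : ∀ t : ℝ, 0 ≤ t → Pval n a t ≠ 0 := fun t ht => Pval_ne_zero han hfact hre ht
  exact ⟨exists_polyZeta0_continuation_to_zero hn han hP,
    fun U Z hU hUc h0 hU1 hZ hZP =>
      polyZeta0_continuation_apply_zero hn han hP hU hUc h0 hU1 hZ hZP⟩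
end

section
/- Let P^0(x) = P(x)/a_n be the associated monic polynomial. Suppose Z is a holomorphic extension of ζ^{(p)}_P and Z^0 is a holomorphic extension of ζ^{(p)}_{P^0}, each defined on an open connected set containing 0 and the half-plane {s : Re s > p + 1} and agreeing there with the respective series. Then Z'(0) = −Z(0) · log a_n + (Z^0)'(0), where log a_n is the real logarithm of a_n. -/
open Filter Topology Asymptotics

/-- A real function analytic at `0` has, along `t = 1 / (k + 1)`, a polynomial expansion of any
order with a uniform error bound. -/
lemma exists_expansion_inv_nat {ψ : ℝ → ℝ} (hψ : AnalyticAt ℝ ψ 0) (M : ℕ) :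
    ∃ d : ℕ → ℝ, ∃ C > 0, ∀ k : ℕ,
      |ψ ((k : ℝ) + 1)⁻¹ - ∑ i ∈ Finset.range M, d i * ((k : ℝ) + 1)⁻¹ ^ i|
        ≤ C * ((k : ℝ) + 1)⁻¹ ^ M := by
  obtain ⟨P, hP⟩ := hψ
  have ht : Tendsto (fun k : ℕ => ((k : ℝ) + 1)⁻¹) atTop (𝓝 0) := by
    simpa using tendsto_one_div_add_atTop_nhds_zero_nat (𝕜 := ℝ)
  obtain ⟨C, hC, h⟩ := bound_of_isBigO_nat_atTop ((hP.isBigO_sub_partialSum_pow M).comp_tendsto ht)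
  refine ⟨P.coeff, C, hC, fun k => ?_⟩
  have hk : (0 : ℝ) < ((k : ℝ) + 1)⁻¹ := by positivity
  have := @h k (pow_pos (norm_pos_iff.2 hk.ne') M).ne'
  simpa [FormalMultilinearSeries.partialSum, abs_of_pos hk, mul_comm,
    abs_of_pos (show (0 : ℝ) < k + 1 by positivity)] using this

/-- Expansion of `exp (-s ψ(1 / (k + 1)))` in powers of `1 / (k + 1)`, with coefficients polynomial
in `s` and an error that is uniform for bounded `s`. -/
lemma exists_expansion_exp {ψ : ℝ → ℝ} (hψ : AnalyticAt ℝ ψ 0) (h0 : ψ 0 = 0) (M : ℕ) :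
    ∃ d : ℕ → ℕ → ℝ, ∀ B : ℝ, 0 ≤ B → ∃ C : ℝ, ∀ (k : ℕ) (s : ℂ), ‖s‖ ≤ B →
      ‖Complex.exp (-s * (ψ ((k : ℝ) + 1)⁻¹ : ℝ)) - ∑ j ∈ Finset.range M, ∑ i ∈ Finset.range M,
        (-s) ^ j / (j.factorial : ℂ) * (d j i : ℂ) * (((k : ℝ) + 1)⁻¹ : ℝ) ^ i‖
        ≤ C * ((k : ℝ) + 1)⁻¹ ^ M := by
  choose d C hC hd using fun j : ℕ => exists_expansion_inv_nat (hψ.pow j) M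
  obtain ⟨d1, C1, hC1, hd1⟩ := exists_expansion_inv_nat hψ 1
  have hd10 : d1 0 = 0 := by
    have ht : Tendsto (fun k : ℕ => ((k : ℝ) + 1)⁻¹) atTop (𝓝 0) := by
      simpa using tendsto_one_div_add_atTop_nhds_zero_nat (𝕜 := ℝ)
    have h1 : Tendsto (fun k : ℕ => |ψ ((k : ℝ) + 1)⁻¹ - d1 0|) atTop (𝓝 |ψ 0 - d1 0|) :=
      ((hψ.continuousAt.tendsto.comp ht).sub_const _).abs
    have h2 : Tendsto (fun k : ℕ => C1 * ((k : ℝ) + 1)⁻¹) atTop (𝓝 (C1 * 0)) := ht.const_mul _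
    have := le_of_tendsto_of_tendsto' h1 h2 (fun k => by simpa using hd1 k)
    simpa [h0] using this
  have hψ1 : ∀ k : ℕ, |ψ ((k : ℝ) + 1)⁻¹| ≤ C1 * ((k : ℝ) + 1)⁻¹ := fun k => by
    simpa [hd10] using hd1 k
  refine ⟨d, fun B hB => ⟨(B * C1) ^ M * Real.exp (B * C1)
    + ∑ j ∈ Finset.range M, B ^ j * C j, fun k s hs => ?_⟩⟩
  set t : ℝ := ((k : ℝ) + 1)⁻¹ with ht
  have ht0 : 0 < t := by positivity
  have ht1 : t ≤ 1 := inv_le_one_of_one_le₀ (by simp)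
  have hx : ‖-s * ((ψ t : ℝ) : ℂ)‖ ≤ B * C1 * t := by
    rw [norm_mul, norm_neg, Complex.norm_real, Real.norm_eq_abs, mul_assoc]
    exact mul_le_mul hs (hψ1 k) (abs_nonneg _) hB
  have hx' : ‖-s * ((ψ t : ℝ) : ℂ)‖ ≤ B * C1 :=
    hx.trans (mul_le_of_le_one_right (by positivity) ht1)
  have e1 : ‖Complex.exp (-s * (ψ t : ℝ))
      - ∑ j ∈ Finset.range M, (-s * (ψ t : ℝ)) ^ j / (j.factorial : ℂ)‖
      ≤ (B * C1) ^ M * Real.exp (B * C1) * t ^ M := by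
    refine (Complex.norm_exp_sub_sum_le_norm_mul_exp _ M).trans ?_
    calc _ ≤ (B * C1 * t) ^ M * Real.exp (B * C1) := by gcongr
      _ = _ := by ring
  have e2 : ‖∑ j ∈ Finset.range M, (-s * (ψ t : ℝ)) ^ j / (j.factorial : ℂ)
      - ∑ j ∈ Finset.range M, ∑ i ∈ Finset.range M,
        (-s) ^ j / (j.factorial : ℂ) * (d j i : ℂ) * (t : ℂ) ^ i‖
      ≤ (∑ j ∈ Finset.range M, B ^ j * C j) * t ^ M := by
    rw [← Finset.sum_sub_distrib, Finset.sum_mul]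
    refine norm_sum_le_of_le _ fun j _ => ?_
    have : (-s * (ψ t : ℝ)) ^ j / (j.factorial : ℂ)
        - ∑ i ∈ Finset.range M, (-s) ^ j / (j.factorial : ℂ) * (d j i : ℂ) * (t : ℂ) ^ i
        = (-s) ^ j / (j.factorial : ℂ)
          * ((ψ t ^ j - ∑ i ∈ Finset.range M, d j i * t ^ i : ℝ) : ℂ) := by
      push_cast
      rw [mul_sub, Finset.mul_sum]
      congr 1
      · ring
      · exact Finset.sum_congr rfl fun i _ => by ring
    rw [this, norm_mul, Complex.norm_real, Real.norm_eq_abs, mul_assoc]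
    refine mul_le_mul ?_ (hd j k) (abs_nonneg _) (by positivity)
    rw [norm_div, norm_pow, norm_neg, Complex.norm_natCast]
    refine (div_le_self (by positivity) (by exact_mod_cast j.factorial_pos)).trans ?_
    gcongr
  rw [add_mul]
  exact (norm_sub_le_norm_sub_add_norm_sub _ _ _).trans (add_le_add e1 e2)

/-- `f`, given on `Re s > σ`, is there a quotient of a function holomorphic on `Re s > -N` by an
entire function with no zeros near `0` except possibly `0`. -/
def HasQuotientExtension (σ N : ℝ) (f : ℂ → ℂ) : Prop :=
  ∃ q G : ℂ → ℂ, Differentiable ℂ q ∧ (∀ᶠ s in 𝓝[≠] 0, q s ≠ 0) ∧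
    DifferentiableOn ℂ G {s | -N < s.re} ∧ ∀ s : ℂ, σ < s.re → q s * f s = G s

namespace HasQuotientExtension

variable {σ N : ℝ} {f g : ℂ → ℂ}

lemma of_differentiableOn (hf : DifferentiableOn ℂ f {s | -N < s.re}) :
    HasQuotientExtension σ N f :=
  ⟨1, f, differentiable_const _, by simp, hf, by simp⟩

lemma congr (hf : HasQuotientExtension σ N f) (h : ∀ s : ℂ, σ < s.re → g s = f s) :
    HasQuotientExtension σ N g := by
  obtain ⟨q, G, h1, h2, h3, h4⟩ := hf
  exact ⟨q, G, h1, h2, h3, fun s hs => by rw [h s hs, h4 s hs]⟩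

lemma add (hf : HasQuotientExtension σ N f) (hg : HasQuotientExtension σ N g) :
    HasQuotientExtension σ N (fun s => f s + g s) := by
  obtain ⟨q, G, h1, h2, h3, h4⟩ := hf
  obtain ⟨r, H, k1, k2, k3, k4⟩ := hg
  refine ⟨fun s => q s * r s, fun s => r s * G s + q s * H s, h1.mul k1, ?_,
    (k1.differentiableOn.mul h3).add (h1.differentiableOn.mul k3), fun s hs => ?_⟩
  · filter_upwards [h2, k2] with s a b using mul_ne_zero a b
  · simp only [← h4 s hs, ← k4 s hs]; ring

lemma entire_mul (hf : HasQuotientExtension σ N f) (hg : Differentiable ℂ g) :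
    HasQuotientExtension σ N (fun s => g s * f s) := by
  obtain ⟨q, G, h1, h2, h3, h4⟩ := hf
  refine ⟨q, fun s => g s * G s, h1, h2, hg.differentiableOn.mul h3, fun s hs => ?_⟩
  simp only [← h4 s hs]; ring

lemma sum {ι : Type*} (S : Finset ι) {F : ι → ℂ → ℂ}
    (hF : ∀ i ∈ S, HasQuotientExtension σ N (F i)) :
    HasQuotientExtension σ N (fun s => ∑ i ∈ S, F i s) := by
  classical
  induction S using Finset.induction_on with
  | empty => simpa using of_differentiableOn (differentiableOn_const (0 : ℂ))
  | insert a S ha ih =>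
    simp only [Finset.sum_insert ha]
    exact (hF a (by simp)).add (ih fun i hi => hF i (by simp [hi]))

/-- Two holomorphic extensions, on possibly different connected open sets, of a function that is a
quotient on every half-plane agree near `0`. -/
lemma eventuallyEq (hf : ∀ N : ℕ, HasQuotientExtension σ N f) {U V : Set ℂ} {Z W : ℂ → ℂ}
    (hU : IsOpen U) (hUc : IsConnected U) (hV : IsOpen V) (hVc : IsConnected V)
    (h0U : (0 : ℂ) ∈ U) (h0V : (0 : ℂ) ∈ V)
    (hUsub : {s : ℂ | σ < s.re} ⊆ U) (hVsub : {s : ℂ | σ < s.re} ⊆ V)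
    (hZ : DifferentiableOn ℂ Z U) (hW : DifferentiableOn ℂ W V)
    (hZf : ∀ s : ℂ, σ < s.re → Z s = f s) (hWf : ∀ s : ℂ, σ < s.re → W s = f s) :
    Z =ᶠ[𝓝 0] W := by
  have key : ∀ {U : Set ℂ} {Z : ℂ → ℂ}, IsOpen U → IsConnected U → (0 : ℂ) ∈ U →
      {s : ℂ | σ < s.re} ⊆ U → DifferentiableOn ℂ Z U → (∀ s : ℂ, σ < s.re → Z s = f s) →
      ∃ N₀ : ℕ, ∀ N : ℕ, N₀ ≤ N → ∀ q G : ℂ → ℂ, Differentiable ℂ q →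
        DifferentiableOn ℂ G {s | -(N : ℝ) < s.re} → (∀ s : ℂ, σ < s.re → q s * f s = G s) →
        ∀ᶠ s in 𝓝 0, q s * Z s = G s := by
    intro U Z hU hUc h0 hsub hZ hZf
    set b : ℂ := ((σ + 1 : ℝ) : ℂ) with hb
    have hbre : σ < b.re := by simp [hb]
    obtain ⟨γ, hγ⟩ := (hU.isConnected_iff_isPathConnected.1 hUc).joinedIn 0 h0 b (hsub hbre)
    obtain ⟨m, hm⟩ := ((isCompact_range γ.continuous).image Complex.continuous_re).bddBelow
    obtain ⟨N₀, hN₀⟩ := exists_nat_gt (-m)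
    refine ⟨N₀, fun N hN q G hq hG hqG => ?_⟩
    have hNm : -(N : ℝ) < m := by
      have : (N₀ : ℝ) ≤ N := by exact_mod_cast hN
      linarith
    have hHo : IsOpen {s : ℂ | -(N : ℝ) < s.re} := isOpen_lt continuous_const Complex.continuous_re
    set T := U ∩ {s : ℂ | -(N : ℝ) < s.re} with hT
    have hTo : IsOpen T := hU.inter hHo
    have hγT : Set.range γ ⊆ T := by
      rintro _ ⟨x, rfl⟩
      exact ⟨hγ x, hNm.trans_le (hm ⟨_, ⟨x, rfl⟩, rfl⟩)⟩
    have h0r : (0 : ℂ) ∈ Set.range γ := ⟨0, γ.source⟩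
    have hbr : b ∈ Set.range γ := ⟨1, γ.target⟩
    set K := connectedComponentIn T 0
    have hKo : IsOpen K := hTo.connectedComponentIn
    have hKT : K ⊆ T := connectedComponentIn_subset _ _
    have hγK : Set.range γ ⊆ K :=
      (isPreconnected_range γ.continuous).subset_connectedComponentIn h0r hγT
    have hqZ : AnalyticOnNhd ℂ (fun s => q s * Z s) K :=
      (hq.differentiableOn.mul (hZ.mono fun s hs => (hKT hs).1)).analyticOnNhd hKo
    have hGK : AnalyticOnNhd ℂ G K := (hG.mono fun s hs => (hKT hs).2).analyticOnNhd hKo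
    have heq := hqZ.eqOn_of_preconnected_of_eventuallyEq hGK isPreconnected_connectedComponentIn
      (hγK hbr) (by
        filter_upwards [(isOpen_lt continuous_const Complex.continuous_re).mem_nhds hbre]
          with s hs
        rw [hZf s hs, hqG s hs])
    filter_upwards [hKo.mem_nhds (hγK h0r)] with s hs using heq hs
  obtain ⟨N₁, h₁⟩ := key hU hUc h0U hUsub hZ hZf
  obtain ⟨N₂, h₂⟩ := key hV hVc h0V hVsub hW hWf
  obtain ⟨q, G, hq, hq0, hG, hqG⟩ := hf (max N₁ N₂)
  have e₁ := h₁ _ (le_max_left _ _) q G hq hG hqG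
  have e₂ := h₂ _ (le_max_right _ _) q G hq hG hqG
  have hp : Z =ᶠ[𝓝[≠] 0] W := by
    filter_upwards [hq0, e₁.filter_mono nhdsWithin_le_nhds, e₂.filter_mono nhdsWithin_le_nhds]
      with s hs a b using mul_left_cancel₀ hs (a.trans b.symm)
  exact (ContinuousAt.eventuallyEq_nhds_iff_eventuallyEq_nhdsNE
    (hZ.differentiableAt (hU.mem_nhds h0U)).continuousAt
    (hW.differentiableAt (hV.mem_nhds h0V)).continuousAt).1 hp

/-- Affine substitutions in the Riemann zeta function. -/
lemma riemannZeta_affine {n : ℕ} (hn : 1 ≤ n) (c : ℂ) (hc : ∀ s : ℂ, σ < s.re → n * s + c ≠ 1) :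
    HasQuotientExtension σ N (fun s => riemannZeta (n * s + c)) := by
  have hn0 : (n : ℂ) ≠ 0 := by exact_mod_cast (by lia : n ≠ 0)
  refine ⟨fun s => n * s + c - 1,
    fun s => Function.update (fun z => (z - 1) * riemannZeta z) 1 1 (n * s + c),
    by fun_prop, ?_, ?_, fun s hs => ?_⟩
  · by_cases h : (1 - c) / n = 0
    · filter_upwards [self_mem_nhdsWithin] with s hs h1
      apply hs
      have : (n : ℂ) * s = 1 - c := by linear_combination h1
      rw [Set.mem_singleton_iff, ← h, ← this]; field_simp
    · filter_upwards [nhdsWithin_le_nhds (isOpen_ne.mem_nhds (Ne.symm h))] with s hs h1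
      apply hs
      have : (n : ℂ) * s = 1 - c := by linear_combination h1
      rw [← this]; field_simp
  · have hd : Differentiable ℂ (Function.update (fun z => (z - 1) * riemannZeta z) 1 1) := by
      simpa [DirichletCharacter.LFunctionTrivChar₁, DirichletCharacter.LFunctionTrivChar,
        DirichletCharacter.LFunction_modOne_eq]
        using DirichletCharacter.differentiable_LFunctionTrivChar₁ 1
    exact (hd.comp (by fun_prop : Differentiable ℂ fun s : ℂ => n * s + c)).differentiableOn
  · simp [Function.update_of_ne (hc s hs)]

end HasQuotientExtension

lemma norm_pow_mul_exp_log_le (p n N k : ℕ) {s : ℂ} (hs : -(N : ℝ) < s.re) :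
    ‖((k : ℂ) + 1) ^ p * Complex.exp (-s * (n * Real.log ((k : ℝ) + 1) : ℝ))‖
      ≤ ((k : ℝ) + 1) ^ (p + n * N) := by
  have hk : (0 : ℝ) < (k : ℝ) + 1 := by positivity
  have hl : 0 ≤ Real.log ((k : ℝ) + 1) := Real.log_nonneg (by simp)
  have h1 : ‖(k : ℂ) + 1‖ = (k : ℝ) + 1 := by
    rw [← abs_of_pos hk, ← Real.norm_eq_abs, ← Complex.norm_real]; push_cast; rfl
  rw [norm_mul, norm_pow, h1, pow_add, Complex.norm_exp, Complex.re_mul_ofReal]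
  gcongr
  calc _ ≤ Real.exp ((n * N : ℕ) * Real.log ((k : ℝ) + 1)) := by
        refine Real.exp_le_exp.2 ?_
        rw [Complex.neg_re]; push_cast
        nlinarith [mul_le_mul_of_nonneg_right (neg_lt.1 hs).le
          (mul_nonneg (Nat.cast_nonneg (α := ℝ) n) hl)]
    _ = _ := by rw [Real.exp_nat_mul, Real.exp_log hk]

lemma pow_mul_exp_log_mul_inv_pow (p n i k : ℕ) (s : ℂ) :
    ((k : ℂ) + 1) ^ p * Complex.exp (-s * (n * Real.log ((k : ℝ) + 1) : ℝ))
      * ((((k : ℝ) + 1)⁻¹ : ℝ) : ℂ) ^ i = 1 / ((k : ℂ) + 1) ^ (n * s + (i - p)) := by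
  have hk : (k : ℂ) + 1 ≠ 0 := by exact_mod_cast k.succ_ne_zero
  have hl : ((Real.log ((k : ℝ) + 1) : ℝ) : ℂ) = Complex.log ((k : ℂ) + 1) := by
    rw [Complex.ofReal_log (by positivity)]; push_cast; rfl
  rw [Complex.cpow_add _ _ hk, Complex.cpow_sub _ _ hk, Complex.cpow_natCast, Complex.cpow_natCast,
    Complex.cpow_def_of_ne_zero hk, one_div, mul_inv, ← Complex.exp_neg]
  push_cast
  rw [hl, inv_div, inv_pow]
  rw [show -s * (n * Complex.log ((k : ℂ) + 1)) = -(Complex.log ((k : ℂ) + 1) * (n * s)) by ring]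
  field_simp

lemma hasSum_zeta_shift {s : ℂ} (hs : 1 < s.re) :
    HasSum (fun k : ℕ => 1 / ((k : ℂ) + 1) ^ s) (riemannZeta s) := by
  rw [zeta_eq_tsum_one_div_nat_add_one_cpow hs]
  refine Summable.hasSum ?_
  simpa using (summable_nat_add_iff 1).2 (Complex.summable_one_div_nat_cpow.2 hs)

/-- Continuation of `∑ (k + 1) ^ p (k + 1) ^ (-n s) exp (-s ψ(1 / (k + 1)))`. -/
lemma hasQuotientExtension_tsum {ψ : ℝ → ℝ} (hψ : AnalyticAt ℝ ψ 0) (h0 : ψ 0 = 0)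
    {n : ℕ} (hn : 1 ≤ n) (p N : ℕ) :
    (∀ s : ℂ, (p : ℝ) + 1 < s.re → Summable fun k : ℕ =>
      ((k : ℂ) + 1) ^ p * Complex.exp (-s * (n * Real.log ((k : ℝ) + 1) : ℝ))
        * Complex.exp (-s * (ψ ((k : ℝ) + 1)⁻¹ : ℝ))) ∧
    HasQuotientExtension ((p : ℝ) + 1) N (fun s => ∑' k : ℕ,
      ((k : ℂ) + 1) ^ p * Complex.exp (-s * (n * Real.log ((k : ℝ) + 1) : ℝ))
        * Complex.exp (-s * (ψ ((k : ℝ) + 1)⁻¹ : ℝ))) := by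
  set M := p + n * N + 2 with hM
  obtain ⟨d, hd⟩ := exists_expansion_exp hψ h0 M
  set E : ℕ → ℂ → ℂ := fun k s =>
    ((k : ℂ) + 1) ^ p * Complex.exp (-s * (n * Real.log ((k : ℝ) + 1) : ℝ)) with hE
  set R : ℕ → ℂ → ℂ := fun k s => Complex.exp (-s * (ψ ((k : ℝ) + 1)⁻¹ : ℝ))
    - ∑ j ∈ Finset.range M, ∑ i ∈ Finset.range M,
        (-s) ^ j / (j.factorial : ℂ) * (d j i : ℂ) * (((k : ℝ) + 1)⁻¹ : ℝ) ^ i with hR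
  have hsq : Summable fun k : ℕ => ((k : ℝ) + 1)⁻¹ ^ 2 := by
    simpa using (summable_nat_add_iff 1).2 (Real.summable_nat_pow_inv.2 (one_lt_two))
  have hbound : ∀ B : ℝ, 0 ≤ B → ∃ C : ℝ, ∀ (k : ℕ) (s : ℂ), -(N : ℝ) < s.re → ‖s‖ ≤ B →
      ‖E k s * R k s‖ ≤ C * ((k : ℝ) + 1)⁻¹ ^ 2 := by
    intro B hB
    obtain ⟨C, hC⟩ := hd B hB
    refine ⟨C, fun k s hs hsB => ?_⟩
    rw [norm_mul]
    calc _ ≤ ((k : ℝ) + 1) ^ (p + n * N) * (C * ((k : ℝ) + 1)⁻¹ ^ M) :=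
          mul_le_mul (norm_pow_mul_exp_log_le p n N k hs) (hC k s hsB) (norm_nonneg _)
            (by positivity)
      _ = _ := by
          have : (k : ℝ) + 1 ≠ 0 := by positivity
          rw [hM, pow_add ((k : ℝ) + 1)⁻¹, inv_pow _ (p + n * N)]
          field_simp
  have hrem : DifferentiableOn ℂ (fun s => ∑' k, E k s * R k s) {s | -(N : ℝ) < s.re} := by
    intro s hs
    obtain ⟨C, hC⟩ := hbound (‖s‖ + 1) (by positivity)
    have ho : IsOpen ({s : ℂ | -(N : ℝ) < s.re} ∩ Metric.ball 0 (‖s‖ + 1)) :=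
      (isOpen_lt continuous_const Complex.continuous_re).inter Metric.isOpen_ball
    have := Complex.differentiableOn_tsum_of_summable_norm (F := fun k s => E k s * R k s)
      (hsq.mul_left C)
      (fun k => Differentiable.differentiableOn (by simp only [hE, hR]; fun_prop)) ho
      (fun k w hw => hC k w hw.1 (by simpa using (mem_ball_zero_iff.1 hw.2).le))
    exact (this.differentiableAt (ho.mem_nhds ⟨hs, by simp⟩)).differentiableWithinAt
  have hre : ∀ (s : ℂ) (i : ℕ), (p : ℝ) + 1 < s.re → 1 < ((n : ℂ) * s + (i - p)).re := by
    intro s i hs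
    have h1 : (1 : ℝ) ≤ n := by exact_mod_cast hn
    have h2 : (0 : ℝ) ≤ i := by positivity
    have h3 : (0 : ℝ) ≤ p := by positivity
    simp only [Complex.add_re, Complex.sub_re, Complex.natCast_re, Complex.mul_re,
      Complex.natCast_im, zero_mul, sub_zero]
    nlinarith
  have hsum : ∀ s : ℂ, (p : ℝ) + 1 < s.re → HasSum
      (fun k => E k s * Complex.exp (-s * (ψ ((k : ℝ) + 1)⁻¹ : ℝ)))
      (∑ j ∈ Finset.range M, ∑ i ∈ Finset.range M,
        (-s) ^ j / (j.factorial : ℂ) * (d j i : ℂ) * riemannZeta (n * s + (i - p))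
        + ∑' k, E k s * R k s) := by
    intro s hs
    obtain ⟨C, hC⟩ := hbound ‖s‖ (norm_nonneg _)
    have hsN : -(N : ℝ) < s.re := by
      have : (0 : ℝ) ≤ N := by positivity
      have : (0 : ℝ) ≤ p := by positivity
      linarith
    have hRs : HasSum (fun k => E k s * R k s) (∑' k, E k s * R k s) :=
      (Summable.of_norm_bounded (hsq.mul_left C) fun k => hC k s hsN le_rfl).hasSum
    have hmain := (hasSum_sum (s := Finset.range M) fun j _ => hasSum_sum (s := Finset.range M)
      fun i _ => (hasSum_zeta_shift (hre s i hs)).mul_left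
        ((-s) ^ j / (j.factorial : ℂ) * (d j i : ℂ))).add hRs
    refine hmain.congr_fun fun k => ?_
    simp only [hR, hE, mul_sub, Finset.mul_sum, ← pow_mul_exp_log_mul_inv_pow]
    rw [add_sub_left_comm, left_eq_add, sub_eq_zero]
    exact Finset.sum_congr rfl fun j _ => Finset.sum_congr rfl fun i _ => by ring
  refine ⟨fun s hs => (hsum s hs).summable, HasQuotientExtension.congr ?_
    fun s hs => (hsum s hs).tsum_eq⟩
  refine .add (.sum _ fun j _ => .sum _ fun i _ => ?_) (.of_differentiableOn hrem)
  exact (HasQuotientExtension.riemannZeta_affine hn _ fun s hs h => by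
    have := hre s i hs; rw [h] at this; simp at this).entire_mul (by fun_prop)

/-- The polynomial zeta series is a quotient of holomorphic functions on every half-plane. -/
lemma hasQuotientExtension_polyZeta {n : ℕ} (hn : 1 ≤ n) {a : ℕ → ℝ} (han : 0 < a n)
    (hP : ∀ k : ℕ, Pval n a k ≠ 0) (p N : ℕ) :
    HasQuotientExtension ((p : ℝ) + 1) N (fun s => ∑' k : ℕ,
      (k : ℂ) ^ p * Complex.exp (-s * (Real.log (Pval n a k) : ℂ))) := by
  set g : ℝ → ℝ := fun t => ∑ i ∈ Finset.range (n + 1), a i / a n * t ^ (n - i) with hg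
  have hg0 : g 0 = 1 := by
    simp only [hg]
    rw [Finset.sum_range_succ, Finset.sum_eq_zero]
    · simp [han.ne']
    · intro i hi
      have : n - i ≠ 0 := by have := Finset.mem_range.1 hi; lia
      simp [this]
  have hga : AnalyticAt ℝ g 0 := by simp only [hg]; fun_prop
  have hψ : AnalyticAt ℝ (fun t => Real.log (g t)) 0 := hga.log (by simp [hg0])
  have hPg : ∀ k : ℕ, Pval n a ((k : ℝ) + 1)
      = a n * (((k : ℝ) + 1) ^ n * g ((k : ℝ) + 1)⁻¹) := by
    intro k
    have hk : (k : ℝ) + 1 ≠ 0 := by positivity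
    simp only [hg, Pval, Finset.mul_sum]
    refine Finset.sum_congr rfl fun i hi => ?_
    have hi' : i ≤ n := by have := Finset.mem_range.1 hi; lia
    rw [← Nat.sub_add_cancel hi', pow_add, Nat.add_sub_cancel, inv_pow,
      Nat.sub_add_cancel hi']
    field_simp
  have hlog : ∀ k : ℕ, Real.log (Pval n a ((k : ℝ) + 1))
      = Real.log (a n) + (n * Real.log ((k : ℝ) + 1) + Real.log (g ((k : ℝ) + 1)⁻¹)) := by
    intro k
    have hne := hP (k + 1)
    push_cast at hne
    rw [hPg] at hne ⊢
    have h2 := right_ne_zero_of_mul hne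
    rw [Real.log_mul han.ne' h2, Real.log_mul (left_ne_zero_of_mul h2) (right_ne_zero_of_mul h2),
      Real.log_pow]
  obtain ⟨hs, hT⟩ := hasQuotientExtension_tsum hψ (by simp [hg0]) hn p N
  have hterm : ∀ (s : ℂ) (k : ℕ), ((k + 1 : ℕ) : ℂ) ^ p
      * Complex.exp (-s * (Real.log (Pval n a ((k + 1 : ℕ) : ℝ)) : ℂ))
      = Complex.exp (-s * (Real.log (a n) : ℂ)) * (((k : ℂ) + 1) ^ p
        * Complex.exp (-s * (n * Real.log ((k : ℝ) + 1) : ℝ))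
        * Complex.exp (-s * (Real.log (g ((k : ℝ) + 1)⁻¹) : ℝ))) := by
    intro s k
    push_cast
    rw [hlog]
    push_cast
    rw [mul_add, mul_add, Complex.exp_add, Complex.exp_add]
    ring
  refine HasQuotientExtension.congr (f := fun s =>
    (0 : ℂ) ^ p * Complex.exp (-s * (Real.log (Pval n a 0) : ℂ)) + _ * _)
    (.add (.of_differentiableOn (Differentiable.differentiableOn (by fun_prop)))
    (hT.entire_mul (g := fun s => Complex.exp (-s * (Real.log (a n) : ℂ))) (by fun_prop)))
    fun s hs' => ?_
  rw [Summable.tsum_eq_zero_add]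
  · simp only [hterm, tsum_mul_left]
    simp
  · rw [← summable_nat_add_iff 1]
    simp only [hterm]
    exact (hs s hs').mul_left _

lemma Pval_natCast_ne_zero {n : ℕ} {a : ℕ → ℝ} (han : a n ≠ 0) {x : Fin n → ℂ}
    (hfact : ∀ z : ℂ, (∑ i ∈ Finset.range (n + 1), (a i : ℂ) * z ^ i)
      = (a n : ℂ) * ∏ i : Fin n, (z - x i))
    (hre : ∀ i, (x i).re < 0) (k : ℕ) : Pval n a k ≠ 0 := by
  intro h
  have h1 := hfact k
  have h2 : (∑ i ∈ Finset.range (n + 1), (a i : ℂ) * (k : ℂ) ^ i) = ((Pval n a k : ℝ) : ℂ) := by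
    simp [Pval]
  rw [h2, h, Complex.ofReal_zero, eq_comm, mul_eq_zero, Finset.prod_eq_zero_iff] at h1
  rcases h1 with h1 | ⟨i, -, hi⟩
  · exact han (by exact_mod_cast h1)
  · have := hre i
    rw [← sub_eq_zero.1 hi, Complex.natCast_re] at this
    exact absurd this (by simp)

/-- If `Z` is a holomorphic extension of `ζ^{(p)}_P` and `Z⁰` a holomorphic extension of
`ζ^{(p)}_{P⁰}` (with `P⁰ = P/aₙ` the associated monic polynomial), each on an open connected
set containing `0` and `{s : Re s > p + 1}`, then `Z′(0) = −Z(0)·log aₙ + (Z⁰)′(0)`. -/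
theorem polyZeta_deriv_monic_relation
    (n : ℕ) (hn : 1 ≤ n) (a : ℕ → ℝ) (han : 0 < a n) (ha0 : a 0 ≠ 0)
    (x : Fin n → ℂ)
    (hfact : ∀ z : ℂ, (∑ i ∈ Finset.range (n + 1), (a i : ℂ) * z ^ i)
      = (a n : ℂ) * ∏ i : Fin n, (z - x i))
    (hre : ∀ i, (x i).re < 0)
    (p : ℕ)
    (U U0 : Set ℂ) (Z Z0 : ℂ → ℂ)
    (hU : IsOpen U) (hUc : IsConnected U) (hU0 : IsOpen U0) (hU0c : IsConnected U0)
    (h0U : (0 : ℂ) ∈ U) (h0U0 : (0 : ℂ) ∈ U0)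
    (hUsub : {s : ℂ | (p : ℝ) + 1 < s.re} ⊆ U) (hU0sub : {s : ℂ | (p : ℝ) + 1 < s.re} ⊆ U0)
    (hZ : DifferentiableOn ℂ Z U) (hZ0 : DifferentiableOn ℂ Z0 U0)
    (hZeq : ∀ s : ℂ, (p : ℝ) + 1 < s.re →
      Z s = ∑' k : ℕ, (k : ℂ) ^ p * Complex.exp (-s * (Real.log (Pval n a k) : ℂ)))
    (hZ0eq : ∀ s : ℂ, (p : ℝ) + 1 < s.re →
      Z0 s = ∑' k : ℕ, (k : ℂ) ^ p * Complex.exp (-s * (Real.log (Pval n a k / a n) : ℂ))) :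
    deriv Z 0 = -(Z 0) * (Real.log (a n) : ℂ) + deriv Z0 0 := by
  have hP := Pval_natCast_ne_zero han.ne' hfact hre
  have hev : Z =ᶠ[𝓝 0] fun s => Complex.exp (-s * (Real.log (a n) : ℂ)) * Z0 s := by
    refine HasQuotientExtension.eventuallyEq (hasQuotientExtension_polyZeta hn han hP p) hU hUc
      hU0 hU0c h0U h0U0 hUsub hU0sub hZ
      ((Differentiable.differentiableOn (by fun_prop)).mul hZ0) hZeq fun s hs => ?_
    rw [hZ0eq s hs, ← tsum_mul_left]
    refine tsum_congr fun k => ?_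
    rw [Real.log_div (hP k) han.ne', Complex.ofReal_sub, mul_left_comm, ← Complex.exp_add]
    congr 2
    ring
  have hd := (hZ0.differentiableAt (hU0.mem_nhds h0U0)).hasDerivAt
  have he : HasDerivAt (fun s : ℂ => Complex.exp (-s * (Real.log (a n) : ℂ)))
      (-(Real.log (a n) : ℂ)) 0 := by
    simpa using ((hasDerivAt_id (0 : ℂ)).neg.mul_const (Real.log (a n) : ℂ)).cexp
  have h0 : Z 0 = Z0 0 := by simpa using hev.eq_of_nhds
  rw [hev.deriv_eq, (he.fun_mul hd).deriv, h0]
  simp [mul_comm]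
end

section
/- Let p be a natural number and let Z be a holomorphic extension of ζ^{(p)}_P to an open connected set containing 0 and the half-plane {s : Re s > p + 1}. Then Z'(0) = −Z(0) · log a_n + (1/(2n)) Σ_{l=1}^{p} [ (1/(l(p+1−l))) · (Σ_{i=1}^n x_i^l)(Σ_{j=1}^n x_j^{p−l+1}) ] − (H_p/(p+1)) · Σ_{i=1}^n x_i^{p+1} + Σ_{i=1}^n Σ_{l=0}^{p} C(p,l) · x_i^{p−l} · h_i'(−l), where H_p = Σ_{i=1}^p 1/i (H_0 = 0), C(p,l) is the binomial coefficient, and log a_n is the real logarithm of a_n. -/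
open Filter Topology

/-- A punctured disc in the complex plane is preconnected. -/
theorem isPreconnected_ball_diff_center (s : ℂ) {r : ℝ} (hr : 0 < r) :
    IsPreconnected (Metric.ball s r \ {s}) := by
  have himage : Metric.ball s r \ {s} = (fun z => s + Complex.exp z) '' {z | z.re < Real.log r} := by
    ext t
    simp only [Set.mem_sdiff, Metric.mem_ball, Set.mem_singleton_iff, Set.mem_image,
      Set.mem_ofPred_eq, dist_eq_norm]
    constructor
    · rintro ⟨ht, hne⟩
      have hne' : t - s ≠ 0 := sub_ne_zero.2 hne
      refine ⟨Complex.log (t - s), ?_, ?_⟩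
      · rw [Complex.log_re]
        exact Real.log_lt_log (norm_pos_iff.2 hne') ht
      · rw [Complex.exp_log hne']; ring
    · rintro ⟨z, hz, rfl⟩
      refine ⟨?_, by simp [Complex.exp_ne_zero]⟩
      rw [add_sub_cancel_left, Complex.norm_exp]
      exact (Real.lt_log_iff_exp_lt hr).1 hz
  rw [himage]
  exact (convex_halfSpace_re_lt _).isPreconnected.image _ (by fun_prop)

/-- Identity principle along a preconnected set for a function with isolated singularities. -/
theorem eventually_eq_zero_of_isPreconnected {f : ℂ → ℂ} {K : Set ℂ} (hK : IsPreconnected K)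
    (hf : ∀ s ∈ K, ∀ᶠ t in 𝓝[≠] s, DifferentiableAt ℂ f t) {s₀ : ℂ} (hs₀ : s₀ ∈ K)
    (h₀ : ∀ᶠ t in 𝓝[≠] s₀, f t = 0) {s : ℂ} (hs : s ∈ K) : ∀ᶠ t in 𝓝[≠] s, f t = 0 := by
  refine hK.subset_of_closure_inter_subset (u := {s | ∀ᶠ t in 𝓝[≠] s, f t = 0}) ?_
    ⟨s₀, hs₀, h₀⟩ ?_ hs
  · rw [isOpen_iff_eventually]
    intro s hs
    have h1 := eventually_nhdsWithin_iff.1 (eventually_eventually_nhdsWithin.2 hs)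
    filter_upwards [h1] with t ht
    by_cases hts : t = s
    · exact hts ▸ hs
    · have h2 := ht hts
      rw [isOpen_compl_singleton.nhdsWithin_eq hts] at h2
      exact h2.filter_mono nhdsWithin_le_nhds
  · rintro s ⟨hcl, hsK⟩
    obtain ⟨r, hr, hball⟩ := Metric.mem_nhdsWithin_iff.1 (hf s hsK)
    obtain ⟨t, htr, htA⟩ := mem_closure_iff.1 hcl _ Metric.isOpen_ball (Metric.mem_ball_self hr)
    replace htA : ∀ᶠ u in 𝓝[≠] t, f u = 0 := htA
    by_cases hts : t = s
    · exact hts ▸ htA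
    have hopen : IsOpen (Metric.ball s r \ {s}) := Metric.isOpen_ball.sdiff isClosed_singleton
    have hdiff : DifferentiableOn ℂ f (Metric.ball s r \ {s}) :=
      fun t ht => (hball ht).differentiableWithinAt
    have hzero := (hdiff.analyticOnNhd hopen).eqOn_zero_of_preconnected_of_frequently_eq_zero
      (isPreconnected_ball_diff_center s hr) ⟨htr, hts⟩ htA.frequently
    refine Metric.mem_nhdsWithin_iff.2 ⟨r, hr, fun t ht => hzero ht⟩

theorem norm_natCast_add_one_cpow (k : ℕ) (z : ℂ) :
    ‖((k : ℂ) + 1) ^ z‖ = ((k : ℝ) + 1) ^ z.re := by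
  have h := Complex.norm_cpow_eq_rpow_re_of_pos (x := (k : ℝ) + 1) (by positivity) z
  simpa using h

theorem natCast_add_one_ne_zero' (k : ℕ) : (k : ℂ) + 1 ≠ 0 := Nat.cast_add_one_ne_zero k

theorem summable_natCast_add_one_rpow {r : ℝ} (hr : r < -1) :
    Summable fun k : ℕ => ((k : ℝ) + 1) ^ r := by
  have h := (summable_nat_add_iff 1).2 (Real.summable_nat_rpow.2 hr)
  simpa using h

theorem exists_bound_exp_sub_truncation {J : ℕ} {v : ℕ → ℂ} {V : Polynomial ℂ} {B : ℝ}
    (hv : ∀ k : ℕ, ‖v k‖ ≤ B / ((k : ℝ) + 1))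
    (hV : ∀ k : ℕ, ‖v k - V.eval ((k : ℂ) + 1)⁻¹‖ ≤ B / ((k : ℝ) + 1) ^ J) (M : ℝ) :
    ∃ C : ℝ, ∀ s : ℂ, ‖s‖ ≤ M → ∀ k : ℕ,
      ‖Complex.exp (-s * v k) - ∑ m ∈ Finset.range J,
        (-s) ^ m / (m.factorial : ℂ) * V.eval ((k : ℂ) + 1)⁻¹ ^ m‖ ≤ C / ((k : ℝ) + 1) ^ J := by
  have hB : 0 ≤ B := by simpa using (norm_nonneg _).trans (hv 0)
  have hvB : ∀ k, ‖v k‖ ≤ B := fun k =>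
    (hv k).trans (div_le_self hB (by linarith [(Nat.cast_nonneg k : (0 : ℝ) ≤ k)]))
  have hVB : ∀ k : ℕ, ‖V.eval ((k : ℂ) + 1)⁻¹‖ ≤ 2 * B := fun k => by
    have h1 : ‖v k - V.eval ((k : ℂ) + 1)⁻¹‖ ≤ B := (hV k).trans
      (div_le_self hB (one_le_pow₀ (by linarith [(Nat.cast_nonneg k : (0 : ℝ) ≤ k)])))
    have h2 := norm_sub_norm_le (V.eval ((k : ℂ) + 1)⁻¹) (v k)
    rw [norm_sub_rev] at h2
    linarith [hvB k]
  have hpow : ∀ m : ℕ, ∃ C : ℝ, ∀ k : ℕ,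
      ‖v k ^ m - V.eval ((k : ℂ) + 1)⁻¹ ^ m‖ ≤ C / ((k : ℝ) + 1) ^ J := by
    intro m
    induction m with
    | zero => exact ⟨0, fun k => by simp⟩
    | succ m ih =>
      obtain ⟨C, hC⟩ := ih
      refine ⟨C * B + (2 * B) ^ m * B, fun k => ?_⟩
      calc ‖v k ^ (m + 1) - V.eval ((k : ℂ) + 1)⁻¹ ^ (m + 1)‖
          = ‖(v k ^ m - V.eval ((k : ℂ) + 1)⁻¹ ^ m) * v k
              + V.eval ((k : ℂ) + 1)⁻¹ ^ m * (v k - V.eval ((k : ℂ) + 1)⁻¹)‖ := by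
            congr 1; ring
        _ ≤ C / ((k : ℝ) + 1) ^ J * B + (2 * B) ^ m * (B / ((k : ℝ) + 1) ^ J) := by
            refine (norm_add_le _ _).trans ?_
            rw [norm_mul, norm_mul, norm_pow]
            have := (norm_nonneg _).trans (hC k)
            gcongr
            · exact hC k
            · exact hvB k
            · exact hVB k
            · exact hV k
        _ = _ := by ring
  choose C hC using hpow
  refine ⟨(M * B) ^ J * Real.exp (M * B)
    + ∑ m ∈ Finset.range J, M ^ m / (m.factorial : ℝ) * C m, fun s hs k => ?_⟩
  have hM : 0 ≤ M := (norm_nonneg s).trans hs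
  have hk : (0 : ℝ) < (k : ℝ) + 1 := by positivity
  have hsplit : Complex.exp (-s * v k) - ∑ m ∈ Finset.range J,
        (-s) ^ m / (m.factorial : ℂ) * V.eval ((k : ℂ) + 1)⁻¹ ^ m
      = (Complex.exp (-s * v k) - ∑ m ∈ Finset.range J, (-s * v k) ^ m / (m.factorial : ℂ))
        + ∑ m ∈ Finset.range J, (-s) ^ m / (m.factorial : ℂ)
          * (v k ^ m - V.eval ((k : ℂ) + 1)⁻¹ ^ m) := by
    rw [sub_add, ← Finset.sum_sub_distrib]
    congr 1
    refine Finset.sum_congr rfl fun m _ => ?_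
    rw [mul_pow]; ring
  rw [hsplit, add_div, Finset.sum_div]
  refine (norm_add_le _ _).trans (add_le_add ?_ ((norm_sum_le _ _).trans
    (Finset.sum_le_sum fun m _ => ?_)))
  · refine (Complex.norm_exp_sub_sum_le_norm_mul_exp _ _).trans ?_
    have h1 : ‖-s * v k‖ ≤ M * B / ((k : ℝ) + 1) := by
      rw [norm_mul, norm_neg, mul_div_assoc]
      exact mul_le_mul hs (hv k) (norm_nonneg _) hM
    have h2 : ‖-s * v k‖ ≤ M * B := by
      rw [norm_mul, norm_neg]
      exact mul_le_mul hs (hvB k) (norm_nonneg _) hM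
    calc ‖-s * v k‖ ^ J * Real.exp ‖-s * v k‖
        ≤ (M * B / ((k : ℝ) + 1)) ^ J * Real.exp (M * B) := by gcongr
      _ = _ := by rw [div_pow]; ring
  · rw [norm_mul, norm_div, norm_pow, norm_neg, Complex.norm_natCast, mul_div_assoc]
    have := (norm_nonneg _).trans (hC m k)
    gcongr
    exact hC m k

/-- Sums `∑ (k + 1) ^ (p - n s) ρ(s, k)` with `ρ(s, k) = O((k + 1) ^ (-J))`, locally uniformly
in `s`. -/
theorem tsum_cpow_mul_of_bound {n p J : ℕ} {ρ : ℂ → ℕ → ℂ}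
    (hρ : ∀ k, Differentiable ℂ fun s => ρ s k)
    (hbound : ∀ M : ℝ, ∃ C : ℝ, ∀ s : ℂ, ‖s‖ ≤ M → ∀ k : ℕ, ‖ρ s k‖ ≤ C / ((k : ℝ) + 1) ^ J)
    (h₀ : ∀ k, ρ 0 k = 0) (h₁ : ∀ k, HasDerivAt (fun s => ρ s k) 0 0) :
    DifferentiableOn ℂ (fun s : ℂ => ∑' k : ℕ, ((k : ℂ) + 1) ^ ((p : ℂ) - n * s) * ρ s k)
      {s | (p : ℝ) + 2 - J < n * s.re} ∧
    (∀ s : ℂ, (p : ℝ) + 2 - J < n * s.re →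
      Summable fun k : ℕ => ((k : ℂ) + 1) ^ ((p : ℂ) - n * s) * ρ s k) ∧
    (p + 2 < J →
      HasDerivAt (fun s : ℂ => ∑' k : ℕ, ((k : ℂ) + 1) ^ ((p : ℂ) - n * s) * ρ s k) 0 0) := by
  set Ω : ℝ → Set ℂ := fun M => {s | (p : ℝ) + 2 - J < n * s.re} ∩ Metric.ball 0 M with hΩ
  have hΩo : ∀ M, IsOpen (Ω M) := fun M =>
    (isOpen_lt continuous_const (by fun_prop)).inter Metric.isOpen_ball
  have hterm : ∀ k : ℕ, Differentiable ℂ fun s : ℂ =>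
      ((k : ℂ) + 1) ^ ((p : ℂ) - n * s) * ρ s k := fun k =>
    (Differentiable.const_cpow (by fun_prop) (Or.inl (natCast_add_one_ne_zero' k))).mul (hρ k)
  have hle : ∀ M : ℝ, ∃ C : ℝ, ∀ (k : ℕ), ∀ s ∈ Ω M,
      ‖((k : ℂ) + 1) ^ ((p : ℂ) - n * s) * ρ s k‖ ≤ C * ((k : ℝ) + 1) ^ (-2 : ℝ) := by
    intro M
    obtain ⟨C, hC⟩ := hbound M
    refine ⟨C, fun k s ⟨hs, hsM⟩ => ?_⟩
    have hsM' : ‖s‖ ≤ M := (mem_ball_zero_iff.1 hsM).le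
    have hs' : (p : ℝ) + 2 - J < n * s.re := hs
    have hk : (0 : ℝ) < (k : ℝ) + 1 := by positivity
    have hCk := hC s hsM' k
    have hC0 : 0 ≤ C := by
      have h := (norm_nonneg _).trans hCk
      by_contra hneg
      exact absurd h (not_le.2 (div_neg_of_neg_of_pos (not_le.1 hneg) (by positivity)))
    rw [norm_mul, norm_natCast_add_one_cpow]
    have hre : ((p : ℂ) - n * s).re = p - n * s.re := by simp
    rw [hre]
    calc ((k : ℝ) + 1) ^ ((p : ℝ) - n * s.re) * ‖ρ s k‖
        ≤ ((k : ℝ) + 1) ^ ((p : ℝ) - n * s.re) * (C / ((k : ℝ) + 1) ^ J) := by gcongr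
      _ = C * ((k : ℝ) + 1) ^ ((p : ℝ) - n * s.re - J) := by
          rw [Real.rpow_sub hk _ (J : ℝ), Real.rpow_natCast]; ring
      _ ≤ C * ((k : ℝ) + 1) ^ (-2 : ℝ) := by
          gcongr
          · linarith [(Nat.cast_nonneg k : (0 : ℝ) ≤ k)]
          · linarith
  have hsum : ∀ C : ℝ, Summable fun k : ℕ => C * ((k : ℝ) + 1) ^ (-2 : ℝ) := fun C =>
    (summable_natCast_add_one_rpow (by norm_num)).mul_left C
  have hdiff : ∀ M, DifferentiableOn ℂ
      (fun s : ℂ => ∑' k : ℕ, ((k : ℂ) + 1) ^ ((p : ℂ) - n * s) * ρ s k) (Ω M) := fun M => by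
    obtain ⟨C, hC⟩ := hle M
    exact Complex.differentiableOn_tsum_of_summable_norm (hsum C)
      (fun k => (hterm k).differentiableOn) (hΩo M) hC
  have hmem : ∀ s : ℂ, (p : ℝ) + 2 - J < n * s.re → s ∈ Ω (‖s‖ + 1) := fun s hs =>
    ⟨hs, by simp⟩
  refine ⟨fun s hs => ?_, fun s hs => ?_, fun hJ => ?_⟩
  · exact ((hdiff (‖s‖ + 1)).differentiableAt
      ((hΩo _).mem_nhds (hmem s hs))).differentiableWithinAt
  · obtain ⟨C, hC⟩ := hle (‖s‖ + 1)
    exact Summable.of_norm_bounded (hsum C) fun k => hC k s (hmem s hs)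
  · have hJ' : (p : ℝ) + 2 < J := by exact_mod_cast hJ
    have h0 : (0 : ℂ) ∈ Ω (‖(0 : ℂ)‖ + 1) := hmem 0 (by simp; linarith)
    obtain ⟨C, hC⟩ := hle (‖(0 : ℂ)‖ + 1)
    have hderiv := Complex.hasSum_deriv_of_summable_norm (hsum C)
      (fun k => (hterm k).differentiableOn) (hΩo _) hC h0
    have hzero : ∀ k : ℕ, deriv (fun s : ℂ => ((k : ℂ) + 1) ^ ((p : ℂ) - n * s) * ρ s k) 0 = 0 := by
      intro k
      have hd : DifferentiableAt ℂ (fun s : ℂ => ((k : ℂ) + 1) ^ ((p : ℂ) - n * s)) 0 :=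
        (Differentiable.const_cpow (by fun_prop) (Or.inl (natCast_add_one_ne_zero' k))) 0
      have h := (hd.hasDerivAt.mul (h₁ k)).deriv
      simp only [h₀, mul_zero, add_zero] at h
      exact h
    simp only [hzero] at hderiv
    have h := ((hdiff _).differentiableAt ((hΩo _).mem_nhds h0)).hasDerivAt
    rwa [hderiv.unique hasSum_zero] at h

theorem hasSum_natCast_add_one_cpow {z : ℂ} (hz : 1 < z.re) :
    HasSum (fun k : ℕ => ((k : ℂ) + 1) ^ (-z)) (riemannZeta z) := by
  rw [zeta_eq_tsum_one_div_nat_add_one_cpow hz]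
  have hsum : Summable fun k : ℕ => ((k : ℂ) + 1) ^ (-z) := by
    refine Summable.of_norm ?_
    simp only [norm_natCast_add_one_cpow, Complex.neg_re]
    exact summable_natCast_add_one_rpow (by linarith)
  convert hsum.hasSum using 3 with k
  rw [Complex.cpow_neg, one_div]

theorem hasDerivAt_sq_mul_riemannZeta {n : ℂ} (hn : n ≠ 0) :
    HasDerivAt (fun s : ℂ => s ^ 2 * riemannZeta (n * s + 1)) (1 / n) 0 := by
  rw [hasDerivAt_iff_tendsto_slope]
  have hmap : Tendsto (fun s : ℂ => n * s + 1) (𝓝[≠] 0) (𝓝[≠] 1) := by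
    refine tendsto_nhdsWithin_iff.2 ⟨?_, ?_⟩
    · have h : Continuous fun s : ℂ => n * s + 1 := by fun_prop
      have h0 := h.tendsto 0
      rw [mul_zero, zero_add] at h0
      exact h0.mono_left nhdsWithin_le_nhds
    · filter_upwards [self_mem_nhdsWithin] with s hs
      have hs' : s ≠ 0 := hs
      simp [hn, hs']
  refine ((riemannZeta_residue_one.comp hmap).div_const n).congr' ?_
  filter_upwards [self_mem_nhdsWithin] with s hs
  have hs' : s ≠ 0 := hs
  simp only [Function.comp, slope_def_field, sub_zero]
  field_simp
  ring

theorem eventually_mul_add_ne {n : ℂ} (hn : n ≠ 0) (b c s : ℂ) :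
    ∀ᶠ t in 𝓝[≠] s, n * t + b ≠ c := by
  have h : ∀ᶠ t in 𝓝[≠] s, t ≠ (c - b) / n := by
    by_cases hs : s = (c - b) / n
    · rw [← hs]; exact self_mem_nhdsWithin
    · exact eventually_ne_nhdsWithin hs
  filter_upwards [h] with t ht heq
  exact ht (by rw [eq_div_iff hn, ← heq]; ring)

theorem differentiableAt_riemannZeta_affine {n b t : ℂ} (h : n * t + b ≠ 1) :
    DifferentiableAt ℂ (fun s : ℂ => riemannZeta (n * s + b)) t :=
  DifferentiableAt.comp t (f := fun s : ℂ => n * s + b) (differentiableAt_riemannZeta h)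
    (by fun_prop)

/-- Derivative at the origin of `(-s) ^ m / m! * ζ(n s + j - p)`, for `2 ≤ m`. -/
theorem hasDerivAt_pow_mul_riemannZeta {n : ℂ} (hn : n ≠ 0) (m j p : ℕ) :
    HasDerivAt (fun s : ℂ => (-s) ^ (m + 2) / ((m + 2).factorial : ℂ)
        * riemannZeta (n * s + ((j : ℂ) - p)))
      (if m = 0 ∧ j = p + 1 then 1 / (2 * n) else 0) 0 := by
  by_cases hj : j = p + 1
  · have hb : ((j : ℂ) - p) = 1 := by rw [hj]; push_cast; ring
    have hfun : (fun s : ℂ => (-s) ^ (m + 2) / ((m + 2).factorial : ℂ)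
          * riemannZeta (n * s + ((j : ℂ) - p)))
        = fun s => (-s) ^ m / ((m + 2).factorial : ℂ) * (s ^ 2 * riemannZeta (n * s + 1)) := by
      funext s; rw [hb]; ring
    rw [hfun]
    have hd : DifferentiableAt ℂ (fun s : ℂ => (-s) ^ m / ((m + 2).factorial : ℂ)) 0 := by
      fun_prop
    refine (hd.hasDerivAt.mul (hasDerivAt_sq_mul_riemannZeta hn)).congr_deriv ?_
    by_cases hm : m = 0
    · subst hm
      simp [hj, Nat.factorial]
      ring
    · simp [hm]
  · have hb : n * 0 + ((j : ℂ) - p) ≠ 1 := by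
      intro h
      apply hj
      have : (j : ℂ) = ((p + 1 : ℕ) : ℂ) := by push_cast; linear_combination h
      exact_mod_cast this
    have hd : DifferentiableAt ℂ (fun s : ℂ => (-s) ^ m / ((m + 2).factorial : ℂ)
        * riemannZeta (n * s + ((j : ℂ) - p))) 0 :=
      DifferentiableAt.mul (by fun_prop) (differentiableAt_riemannZeta_affine hb)
    have hfun : (fun s : ℂ => (-s) ^ (m + 2) / ((m + 2).factorial : ℂ)
          * riemannZeta (n * s + ((j : ℂ) - p)))
        = fun s => s ^ 2 * ((-s) ^ m / ((m + 2).factorial : ℂ)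
          * riemannZeta (n * s + ((j : ℂ) - p))) := by
      funext s; ring
    rw [hfun]
    refine ((hasDerivAt_pow 2 (0 : ℂ)).mul hd.hasDerivAt).congr_deriv ?_
    simp [hj]

/-- Continuation of a linear combination of the series `∑ (k + 1) ^ (p - n s) exp (-s v(k))`,
where `v(k)` has the asymptotic expansion `V(1 / (k + 1))` up to `O((k + 1) ^ (-J))` and the
terms of order zero and one in `s` cancel. -/
theorem exists_continuation {ι : Type*} [Fintype ι] {n p J : ℕ} (hn : n ≠ 0) (hJ : p + 2 < J)
    (c : ι → ℂ) (v : ι → ℕ → ℂ) (V : ι → Polynomial ℂ)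
    (hv : ∀ α, ∃ B : ℝ, (∀ k : ℕ, ‖v α k‖ ≤ B / ((k : ℝ) + 1)) ∧
      ∀ k : ℕ, ‖v α k - (V α).eval ((k : ℂ) + 1)⁻¹‖ ≤ B / ((k : ℝ) + 1) ^ J)
    (hc : ∑ α, c α = 0) (hcv : ∀ k, ∑ α, c α * v α k = 0)
    (hcV : ∑ α, Polynomial.C (c α) * V α = 0) :
    ∃ F : ℂ → ℂ,
      (∀ s : ℂ, (p : ℝ) + 1 < n * s.re →
        HasSum (fun k : ℕ => ((k : ℂ) + 1) ^ ((p : ℂ) - n * s)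
          * ∑ α, c α * Complex.exp (-s * v α k)) (F s)) ∧
      (∀ s : ℂ, (p : ℝ) + 2 - J < n * s.re → ∀ᶠ t in 𝓝[≠] s, DifferentiableAt ℂ F t) ∧
      HasDerivAt F ((∑ α, c α * (V α ^ 2).coeff (p + 1)) / (2 * n)) 0 := by
  have hn' : (n : ℂ) ≠ 0 := Nat.cast_ne_zero.2 hn
  set A : ℕ → Polynomial ℂ := fun m => ∑ α, Polynomial.C (c α) * V α ^ m with hA
  have hA0 : A 0 = 0 := by
    simp only [hA, pow_zero, mul_one]
    rw [← map_sum, hc, map_zero]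
  have hA1 : A 1 = 0 := by simpa only [hA, pow_one] using hcV
  obtain ⟨D, hD, hpD⟩ : ∃ D : ℕ, (∀ m < J, (A m).natDegree < D) ∧ p + 1 < D := by
    refine ⟨(Finset.range J).sup (fun m => (A m).natDegree) + (p + 2), fun m hm => ?_, by omega⟩
    have := Finset.le_sup (f := fun m => (A m).natDegree) (Finset.mem_range.2 hm)
    omega
  have heval : ∀ (m : ℕ) (w : ℂ), ∑ α, c α * (V α).eval w ^ m = (A m).eval w := fun m w => by
    simp [hA, Polynomial.eval_finsetSum]
  set ρ : ℂ → ℕ → ℂ := fun s k => ∑ α, c α * (Complex.exp (-s * v α k)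
    - ∑ m ∈ Finset.range J, (-s) ^ m / (m.factorial : ℂ) * (V α).eval ((k : ℂ) + 1)⁻¹ ^ m) with hρ
  have hρA : ∀ s k, ρ s k = ∑ α, c α * Complex.exp (-s * v α k)
      - ∑ m ∈ Finset.range J, (-s) ^ m / (m.factorial : ℂ) * (A m).eval ((k : ℂ) + 1)⁻¹ := by
    intro s k
    simp only [hρ, mul_sub, Finset.sum_sub_distrib, ← heval, Finset.mul_sum]
    rw [Finset.sum_comm]
    congr 1
    refine Finset.sum_congr rfl fun m _ => Finset.sum_congr rfl fun α _ => by ring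
  have hbound : ∀ M : ℝ, ∃ C : ℝ, ∀ s : ℂ, ‖s‖ ≤ M → ∀ k : ℕ,
      ‖ρ s k‖ ≤ C / ((k : ℝ) + 1) ^ J := by
    intro M
    have h : ∀ α, ∃ C : ℝ, ∀ s : ℂ, ‖s‖ ≤ M → ∀ k : ℕ,
        ‖Complex.exp (-s * v α k) - ∑ m ∈ Finset.range J,
          (-s) ^ m / (m.factorial : ℂ) * (V α).eval ((k : ℂ) + 1)⁻¹ ^ m‖
          ≤ C / ((k : ℝ) + 1) ^ J := fun α => by
      obtain ⟨B, hB, hB'⟩ := hv α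
      exact exists_bound_exp_sub_truncation hB hB' M
    choose C hC using h
    refine ⟨∑ α, ‖c α‖ * C α, fun s hs k => ?_⟩
    rw [Finset.sum_div]
    refine (norm_sum_le _ _).trans (Finset.sum_le_sum fun α _ => ?_)
    rw [norm_mul, mul_div_assoc]
    exact mul_le_mul_of_nonneg_left (hC α s hs k) (norm_nonneg _)
  have hρd : ∀ k, Differentiable ℂ fun s => ρ s k := fun k => by
    simp only [hρ]; fun_prop
  have hρ0 : ∀ k, ρ 0 k = 0 := fun k => by
    rw [hρA]
    have : ∀ m ∈ Finset.range J, (-(0 : ℂ)) ^ m / (m.factorial : ℂ)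
        * (A m).eval ((k : ℂ) + 1)⁻¹ = 0 := by
      rintro (_ | m) _
      · simp [hA0]
      · simp
    rw [Finset.sum_eq_zero this]
    simpa using hc
  have hρ1 : ∀ k, HasDerivAt (fun s => ρ s k) 0 0 := fun k => by
    have h1 : HasDerivAt (fun s : ℂ => ∑ α, c α * Complex.exp (-s * v α k)) 0 0 := by
      have h : ∀ α ∈ (Finset.univ : Finset ι),
          HasDerivAt (fun s : ℂ => c α * Complex.exp (-s * v α k)) (-(c α * v α k)) 0 := by
        intro α _
        refine ((((hasDerivAt_id (0 : ℂ)).neg.mul_const (v α k)).cexp).const_mul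
          (c α)).congr_deriv ?_
        simp
      refine (HasDerivAt.fun_sum h).congr_deriv ?_
      rw [Finset.sum_neg_distrib, hcv, neg_zero]
    have h2 : HasDerivAt (fun s : ℂ => ∑ m ∈ Finset.range J,
        (-s) ^ m / (m.factorial : ℂ) * (A m).eval ((k : ℂ) + 1)⁻¹) 0 0 := by
      refine (HasDerivAt.fun_sum (A' := fun _ => 0) ?_).congr_deriv Finset.sum_const_zero
      rintro (_ | _ | m) _
      · simpa [hA0] using hasDerivAt_const (0 : ℂ) (0 : ℂ)
      · simpa [hA1] using hasDerivAt_const (0 : ℂ) (0 : ℂ)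
      · refine ((((hasDerivAt_id (0 : ℂ)).neg.pow (m + 2)).div_const _).mul_const _).congr_deriv ?_
        simp
    have h3 := h1.sub h2
    rw [sub_zero] at h3
    refine h3.congr_of_eventuallyEq (Eventually.of_forall fun s => ?_)
    simp only [hρA, Pi.sub_apply]
  obtain ⟨hRd, hRs, hR0⟩ := tsum_cpow_mul_of_bound (n := n) (p := p) hρd hbound hρ0 hρ1
  refine ⟨fun s => (∑' k : ℕ, ((k : ℂ) + 1) ^ ((p : ℂ) - n * s) * ρ s k)
    + ∑ m ∈ Finset.range J, ∑ j ∈ Finset.range D, (A m).coeff j *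
      ((-s) ^ m / (m.factorial : ℂ) * riemannZeta (n * s + ((j : ℂ) - p))), ?_, ?_, ?_⟩
  · intro s hs
    have hJ' : (p : ℝ) + 2 < J := by exact_mod_cast hJ
    have h1 := (hRs s (by linarith [(Nat.cast_nonneg p : (0 : ℝ) ≤ p)])).hasSum
    have h2 : HasSum (fun k : ℕ => ∑ m ∈ Finset.range J, ∑ j ∈ Finset.range D, (A m).coeff j *
        ((-s) ^ m / (m.factorial : ℂ) * ((k : ℂ) + 1) ^ (-(n * s + ((j : ℂ) - p)))))
        (∑ m ∈ Finset.range J, ∑ j ∈ Finset.range D, (A m).coeff j *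
          ((-s) ^ m / (m.factorial : ℂ) * riemannZeta (n * s + ((j : ℂ) - p)))) := by
      refine hasSum_sum fun m _ => hasSum_sum fun j _ => ?_
      refine ((hasSum_natCast_add_one_cpow ?_).mul_left _).mul_left _
      simp
      linarith [(Nat.cast_nonneg j : (0 : ℝ) ≤ j)]
    convert h1.add h2 using 2 with k
    have hk := natCast_add_one_ne_zero' k
    rw [hρA, mul_sub, sub_add]
    refine (sub_eq_self.2 (sub_eq_zero.2 ?_)).symm
    rw [Finset.mul_sum]
    refine Finset.sum_congr rfl fun m hm => ?_
    rw [Polynomial.eval_eq_sum_range' (hD m (Finset.mem_range.1 hm)), Finset.mul_sum,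
      Finset.mul_sum]
    refine Finset.sum_congr rfl fun j _ => ?_
    rw [show -(n * s + ((j : ℂ) - p)) = (p - n * s) - j by ring, Complex.cpow_sub (p - n * s) j hk,
      Complex.cpow_natCast, inv_pow]
    ring
  · intro s hs
    have h1 : ∀ᶠ t in 𝓝[≠] s, (p : ℝ) + 2 - J < n * t.re :=
      nhdsWithin_le_nhds ((isOpen_lt continuous_const (by fun_prop)).mem_nhds hs)
    have h2 : ∀ᶠ t in 𝓝[≠] s, ∀ j ∈ Finset.range D, n * t + ((j : ℂ) - p) ≠ 1 :=
      (Filter.eventually_all_finset _).2 fun j _ => eventually_mul_add_ne hn' _ _ _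
    filter_upwards [h1, h2] with t ht1 ht2
    refine (hRd.differentiableAt
      ((isOpen_lt continuous_const (by fun_prop)).mem_nhds ht1)).add ?_
    refine DifferentiableAt.fun_sum fun m _ => DifferentiableAt.fun_sum fun j hj => ?_
    exact (DifferentiableAt.mul (by fun_prop)
      (differentiableAt_riemannZeta_affine (ht2 j hj))).const_mul _
  · refine ((hR0 hJ).add (HasDerivAt.fun_sum (A' := fun m => ∑ j ∈ Finset.range D, (A m).coeff j *
      (if m = 2 ∧ j = p + 1 then 1 / (2 * (n : ℂ)) else 0)) ?_)).congr_deriv ?_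
    · intro m _
      refine HasDerivAt.fun_sum fun j _ => ?_
      rcases m with (_ | _ | m)
      · simpa [hA0] using hasDerivAt_const (0 : ℂ) (0 : ℂ)
      · simpa [hA1] using hasDerivAt_const (0 : ℂ) (0 : ℂ)
      · refine ((hasDerivAt_pow_mul_riemannZeta hn' m j p).const_mul _).congr_deriv ?_
        simp
    · rw [zero_add, Finset.sum_eq_single 2, Finset.sum_eq_single (p + 1)]
      · simp [hA, Polynomial.finsetSum_coeff]
        ring
      · intro j _ hj; simp [hj]
      · intro h; exact absurd (Finset.mem_range.2 hpD) h
      · intro m _ hm; simp [hm]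
      · intro h; exact absurd (Finset.mem_range.2 (by omega)) h

/-- The Taylor polynomial at `w = 0` of `log (1 - x w)`, up to degree `J - 1`. -/
noncomputable def logPolynomial (J : ℕ) (x : ℂ) : Polynomial ℂ :=
  ∑ l ∈ Finset.range J, Polynomial.monomial l (-(x ^ l / (l : ℂ)))

theorem coeff_logPolynomial {J l : ℕ} (hl : l < J) (x : ℂ) :
    (logPolynomial J x).coeff l = -(x ^ l / (l : ℂ)) := by
  simp [logPolynomial, Polynomial.finsetSum_coeff, Polynomial.coeff_monomial, hl]

theorem eval_logPolynomial (J : ℕ) (x w : ℂ) :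
    (logPolynomial J x).eval w = Complex.logTaylor J (-(x * w)) := by
  simp only [logPolynomial, Complex.logTaylor, Polynomial.eval_finsetSum,
    Polynomial.eval_monomial]
  refine Finset.sum_congr rfl fun l _ => ?_
  have h : (-1 : ℂ) ^ l * (-1) ^ l = 1 := by rw [← mul_pow]; simp
  rw [neg_pow (x * w), mul_pow, pow_succ]
  linear_combination (-(x ^ l * w ^ l / (l : ℂ))) * -h

theorem coeff_logPolynomial_mul {J p : ℕ} (hJ : p + 2 < J) (x y : ℂ) :
    (logPolynomial J x * logPolynomial J y).coeff (p + 1)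
      = ∑ l ∈ Finset.Icc 1 p,
        1 / ((l : ℂ) * ((p : ℂ) + 1 - (l : ℂ))) * x ^ l * y ^ (p - l + 1) := by
  rw [Polynomial.coeff_mul, Finset.Nat.sum_antidiagonal_eq_sum_range_succ_mk]
  have hsub : Finset.Icc 1 p ⊆ Finset.range (p + 1).succ := fun l hl => by
    simp only [Finset.mem_Icc, Finset.mem_range] at *; omega
  symm
  refine (Finset.sum_subset_zero_on_sdiff hsub (fun l hl => ?_) fun l hl => ?_)
  · simp only [Finset.mem_sdiff, Finset.mem_Icc, Finset.mem_range, not_and, not_le] at hl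
    rw [coeff_logPolynomial (by omega), coeff_logPolynomial (by omega)]
    by_cases h0 : l = 0
    · simp [h0]
    · have : l = p + 1 := by omega
      simp [this]
  · simp only [Finset.mem_Icc] at hl
    rw [coeff_logPolynomial (by omega), coeff_logPolynomial (by omega),
      show p + 1 - l = p - l + 1 by omega]
    have : ((p - l + 1 : ℕ) : ℂ) = (p : ℂ) + 1 - l := by
      push_cast [Nat.cast_sub hl.2]; ring
    rw [this, neg_mul_neg, div_mul_div_comm]
    ring

theorem sum_one_div_mul_sub (p : ℕ) :
    ∑ l ∈ Finset.Icc 1 p, 1 / ((l : ℂ) * ((p : ℂ) + 1 - (l : ℂ)))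
      = 2 / ((p : ℂ) + 1) * ∑ l ∈ Finset.Icc 1 p, 1 / (l : ℂ) := by
  have hp : (p : ℂ) + 1 ≠ 0 := natCast_add_one_ne_zero' p
  have hcast : ∀ l ∈ Finset.Icc 1 p, (p : ℂ) + 1 - l = ((p + 1 - l : ℕ) : ℂ) := fun l hl => by
    rw [Finset.mem_Icc] at hl
    push_cast [Nat.cast_sub (show l ≤ p + 1 by omega)]; ring
  have hreflect : ∑ l ∈ Finset.Icc 1 p, 1 / ((p : ℂ) + 1 - l)
      = ∑ l ∈ Finset.Icc 1 p, 1 / (l : ℂ) := by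
    refine Finset.sum_bij' (fun l _ => p + 1 - l) (fun l _ => p + 1 - l) ?_ ?_ ?_ ?_ ?_
    · intro l hl; rw [Finset.mem_Icc] at *; omega
    · intro l hl; rw [Finset.mem_Icc] at *; omega
    · intro l hl; rw [Finset.mem_Icc] at *; omega
    · intro l hl; rw [Finset.mem_Icc] at *; omega
    · intro l hl; rw [hcast l hl]
  calc ∑ l ∈ Finset.Icc 1 p, 1 / ((l : ℂ) * ((p : ℂ) + 1 - (l : ℂ)))
      = ∑ l ∈ Finset.Icc 1 p, (1 / ((p : ℂ) + 1) * (1 / (l : ℂ))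
          + 1 / ((p : ℂ) + 1) * (1 / ((p : ℂ) + 1 - l))) := by
        refine Finset.sum_congr rfl fun l hl => ?_
        have h1 : (p : ℂ) + 1 - l ≠ 0 := by
          rw [hcast l hl]
          rw [Finset.mem_Icc] at hl
          exact Nat.cast_ne_zero.2 (by omega)
        have h2 : (l : ℂ) ≠ 0 := by
          rw [Finset.mem_Icc] at hl
          exact Nat.cast_ne_zero.2 (by omega)
        field_simp
        ring
    _ = _ := by
        rw [Finset.sum_add_distrib, ← Finset.mul_sum, ← Finset.mul_sum, hreflect]
        ring

theorem exists_bound_log_sub_logTaylor (x : ℂ) (m : ℕ) :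
    ∃ B : ℝ, ∀ k : ℕ, ‖Complex.log (1 - x * ((k : ℂ) + 1)⁻¹)
      - Complex.logTaylor (m + 1) (-(x * ((k : ℂ) + 1)⁻¹))‖ ≤ B / ((k : ℝ) + 1) ^ (m + 1) := by
  have hO : (fun k : ℕ => Complex.log (1 - x * ((k : ℂ) + 1)⁻¹)
      - Complex.logTaylor (m + 1) (-(x * ((k : ℂ) + 1)⁻¹)))
      =O[atTop] fun k : ℕ => (((k : ℝ) + 1) ^ (m + 1))⁻¹ := by
    refine Asymptotics.IsBigO.of_bound (‖x‖ ^ (m + 1) * 2) ?_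
    filter_upwards [eventually_ge_atTop ⌈2 * ‖x‖⌉₊] with k hk
    have hk' : 2 * ‖x‖ ≤ k := Nat.ceil_le.1 hk
    have hpos : (0 : ℝ) < (k : ℝ) + 1 := by positivity
    have hnk : ‖(k : ℂ) + 1‖ = (k : ℝ) + 1 := by
      have := Complex.norm_natCast (k + 1)
      push_cast at this
      exact this
    have hz : ‖-(x * ((k : ℂ) + 1)⁻¹)‖ = ‖x‖ * ((k : ℝ) + 1)⁻¹ := by
      rw [norm_neg, norm_mul, norm_inv, hnk]
    have hhalf : ‖-(x * ((k : ℂ) + 1)⁻¹)‖ ≤ 1 / 2 := by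
      rw [hz, ← div_eq_mul_inv, div_le_iff₀ hpos]; linarith
    have h := Complex.norm_log_sub_logTaylor_le m (lt_of_le_of_lt hhalf (by norm_num))
    rw [← sub_eq_add_neg] at h
    refine h.trans ?_
    have hinv : (1 - ‖-(x * ((k : ℂ) + 1)⁻¹)‖)⁻¹ ≤ 2 := by
      rw [inv_le_comm₀ (by linarith) (by norm_num)]; linarith
    refine (div_le_self (by
      refine mul_nonneg (by positivity) (inv_nonneg.2 (by linarith))) (by
        linarith [(Nat.cast_nonneg m : (0 : ℝ) ≤ m)])).trans ?_
    rw [Real.norm_of_nonneg (by positivity)]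
    calc _ ≤ ‖-(x * ((k : ℂ) + 1)⁻¹)‖ ^ (m + 1) * 2 := by gcongr
      _ = _ := by rw [hz, mul_pow, inv_pow]; ring
  obtain ⟨B, -, hB⟩ := Asymptotics.bound_of_isBigO_nat_atTop hO
  refine ⟨B, fun k => ?_⟩
  have h := hB (x := k) (by positivity)
  rwa [Real.norm_of_nonneg (by positivity), ← div_eq_mul_inv] at h

theorem exists_bound_log_one_sub (x : ℂ) {J : ℕ} (hJ : 1 ≤ J) :
    ∃ B : ℝ, (∀ k : ℕ, ‖Complex.log (1 - x * ((k : ℂ) + 1)⁻¹)‖ ≤ B / ((k : ℝ) + 1)) ∧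
      ∀ k : ℕ, ‖Complex.log (1 - x * ((k : ℂ) + 1)⁻¹)
        - (logPolynomial J x).eval ((k : ℂ) + 1)⁻¹‖ ≤ B / ((k : ℝ) + 1) ^ J := by
  obtain ⟨B, hB⟩ := exists_bound_log_sub_logTaylor x 0
  obtain ⟨B', hB'⟩ := exists_bound_log_sub_logTaylor x (J - 1)
  rw [Nat.sub_add_cancel hJ] at hB'
  refine ⟨max B B', fun k => ?_, fun k => ?_⟩
  · have h := hB k
    simp only [Complex.logTaylor, zero_add, Finset.sum_range_one, Nat.cast_zero, div_zero,
      sub_zero, pow_one] at h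
    exact h.trans (by gcongr; exact le_max_left _ _)
  · rw [eval_logPolynomial]
    exact (hB' k).trans (by gcongr; exact le_max_right _ _)

theorem natCast_sub_ne_zero {x : ℂ} (hx : x.re < 0) (k : ℕ) : (k : ℂ) - x ≠ 0 := by
  intro h
  have := congrArg Complex.re h
  simp at this
  linarith [(Nat.cast_nonneg k : (0 : ℝ) ≤ k)]

theorem exp_neg_mul_log_natCast_add_one_sub {x : ℂ} (hx : x.re < 0) (k : ℕ) (s : ℂ) :
    Complex.exp (-s * Complex.log (((k + 1 : ℕ) : ℂ) - x))
      = ((k : ℂ) + 1) ^ (-s) * Complex.exp (-s * Complex.log (1 - x * ((k : ℂ) + 1)⁻¹)) := by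
  have hk := natCast_add_one_ne_zero' k
  have hfac : ((k + 1 : ℕ) : ℂ) - x = (((k : ℝ) + 1 : ℝ) : ℂ) * (1 - x * ((k : ℂ) + 1)⁻¹) := by
    push_cast
    field_simp
  have hne : 1 - x * ((k : ℂ) + 1)⁻¹ ≠ 0 := by
    intro h
    exact natCast_sub_ne_zero hx (k + 1) (by rw [hfac, h, mul_zero])
  rw [hfac, Complex.log_ofReal_mul (by positivity) hne, Complex.cpow_def_of_ne_zero hk,
    ← Complex.exp_add]
  congr 1
  rw [Complex.ofReal_log (by positivity)]
  push_cast
  ring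

theorem summable_exp_neg_mul_log {x : ℂ} (hx : x.re < 0) {s : ℂ} (hs : 1 < s.re) :
    Summable fun k : ℕ => Complex.exp (-s * Complex.log ((k : ℂ) - x)) := by
  rw [← summable_nat_add_iff 1]
  obtain ⟨B, hB, -⟩ := exists_bound_log_one_sub x le_rfl
  have hB0 : 0 ≤ B := by simpa using (norm_nonneg _).trans (hB 0)
  refine Summable.of_norm_bounded ((summable_natCast_add_one_rpow
    (r := -s.re) (by linarith)).mul_right (Real.exp (‖s‖ * B))) fun k => ?_
  rw [exp_neg_mul_log_natCast_add_one_sub hx, norm_mul, norm_natCast_add_one_cpow, Complex.neg_re]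
  have h : ‖Complex.exp (-s * Complex.log (1 - x * ((k : ℂ) + 1)⁻¹))‖ ≤ Real.exp (‖s‖ * B) := by
    refine (Complex.norm_exp_le_exp_norm _).trans (Real.exp_le_exp.2 ?_)
    rw [norm_mul, norm_neg]
    have := (hB k).trans (div_le_self hB0 (by linarith [(Nat.cast_nonneg k : (0 : ℝ) ≤ k)]))
    gcongr
  gcongr

theorem hasSum_pow_mul_exp_neg_mul_log {x : ℂ} (hx : x.re < 0) {h : ℂ → ℂ}
    (heq : ∀ s : ℂ, 1 < s.re →
      h s = ∑' k : ℕ, Complex.exp (-s * Complex.log ((k : ℂ) - x)))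
    (p : ℕ) {s : ℂ} (hs : (p : ℝ) + 1 < s.re) :
    HasSum (fun k : ℕ => (k : ℂ) ^ p * Complex.exp (-s * Complex.log ((k : ℂ) - x)))
      (∑ l ∈ Finset.range (p + 1), (p.choose l : ℂ) * x ^ (p - l) * h (s - l)) := by
  have hsum : HasSum (fun k : ℕ => ∑ l ∈ Finset.range (p + 1), (p.choose l : ℂ) * x ^ (p - l)
      * Complex.exp (-(s - l) * Complex.log ((k : ℂ) - x)))
      (∑ l ∈ Finset.range (p + 1), (p.choose l : ℂ) * x ^ (p - l) * h (s - l)) := by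
    refine hasSum_sum fun l hl => HasSum.mul_left _ ?_
    have hl' : (l : ℝ) ≤ p := by exact_mod_cast Nat.lt_succ_iff.1 (Finset.mem_range.1 hl)
    have hre : 1 < (s - l).re := by simp; linarith
    rw [heq _ hre]
    exact (summable_exp_neg_mul_log hx hre).hasSum
  convert hsum using 2 with k
  set y : ℂ := (k : ℂ) - x with hy
  have hy0 : y ≠ 0 := natCast_sub_ne_zero hx k
  have hexp : ∀ l : ℕ, Complex.exp (-(s - l) * Complex.log y)
      = y ^ l * Complex.exp (-s * Complex.log y) := fun l => by
    rw [show -(s - l) * Complex.log y = l * Complex.log y + -s * Complex.log y by ring,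
      Complex.exp_add, Complex.exp_nat_mul, Complex.exp_log hy0]
  rw [show (k : ℂ) = y + x by rw [hy]; ring, add_pow, Finset.sum_mul]
  refine Finset.sum_congr rfl fun l _ => ?_
  rw [hexp]
  ring

/-- The product formula for a real polynomial whose zeros have negative real part, in
logarithmic form. -/
theorem log_Pval_eq {n : ℕ} {a : ℕ → ℝ} (han : 0 < a n) {x : Fin n → ℂ}
    (hfact : ∀ z : ℂ, (∑ i ∈ Finset.range (n + 1), (a i : ℂ) * z ^ i)
      = (a n : ℂ) * ∏ i : Fin n, (z - x i))
    (hre : ∀ i, (x i).re < 0) (k : ℕ) :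
    (Real.log (Pval n a k) : ℂ)
      = (Real.log (a n) : ℂ) + ∑ i, Complex.log ((k : ℂ) - x i) := by
  have han' : (a n : ℂ) ≠ 0 := Complex.ofReal_ne_zero.2 han.ne'
  have hconj : ∀ z : ℂ, ∏ i, (z - x i) = ∏ i, (z - (starRingEnd ℂ) (x i)) := by
    intro z
    have h1 := congrArg (starRingEnd ℂ) (hfact ((starRingEnd ℂ) z))
    simp only [map_sum, map_mul, map_pow, map_prod, map_sub, Complex.conj_conj,
      Complex.conj_ofReal] at h1
    exact mul_left_cancel₀ han' ((hfact z).symm.trans h1)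
  have hpoly : ∏ i, (Polynomial.X - Polynomial.C (x i))
      = ∏ i, (Polynomial.X - Polynomial.C ((starRingEnd ℂ) (x i))) := by
    refine Polynomial.funext fun z => ?_
    simpa [Polynomial.eval_prod] using hconj z
  have hroots : Finset.univ.val.map x = Finset.univ.val.map fun i => (starRingEnd ℂ) (x i) := by
    have h := congrArg Polynomial.roots hpoly
    have hr : ∀ y : Fin n → ℂ, (∏ i, (Polynomial.X - Polynomial.C (y i))).roots
        = Finset.univ.val.map y := fun y => by
      rw [← Polynomial.roots_multiset_prod_X_sub_C (Finset.univ.val.map y), Multiset.map_map]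
      rfl
    rwa [hr, hr] at h
  have harg : ∑ i, ((k : ℂ) - x i).arg = 0 := by
    have h1 : ∑ i, ((k : ℂ) - x i).arg = ∑ i, ((k : ℂ) - (starRingEnd ℂ) (x i)).arg := by
      have h := congrArg (fun m => (m.map fun z : ℂ => ((k : ℂ) - z).arg).sum) hroots
      simpa [Multiset.map_map, Function.comp_def, Finset.sum_eq_multiset_sum] using h
    have h2 : ∀ i, ((k : ℂ) - (starRingEnd ℂ) (x i)).arg = -((k : ℂ) - x i).arg := fun i => by
      have hc : (k : ℂ) - (starRingEnd ℂ) (x i) = (starRingEnd ℂ) ((k : ℂ) - x i) := by simp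
      rw [hc, Complex.arg_conj, if_neg]
      intro hpi
      have h3 := (Complex.arg_eq_pi_iff.1 hpi).1
      simp at h3
      linarith [hre i, (Nat.cast_nonneg k : (0 : ℝ) ≤ k)]
    simp only [h2, Finset.sum_neg_distrib] at h1
    linarith
  have hP : |Pval n a k| = a n * ∏ i, ‖(k : ℂ) - x i‖ := by
    have h := congrArg norm (hfact k)
    rw [norm_mul, norm_prod, Complex.norm_of_nonneg han.le] at h
    rw [← h, ← Real.norm_eq_abs, ← Complex.norm_real]
    congr 1
    simp [Pval]
  have hne : ∀ i, ‖(k : ℂ) - x i‖ ≠ 0 := fun i => norm_ne_zero_iff.2 (natCast_sub_ne_zero (hre i) k)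
  rw [← Real.log_abs, hP, Real.log_mul han.ne' (Finset.prod_ne_zero_iff.2 fun i _ => hne i),
    Real.log_prod fun i _ => hne i]
  apply Complex.ext
  · simp [Complex.log_re]
  · simp [Complex.log_im, harg]

/-- Continuation of the difference between the zeta series of `∏ (k - xᵢ)` and the mean of the
Hurwitz-type series of the zeros at `n s`. -/
theorem exists_continuation_sub_mean {n : ℕ} (hn : n ≠ 0) (p R : ℕ) {x : Fin n → ℂ}
    (hre : ∀ i, (x i).re < 0) :
    ∃ F : ℂ → ℂ,
      (∀ s : ℂ, (p : ℝ) + 1 < n * s.re →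
        HasSum (fun k : ℕ => ((k + 1 : ℕ) : ℂ) ^ p
          * (Complex.exp (-s * ∑ i, Complex.log (((k + 1 : ℕ) : ℂ) - x i))
            - 1 / (n : ℂ) * ∑ i, Complex.exp (-(n * s) * Complex.log (((k + 1 : ℕ) : ℂ) - x i))))
          (F s)) ∧
      (∀ s : ℂ, -(R : ℝ) < s.re → ∀ᶠ t in 𝓝[≠] s, DifferentiableAt ℂ F t) ∧
      HasDerivAt F ((1 / (2 * (n : ℂ))) *
          (∑ l ∈ Finset.Icc 1 p, (1 / ((l : ℂ) * ((p : ℂ) + 1 - (l : ℂ)))) *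
            (∑ i : Fin n, x i ^ l) * (∑ j : Fin n, x j ^ (p - l + 1)))
        - ((∑ l ∈ Finset.Icc 1 p, 1 / (l : ℂ)) / ((p : ℂ) + 1)) * (∑ i : Fin n, x i ^ (p + 1))) 0 := by
  have hn' : (n : ℂ) ≠ 0 := Nat.cast_ne_zero.2 hn
  set J : ℕ := p + 3 + n * R with hJdef
  have hJ : p + 2 < J := by rw [hJdef]; omega
  set u : Fin n → ℕ → ℂ := fun i k => Complex.log (1 - x i * ((k : ℂ) + 1)⁻¹) with hu
  choose B hB hB' using fun i => exists_bound_log_one_sub (x i) (show 1 ≤ J by omega)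
  obtain ⟨F, hFsum, hFdiff, hFderiv⟩ := exists_continuation (ι := Option (Fin n)) (p := p) hn hJ
    (fun α => α.elim 1 fun _ => -(1 / (n : ℂ)))
    (fun α k => α.elim (∑ i, u i k) fun i => n * u i k)
    (fun α => α.elim (∑ i, logPolynomial J (x i)) fun i =>
      Polynomial.C (n : ℂ) * logPolynomial J (x i))
    (by
      rintro (_ | i)
      · refine ⟨∑ i, B i, fun k => ?_, fun k => ?_⟩
        · rw [Finset.sum_div]
          exact (norm_sum_le _ _).trans (Finset.sum_le_sum fun i _ => hB i k)
        · simp only [Option.elim_none, Polynomial.eval_finsetSum]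
          rw [← Finset.sum_sub_distrib, Finset.sum_div]
          exact (norm_sum_le _ _).trans (Finset.sum_le_sum fun i _ => hB' i k)
      · refine ⟨n * B i, fun k => ?_, fun k => ?_⟩
        · simp only [Option.elim_some]
          rw [norm_mul, Complex.norm_natCast, mul_div_assoc]
          exact mul_le_mul_of_nonneg_left (hB i k) (Nat.cast_nonneg n)
        · simp only [Option.elim_some, Polynomial.eval_mul, Polynomial.eval_C]
          rw [← mul_sub, norm_mul, Complex.norm_natCast, mul_div_assoc]
          exact mul_le_mul_of_nonneg_left (hB' i k) (Nat.cast_nonneg n))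
    (by simp [Fintype.sum_option, hn'])
    (fun k => by
      simp only [Fintype.sum_option, Option.elim_none, Option.elim_some, ← Finset.mul_sum]
      field_simp
      ring)
    (by
      simp only [Fintype.sum_option, Option.elim_none, Option.elim_some, ← mul_assoc,
        ← Polynomial.C_mul, ← Finset.mul_sum]
      rw [show -(1 / (n : ℂ)) * n = -1 by field_simp]
      simp)
  refine ⟨F, fun s hs => ?_, fun s hs => hFdiff s ?_, hFderiv.congr_deriv ?_⟩
  · convert hFsum s hs using 2 with k
    have hk := natCast_add_one_ne_zero' k
    have hprod : Complex.exp (-s * ∑ i, Complex.log (((k + 1 : ℕ) : ℂ) - x i))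
        = ((k : ℂ) + 1) ^ (-(n * s)) * Complex.exp (-s * ∑ i, u i k) := by
      rw [Finset.mul_sum, Complex.exp_sum]
      simp only [exp_neg_mul_log_natCast_add_one_sub (hre _)]
      rw [Finset.prod_mul_distrib, Finset.prod_const, Finset.card_univ, Fintype.card_fin,
        ← Complex.cpow_nat_mul, Finset.mul_sum, Complex.exp_sum, mul_neg]
    rw [hprod]
    simp only [exp_neg_mul_log_natCast_add_one_sub (hre _), Fintype.sum_option, Option.elim_none,
      Option.elim_some, ← Finset.mul_sum]
    rw [sub_eq_add_neg (p : ℂ), Complex.cpow_add _ _ hk, Complex.cpow_natCast]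
    push_cast
    have hsum : ∑ i, Complex.exp (-(n * s) * Complex.log (1 - x i * ((k : ℂ) + 1)⁻¹))
        = ∑ i, Complex.exp (-s * (n * u i k)) :=
      Finset.sum_congr rfl fun i _ => by rw [hu]; congr 1; ring
    rw [hsum]
    ring
  · have hnpos : (1 : ℝ) ≤ n := by exact_mod_cast Nat.one_le_iff_ne_zero.2 hn
    rw [hJdef]
    push_cast
    nlinarith
  · simp only [Fintype.sum_option, Option.elim_none, Option.elim_some, mul_pow, one_mul,
      ← Polynomial.C_pow, Polynomial.coeff_C_mul, ← Finset.mul_sum]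
    have h1 : ((∑ i, logPolynomial J (x i)) ^ 2).coeff (p + 1)
        = ∑ l ∈ Finset.Icc 1 p, (1 / ((l : ℂ) * ((p : ℂ) + 1 - (l : ℂ)))) *
            (∑ i : Fin n, x i ^ l) * (∑ j : Fin n, x j ^ (p - l + 1)) := by
      rw [sq, Finset.sum_mul_sum]
      simp only [Polynomial.finsetSum_coeff, coeff_logPolynomial_mul hJ]
      rw [Finset.sum_congr rfl fun i _ => Finset.sum_comm, Finset.sum_comm]
      refine Finset.sum_congr rfl fun l _ => ?_
      rw [mul_assoc, Finset.sum_mul_sum, Finset.mul_sum]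
      refine Finset.sum_congr rfl fun i _ => ?_
      rw [Finset.mul_sum]
      exact Finset.sum_congr rfl fun j _ => by ring
    have h2 : ∑ i, (logPolynomial J (x i) ^ 2).coeff (p + 1)
        = 2 / ((p : ℂ) + 1) * (∑ l ∈ Finset.Icc 1 p, 1 / (l : ℂ)) * ∑ i, x i ^ (p + 1) := by
      rw [← sum_one_div_mul_sub, Finset.mul_sum]
      refine Finset.sum_congr rfl fun i _ => ?_
      rw [sq, coeff_logPolynomial_mul hJ, Finset.sum_mul]
      refine Finset.sum_congr rfl fun l hl => ?_
      rw [Finset.mem_Icc] at hl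
      rw [mul_assoc, ← pow_add, show l + (p - l + 1) = p + 1 by omega]
    rw [h1, h2]
    have hp : (p : ℂ) + 1 ≠ 0 := natCast_add_one_ne_zero' p
    field_simp
    ring

/-- Main formula: if `Z` is a holomorphic extension of `ζ^{(p)}_P` to an open connected set
containing `0` and `{s : Re s > p + 1}`, and `hᵢ` is the analytic continuation of the
Hurwitz-type zeta function `s ↦ Σ_k (k − xᵢ)^{−s}` (holomorphic off `s = 1`), then
`Z′(0) = −Z(0) log aₙ + (1/(2n)) Σ_{l=1}^p (1/(l(p+1−l)))(Σᵢ xᵢˡ)(Σⱼ xⱼ^{p−l+1})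
  − (H_p/(p+1)) Σᵢ xᵢ^{p+1} + Σᵢ Σ_{l=0}^p C(p,l) xᵢ^{p−l} hᵢ′(−l)`. -/
theorem polyZeta_deriv_at_zero
    (n : ℕ) (hn : 1 ≤ n) (a : ℕ → ℝ) (han : 0 < a n) (ha0 : a 0 ≠ 0)
    (x : Fin n → ℂ)
    (hfact : ∀ z : ℂ, (∑ i ∈ Finset.range (n + 1), (a i : ℂ) * z ^ i)
      = (a n : ℂ) * ∏ i : Fin n, (z - x i))
    (hre : ∀ i, (x i).re < 0)
    (p : ℕ)
    (h : Fin n → ℂ → ℂ)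
    (hdiff : ∀ i, DifferentiableOn ℂ (h i) {(1 : ℂ)}ᶜ)
    (heq : ∀ i, ∀ s : ℂ, 1 < s.re →
      h i s = ∑' k : ℕ, Complex.exp (-s * Complex.log ((k : ℂ) - x i)))
    (U : Set ℂ) (Z : ℂ → ℂ)
    (hU : IsOpen U) (hUc : IsConnected U) (h0U : (0 : ℂ) ∈ U)
    (hUsub : {s : ℂ | (p : ℝ) + 1 < s.re} ⊆ U)
    (hZ : DifferentiableOn ℂ Z U)
    (hZeq : ∀ s : ℂ, (p : ℝ) + 1 < s.re →
      Z s = ∑' k : ℕ, (k : ℂ) ^ p * Complex.exp (-s * (Real.log (Pval n a k) : ℂ))) :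
    deriv Z 0 = -(Z 0) * (Real.log (a n) : ℂ)
      + (1 / (2 * (n : ℂ))) *
          (∑ l ∈ Finset.Icc 1 p, (1 / ((l : ℂ) * ((p : ℂ) + 1 - (l : ℂ)))) *
            (∑ i : Fin n, x i ^ l) * (∑ j : Fin n, x j ^ (p - l + 1)))
      - (((∑ i ∈ Finset.Icc 1 p, (1 : ℝ) / i : ℝ) : ℂ) / ((p : ℂ) + 1)) *
          (∑ i : Fin n, x i ^ (p + 1))
      + ∑ i : Fin n, ∑ l ∈ Finset.range (p + 1),
          (p.choose l : ℂ) * x i ^ (p - l) * deriv (h i) (-(l : ℂ)) := by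
  
  have hn0 : n ≠ 0 := Nat.one_le_iff_ne_zero.1 hn
  have hn' : (n : ℂ) ≠ 0 := Nat.cast_ne_zero.2 hn0
  have hnR : (1 : ℝ) ≤ n := by exact_mod_cast hn
  have hs₀ : (p : ℝ) + 1 < ((p : ℂ) + 2).re := by simp
  obtain ⟨γ, hγ⟩ : JoinedIn U 0 ((p : ℂ) + 2) :=
    ((IsOpen.isConnected_iff_isPathConnected hU).1 hUc).joinedIn 0 h0U _ (hUsub hs₀)
  obtain ⟨r, hr⟩ := (isCompact_range γ.continuous).isBounded.exists_norm_le
  obtain ⟨R, hR⟩ := exists_nat_gt r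
  have hK : ∀ s ∈ Set.range γ, s ∈ U ∧ -(R : ℝ) < s.re := by
    rintro _ ⟨τ, rfl⟩
    refine ⟨hγ τ, ?_⟩
    have h1 := (abs_le.1 (Complex.abs_re_le_norm (γ τ))).1
    linarith [hr (γ τ) ⟨τ, rfl⟩]
  obtain ⟨F, hFsum, hFdiff, hFderiv⟩ := exists_continuation_sub_mean hn0 p R hre
  set E : ℂ → ℂ := fun s => (((0 : ℕ) : ℂ)) ^ p
    * (Complex.exp (-s * ∑ i, Complex.log (((0 : ℕ) : ℂ) - x i))
      - 1 / (n : ℂ) * ∑ i, Complex.exp (-(n * s) * Complex.log (((0 : ℕ) : ℂ) - x i))) with hE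
  set H : ℂ → ℂ := fun s => 1 / (n : ℂ) * ∑ i, ∑ l ∈ Finset.range (p + 1),
    (p.choose l : ℂ) * x i ^ (p - l) * h i (n * s - l) with hH
  set G : ℂ → ℂ := fun s => Complex.exp (-s * (Real.log (a n) : ℂ)) * (F s + E s + H s) with hG
  have hZG : ∀ s : ℂ, (p : ℝ) + 1 < s.re → Z s = G s := by
    intro s hs
    have hns : (p : ℝ) + 1 < n * s.re := by nlinarith [(Nat.cast_nonneg p : (0 : ℝ) ≤ p)]
    have h1 : HasSum (fun k : ℕ => (k : ℂ) ^ p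
        * (Complex.exp (-s * ∑ i, Complex.log ((k : ℂ) - x i))
          - 1 / (n : ℂ) * ∑ i, Complex.exp (-(n * s) * Complex.log ((k : ℂ) - x i))))
        (F s + E s) := by
      refine (hasSum_nat_add_iff' 1).1 ?_
      rw [Finset.sum_range_one, add_sub_cancel_right]
      exact hFsum s hns
    have h2 : HasSum (fun k : ℕ => 1 / (n : ℂ) * ∑ i, (k : ℂ) ^ p
        * Complex.exp (-(n * s) * Complex.log ((k : ℂ) - x i))) (H s) :=
      (hasSum_sum fun i _ => hasSum_pow_mul_exp_neg_mul_log (hre i) (heq i) p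
        (by simpa using hns)).mul_left _
    rw [hZeq s hs]
    refine Eq.trans (tsum_congr fun k => ?_)
      ((h1.add h2).mul_left (Complex.exp (-s * (Real.log (a n) : ℂ)))).tsum_eq
    rw [log_Pval_eq han hfact hre, mul_add, Complex.exp_add, ← Finset.mul_sum]
    ring
  have hGdiff : ∀ s : ℂ, -(R : ℝ) < s.re → ∀ᶠ t in 𝓝[≠] s, DifferentiableAt ℂ G t := by
    intro s hs
    have h2 : ∀ᶠ t in 𝓝[≠] s, ∀ l ∈ Finset.range (p + 1), n * t + (-(l : ℂ)) ≠ 1 :=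
      (Filter.eventually_all_finset _).2 fun l _ => eventually_mul_add_ne hn' _ _ _
    filter_upwards [hFdiff s hs, h2] with t ht1 ht2
    refine DifferentiableAt.mul (by fun_prop) ((ht1.add (by fun_prop)).add ?_)
    refine (DifferentiableAt.fun_sum fun i _ => DifferentiableAt.fun_sum fun l hl =>
      DifferentiableAt.const_mul ?_ _).const_mul _
    have hne : (n : ℂ) * t - l ≠ 1 := by rw [sub_eq_add_neg]; exact ht2 l hl
    exact DifferentiableAt.comp t (f := fun s : ℂ => n * s - l)
      ((hdiff i).differentiableAt (isOpen_compl_singleton.mem_nhds hne)) (by fun_prop)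
  have hEderiv : HasDerivAt E 0 0 := by
    have h1 : HasDerivAt (fun s : ℂ => Complex.exp (-s * ∑ i, Complex.log (((0 : ℕ) : ℂ) - x i)))
        (-∑ i, Complex.log (((0 : ℕ) : ℂ) - x i)) 0 :=
      (((hasDerivAt_id (0 : ℂ)).neg.mul_const _).cexp).congr_deriv (by simp)
    have h2 : HasDerivAt
        (fun s : ℂ => ∑ i, Complex.exp (-(n * s) * Complex.log (((0 : ℕ) : ℂ) - x i)))
        (∑ i, -(n * Complex.log (((0 : ℕ) : ℂ) - x i))) 0 :=
      HasDerivAt.fun_sum fun i _ =>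
        ((((hasDerivAt_id (0 : ℂ)).const_mul (n : ℂ)).neg.mul_const _).cexp).congr_deriv (by simp)
    refine ((h1.sub (h2.const_mul _)).const_mul _).congr_deriv ?_
    rw [Finset.sum_neg_distrib, ← Finset.mul_sum]
    field_simp
    ring
  have hHderiv : HasDerivAt H (∑ i, ∑ l ∈ Finset.range (p + 1),
      (p.choose l : ℂ) * x i ^ (p - l) * deriv (h i) (-(l : ℂ))) 0 := by
    have h1 : ∀ i, ∀ l : ℕ, HasDerivAt (fun s : ℂ => h i (n * s - l))
        (deriv (h i) (-(l : ℂ)) * n) 0 := by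
      intro i l
      have hne : -(l : ℂ) ≠ 1 := by
        intro hl
        have := congrArg Complex.re hl
        simp at this
        linarith [(Nat.cast_nonneg l : (0 : ℝ) ≤ l)]
      have hd : HasDerivAt (h i) (deriv (h i) (-(l : ℂ))) (n * 0 - (l : ℂ)) := by
        rw [mul_zero, zero_sub]
        exact ((hdiff i).differentiableAt (isOpen_compl_singleton.mem_nhds hne)).hasDerivAt
      refine HasDerivAt.comp (0 : ℂ) (h := fun s : ℂ => n * s - l) hd ?_
      simpa using ((hasDerivAt_id (0 : ℂ)).const_mul (n : ℂ)).sub_const (l : ℂ)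
    refine ((HasDerivAt.fun_sum fun i _ => HasDerivAt.fun_sum fun l _ =>
      (h1 i l).const_mul ((p.choose l : ℂ) * x i ^ (p - l))).const_mul _).congr_deriv ?_
    simp only [← mul_assoc, ← Finset.sum_mul]
    field_simp
  have hexp : HasDerivAt (fun s : ℂ => Complex.exp (-s * (Real.log (a n) : ℂ)))
      (-(Real.log (a n) : ℂ)) 0 :=
    (((hasDerivAt_id (0 : ℂ)).neg.mul_const _).cexp).congr_deriv (by simp)
  have hGderiv := hexp.mul ((hFderiv.add hEderiv).add hHderiv)
  have hZd : DifferentiableAt ℂ Z 0 := hZ.differentiableAt (hU.mem_nhds h0U)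
  have hpunct : ∀ᶠ t in 𝓝[≠] (0 : ℂ), Z t - G t = 0 := by
    refine eventually_eq_zero_of_isPreconnected (f := fun t => Z t - G t)
      (isPreconnected_range γ.continuous) (fun s hs => ?_) (s₀ := (p : ℂ) + 2) ⟨1, γ.target⟩ ?_
      ⟨0, γ.source⟩
    · have hUs : ∀ᶠ t in 𝓝[≠] s, t ∈ U := nhdsWithin_le_nhds (hU.mem_nhds (hK s hs).1)
      filter_upwards [hUs, hGdiff s (hK s hs).2] with t ht1 ht2
      exact (hZ.differentiableAt (hU.mem_nhds ht1)).sub ht2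
    · have hopen : ∀ᶠ t in 𝓝[≠] ((p : ℂ) + 2), (p : ℝ) + 1 < t.re :=
        nhdsWithin_le_nhds ((isOpen_lt continuous_const Complex.continuous_re).mem_nhds hs₀)
      filter_upwards [hopen] with t ht
      rw [hZG t ht, sub_self]
  have hGcont : ContinuousAt G 0 := hGderiv.continuousAt
  have hZG' : Z =ᶠ[𝓝 0] G := by
    rw [← ContinuousAt.eventuallyEq_nhds_iff_eventuallyEq_nhdsNE hZd.continuousAt hGcont]
    filter_upwards [hpunct] with t ht using sub_eq_zero.1 ht
  have hZ0 : Z 0 = F 0 + E 0 + H 0 := by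
    rw [hZG'.eq_of_nhds, hG]
    simp
  rw [(hGderiv.congr_of_eventuallyEq hZG').deriv, hZ0]
  simp only [neg_zero, zero_mul, Complex.exp_zero, one_mul, Pi.add_apply, add_zero]
  push_cast
  ring
end

section
/- Let Z be a holomorphic extension of ζ^{(0)}_P to an open connected set containing 0 and the half-plane {s : Re s > 1}. Then exp(Z'(0)) = a_n^{−(1/2 − a_{n−1}/(n a_n))} · (2π)^{−n/2} · ∏_{i=1}^n Γ(−x_i), where Γ is the complex Gamma function and the real power of a_n > 0 is used. -/
open Filter Topology Asymptotics

theorem exists_inv_Gamma_eq_mul (j : ℕ) :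
    ∃ Q : ℂ → ℂ, Differentiable ℂ Q ∧ ∀ z, (Complex.Gamma z)⁻¹ = Q z * (z + j) := by
  induction j with
  | zero =>
    refine ⟨fun z => (Complex.Gamma (z + 1))⁻¹,
      Complex.differentiable_one_div_Gamma.comp (differentiable_id.add_const 1), fun z => ?_⟩
    rw [Complex.one_div_Gamma_eq_self_mul_one_div_Gamma_add_one]
    simp [mul_comm]
  | succ j ih =>
    obtain ⟨Q, hQ, h⟩ := ih
    refine ⟨fun z => z * Q (z + 1),
      differentiable_id.mul (hQ.comp (differentiable_id.add_const 1)), fun z => ?_⟩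
    rw [Complex.one_div_Gamma_eq_self_mul_one_div_Gamma_add_one, h]
    push_cast
    ring

theorem exists_entire_inv_Gamma_mul_riemannZeta (j : ℕ) :
    ∃ E : ℂ → ℂ, Differentiable ℂ E ∧
      ∀ z : ℂ, z + j ≠ 1 → E z = (Complex.Gamma (z - 1))⁻¹ * riemannZeta (z + j) := by
  obtain ⟨Q, hQ, h⟩ := exists_inv_Gamma_eq_mul j
  refine ⟨fun z => Q (z - 1) * riemannZeta₁ (z + j), by fun_prop, fun z hz => ?_⟩
  have hz' : z + j - 1 ≠ 0 := sub_ne_zero.2 hz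
  rw [h, riemannZeta_eq_inv_sub_mul hz]
  have : z - 1 + j = z + j - 1 := by ring
  rw [this]
  field_simp

theorem exists_summable_bound_dirichlet (n J : ℕ) (e : ℕ → ℂ → ℂ)
    (hb : ∀ R : ℝ, ∃ C : ℝ, ∀ k s, ‖s‖ ≤ R → ‖e k s‖ ≤ C * ((k + 1 : ℝ)⁻¹) ^ J)
    {s₀ : ℂ} (hs₀ : 1 < n * s₀.re + J) :
    ∃ V : Set ℂ, IsOpen V ∧ s₀ ∈ V ∧ ∃ u : ℕ → ℝ, Summable u ∧
      ∀ k : ℕ, ∀ s ∈ V, ‖(k + 1 : ℂ) ^ (-(n * s)) * e k s‖ ≤ u k := by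
  obtain ⟨r, hr1, hr⟩ := exists_between hs₀
  obtain ⟨C, hC⟩ := hb (‖s₀‖ + 1)
  have hC0 : 0 ≤ C := by
    have := (norm_nonneg _).trans (hC 0 s₀ (by linarith))
    simpa using this
  refine ⟨Metric.ball s₀ 1 ∩ {s | r < n * s.re + J}, Metric.isOpen_ball.inter
    (isOpen_lt continuous_const (by fun_prop)), ⟨by simp, hr⟩,
    fun k => C * ((k + 1 : ℕ) : ℝ) ^ (-r), ?_, ?_⟩
  · exact (((summable_nat_add_iff 1).2 (Real.summable_nat_rpow.2 (by linarith)))).mul_left C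
  · rintro k s ⟨h1, h2⟩
    have hk : (0 : ℝ) < k + 1 := by positivity
    have hs : ‖s‖ ≤ ‖s₀‖ + 1 := by
      have : ‖s - s₀‖ < 1 := by simpa [dist_eq_norm] using h1
      have := norm_le_norm_add_norm_sub' s s₀
      linarith
    have e1 : ‖(k + 1 : ℂ) ^ (-(n * s))‖ = (k + 1 : ℝ) ^ (-(n * s.re)) := by
      have := Complex.norm_cpow_eq_rpow_re_of_pos hk (-(n * s))
      simpa using this
    rw [norm_mul, e1]
    calc _ ≤ (k + 1 : ℝ) ^ (-(n * s.re)) * (C * ((k + 1 : ℝ)⁻¹) ^ J) := by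
            gcongr; exact hC k s hs
      _ = C * (k + 1 : ℝ) ^ (-(n * s.re + J)) := by
            rw [neg_add, Real.rpow_add hk, Real.rpow_neg hk.le (J : ℝ), Real.rpow_natCast, inv_pow]
            ring
      _ ≤ _ := by
            push_cast
            gcongr
            · linarith [Nat.cast_nonneg (α := ℝ) k]
            · exact le_of_lt h2

theorem differentiableOn_tsum_dirichlet (n J : ℕ) (e : ℕ → ℂ → ℂ)
    (he : ∀ k, Differentiable ℂ (e k))
    (hb : ∀ R : ℝ, ∃ C : ℝ, ∀ k s, ‖s‖ ≤ R → ‖e k s‖ ≤ C * ((k + 1 : ℝ)⁻¹) ^ J) :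
    DifferentiableOn ℂ (fun s : ℂ => ∑' k : ℕ, (k + 1 : ℂ) ^ (-(n * s)) * e k s)
      {s | 1 < n * s.re + J} := by
  intro s₀ hs₀
  obtain ⟨V, hV, hsV, u, hu, hle⟩ := exists_summable_bound_dirichlet n J e hb hs₀
  refine ((Complex.differentiableOn_tsum_of_summable_norm hu (fun k => ?_) hV hle).differentiableAt
    (hV.mem_nhds hsV)).differentiableWithinAt
  have hk : (k + 1 : ℂ) ≠ 0 := Nat.cast_add_one_ne_zero k
  exact ((Differentiable.const_cpow (by fun_prop) (Or.inl hk)).mul (he k)).differentiableOn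

theorem summable_dirichlet (n J : ℕ) (e : ℕ → ℂ → ℂ)
    (hb : ∀ R : ℝ, ∃ C : ℝ, ∀ k s, ‖s‖ ≤ R → ‖e k s‖ ≤ C * ((k + 1 : ℝ)⁻¹) ^ J)
    {s : ℂ} (hs : 1 < n * s.re + J) :
    Summable fun k : ℕ => (k + 1 : ℂ) ^ (-(n * s)) * e k s := by
  obtain ⟨V, hV, hsV, u, hu, hle⟩ := exists_summable_bound_dirichlet n J e hb hs
  exact hu.of_norm_bounded fun k => hle k s hsV

theorem hasDerivAt_zero_tsum_dirichlet (n J : ℕ) (hJ : 1 < J) (e : ℕ → ℂ → ℂ)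
    (he : ∀ k, Differentiable ℂ (e k)) (he0 : ∀ k, e k 0 = 0)
    (hb : ∀ R : ℝ, ∃ C : ℝ, ∀ k s, ‖s‖ ≤ R → ‖e k s‖ ≤ C * ((k + 1 : ℝ)⁻¹) ^ J) :
    ∃ D : ℂ, HasSum (fun k => deriv (e k) 0) D ∧
      HasDerivAt (fun s : ℂ => ∑' k : ℕ, (k + 1 : ℂ) ^ (-(n * s)) * e k s) D 0 := by
  have h0 : 1 < n * (0 : ℂ).re + J := by simpa using hJ
  obtain ⟨V, hV, hsV, u, hu, hle⟩ := exists_summable_bound_dirichlet n J e hb h0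
  have hd : ∀ k : ℕ, Differentiable ℂ fun s : ℂ => (k + 1 : ℂ) ^ (-(n * s)) := fun k =>
    Differentiable.const_cpow (by fun_prop) (Or.inl (Nat.cast_add_one_ne_zero k))
  have hs := Complex.hasSum_deriv_of_summable_norm hu
    (fun k => ((hd k).mul (he k)).differentiableOn) hV hle hsV
  refine ⟨_, ?_, ((Complex.differentiableOn_tsum_of_summable_norm hu
    (fun k => ((hd k).mul (he k)).differentiableOn) hV hle).differentiableAt
    (hV.mem_nhds hsV)).hasDerivAt⟩
  have h : (fun k => deriv (e k) 0) =
      fun k : ℕ => deriv ((fun s : ℂ => (k + 1 : ℂ) ^ (-(n * s))) * e k) 0 := by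
    funext k
    rw [deriv_mul (hd k 0) (he k 0), he0]
    simp
  rw [h]
  exact hs

theorem exists_bound_of_eventually_bound (J : ℕ) (e : ℕ → ℂ → ℂ) (he : ∀ k, Continuous (e k))
    (hb : ∀ R : ℝ, 0 ≤ R → ∃ C : ℝ, ∀ᶠ k : ℕ in atTop, ∀ s, ‖s‖ ≤ R →
      ‖e k s‖ ≤ C * ((k + 1 : ℝ)⁻¹) ^ J) (R : ℝ) :
    ∃ C : ℝ, ∀ k s, ‖s‖ ≤ R → ‖e k s‖ ≤ C * ((k + 1 : ℝ)⁻¹) ^ J := by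
  rcases lt_or_ge R 0 with hR | hR
  · exact ⟨0, fun k s hs => absurd (hs.trans_lt hR) (not_lt.2 (norm_nonneg s))⟩
  obtain ⟨C, hC⟩ := hb R hR
  obtain ⟨K, hK⟩ := eventually_atTop.1 hC
  have hB : ∀ k : ℕ, ∃ B : ℝ, 0 ≤ B ∧ ∀ s, ‖s‖ ≤ R → ‖e k s‖ ≤ B * ((k + 1 : ℝ)⁻¹) ^ J := by
    intro k
    obtain ⟨B, hB⟩ := (isCompact_closedBall (0 : ℂ) R).exists_bound_of_continuousOn
      (he k).continuousOn
    refine ⟨|B| * (k + 1 : ℝ) ^ J, by positivity, fun s hs => ?_⟩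
    have hk : (k + 1 : ℝ) ≠ 0 := by positivity
    rw [mul_assoc, ← mul_pow, mul_inv_cancel₀ hk, one_pow, mul_one]
    exact (hB s (by simpa using hs)).trans (le_abs_self B)
  choose B hB0 hB using hB
  refine ⟨|C| + ∑ k ∈ Finset.range K, B k, fun k s hs => ?_⟩
  have hsum : 0 ≤ ∑ k ∈ Finset.range K, B k := Finset.sum_nonneg fun k _ => hB0 k
  rcases lt_or_ge k K with hk | hk
  · refine (hB k s hs).trans ?_
    gcongr
    have := Finset.single_le_sum (f := B) (fun k _ => hB0 k) (Finset.mem_range.2 hk)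
    linarith [abs_nonneg C]
  · refine (hK k hk s hs).trans ?_
    gcongr
    linarith [le_abs_self C]

theorem exp_mul_expansion_bound (L : ℂ → ℂ) (hL : DifferentiableAt ℂ L 0) (hL0 : L 0 = 0)
    (J : ℕ) (a : ℕ → ℕ → ℂ)
    (ha : ∀ m < J, (fun w => L w ^ m - ∑ j ∈ Finset.range J, a m j * w ^ j)
      =O[𝓝 0] fun w => ‖w‖ ^ J) (R : ℝ) :
    ∃ C : ℝ, ∀ (k : ℕ) (s : ℂ), ‖s‖ ≤ R →
      ‖Complex.exp (s * L ((k + 1 : ℂ)⁻¹)) - ∑ j ∈ Finset.range J,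
        (∑ m ∈ Finset.range J, s ^ m / m.factorial * a m j) * ((k + 1 : ℂ)⁻¹) ^ j‖
        ≤ C * ((k + 1 : ℝ)⁻¹) ^ J := by
  refine exists_bound_of_eventually_bound J (fun k s => Complex.exp (s * L ((k + 1 : ℂ)⁻¹)) -
    ∑ j ∈ Finset.range J, (∑ m ∈ Finset.range J, s ^ m / m.factorial * a m j) *
      ((k + 1 : ℂ)⁻¹) ^ j) (fun k => by fun_prop) (fun R hR => ?_) R
  obtain ⟨A, hA0, hA⟩ : ∃ A > 0, ∀ᶠ w in 𝓝 (0 : ℂ), ‖L w‖ ≤ A * ‖w‖ := by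
    have : L =O[𝓝 0] fun w => w := by simpa [hL0] using hL.isBigO_sub
    obtain ⟨A, hA0, hA⟩ := this.exists_pos
    exact ⟨A, hA0, hA.bound⟩
  have hB : ∀ m, ∃ B : ℝ, m < J → ∀ᶠ w in 𝓝 (0 : ℂ),
      ‖L w ^ m - ∑ j ∈ Finset.range J, a m j * w ^ j‖ ≤ B * ‖w‖ ^ J := by
    intro m
    by_cases hm : m < J
    · obtain ⟨B, hB⟩ := (ha m hm).bound
      exact ⟨B, fun _ => by simpa using hB⟩
    · exact ⟨0, fun h => absurd h hm⟩
  choose B hB using hB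
  have hBall : ∀ᶠ w in 𝓝 (0 : ℂ), ∀ m ∈ Finset.range J,
      ‖L w ^ m - ∑ j ∈ Finset.range J, a m j * w ^ j‖ ≤ B m * ‖w‖ ^ J :=
    (Finset.eventually_all _).2 fun m hm => hB m (Finset.mem_range.1 hm)
  have h1 : ∀ᶠ w in 𝓝 (0 : ℂ), ‖w‖ ≤ 1 := by
    filter_upwards [Metric.closedBall_mem_nhds (0 : ℂ) one_pos] with w hw
    simpa using hw
  have hlim : Tendsto (fun k : ℕ => (k + 1 : ℂ)⁻¹) atTop (𝓝 0) := by
    simpa using tendsto_one_div_add_atTop_nhds_zero_nat (𝕜 := ℂ)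
  refine ⟨(R * A) ^ J * Real.exp (R * A) + ∑ m ∈ Finset.range J, R ^ m / m.factorial * B m, ?_⟩
  filter_upwards [hlim.eventually hA, hlim.eventually hBall, hlim.eventually h1] with k hk1 hk2 hk3
  intro s hs
  have hw : ‖(k + 1 : ℂ)⁻¹‖ = (k + 1 : ℝ)⁻¹ := by
    have : (k + 1 : ℂ) = ((k + 1 : ℕ) : ℂ) := by push_cast; rfl
    rw [norm_inv, this, Complex.norm_natCast]; push_cast; rfl
  set w : ℂ := (k + 1 : ℂ)⁻¹
  rw [← hw]
  have hsplit : Complex.exp (s * L w) - ∑ j ∈ Finset.range J,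
        (∑ m ∈ Finset.range J, s ^ m / m.factorial * a m j) * w ^ j
      = (Complex.exp (s * L w) - ∑ m ∈ Finset.range J, (s * L w) ^ m / m.factorial)
        + ∑ m ∈ Finset.range J, s ^ m / m.factorial *
          (L w ^ m - ∑ j ∈ Finset.range J, a m j * w ^ j) := by
    simp only [mul_sub, Finset.sum_sub_distrib, Finset.mul_sum, Finset.sum_mul]
    rw [Finset.sum_comm]
    have : ∀ m, (s * L w) ^ m / (m.factorial : ℂ) = s ^ m / m.factorial * L w ^ m := fun m => by
      rw [mul_pow]; ring
    simp only [this, mul_assoc]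
    ring
  have hsL : ‖s * L w‖ ≤ R * A * ‖w‖ := by
    rw [norm_mul, mul_assoc]; gcongr
  have hsL' : ‖s * L w‖ ≤ R * A := hsL.trans (mul_le_of_le_one_right (by positivity) hk3)
  rw [hsplit, add_mul, Finset.sum_mul]
  refine (norm_add_le _ _).trans (add_le_add ?_ ((norm_sum_le _ _).trans (Finset.sum_le_sum ?_)))
  · calc _ ≤ _ := Complex.norm_exp_sub_sum_le_norm_mul_exp _ _
      _ ≤ (R * A * ‖w‖) ^ J * Real.exp (R * A) := by gcongr
      _ = _ := by rw [mul_pow]; ring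
  · intro m hm
    rw [norm_mul, norm_div, norm_pow, Complex.norm_natCast, mul_assoc]
    gcongr
    exact hk2 m hm

theorem exists_exp_mul_expansion (L : ℂ → ℂ) (hL : AnalyticAt ℂ L 0) (hL0 : L 0 = 0) (J : ℕ) :
    ∃ c : ℕ → ℂ → ℂ, (∀ j, Differentiable ℂ (c j)) ∧ ∀ R : ℝ, ∃ C : ℝ, ∀ (k : ℕ) (s : ℂ), ‖s‖ ≤ R →
      ‖Complex.exp (s * L ((k + 1 : ℂ)⁻¹)) - ∑ j ∈ Finset.range J, c j s * ((k + 1 : ℂ)⁻¹) ^ j‖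
        ≤ C * ((k + 1 : ℝ)⁻¹) ^ J := by
  have h : ∀ m : ℕ, ∃ a : ℕ → ℂ, (fun w => L w ^ m - ∑ j ∈ Finset.range J, a j * w ^ j)
      =O[𝓝 0] fun w => ‖w‖ ^ J := by
    intro m
    obtain ⟨p, hp⟩ := hL.pow m
    refine ⟨p.coeff, ?_⟩
    simpa [FormalMultilinearSeries.partialSum, mul_comm] using hp.isBigO_sub_partialSum_pow J
  choose a ha using h
  exact ⟨fun j s => ∑ m ∈ Finset.range J, s ^ m / m.factorial * a m j, fun j => by fun_prop,
    exp_mul_expansion_bound L hL.differentiableAt hL0 J a fun m _ => ha m⟩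

theorem exp_mul_expansion_two (L : ℂ → ℂ) (hL : AnalyticAt ℂ L 0) (hL0 : L 0 = 0) (R : ℝ) :
    ∃ C : ℝ, ∀ (k : ℕ) (s : ℂ), ‖s‖ ≤ R →
      ‖Complex.exp (s * L ((k + 1 : ℂ)⁻¹)) -
        ∑ j ∈ Finset.range 2, (if j = 0 then 1 else s * deriv L 0) * ((k + 1 : ℂ)⁻¹) ^ j‖
        ≤ C * ((k + 1 : ℝ)⁻¹) ^ 2 := by
  have h := exp_mul_expansion_bound L hL.differentiableAt hL0 2
    (fun m j => if m = 0 then (if j = 0 then 1 else 0) else (if j = 0 then 0 else deriv L 0)) ?_ R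
  · simpa [Finset.sum_range_succ] using h
  · intro m hm
    interval_cases m
    · simp [isBigO_zero]
    · obtain ⟨p, hp⟩ := hL
      have := hp.isBigO_sub_partialSum_pow 2
      have h0 : p.coeff 0 = 0 := by
        have := hp.coeff_zero (fun _ => 0)
        rw [hL0] at this
        simpa using this
      have h1 : p.coeff 1 = deriv L 0 := by
        rw [hp.deriv]; rfl
      simpa [FormalMultilinearSeries.partialSum, Finset.sum_range_succ, mul_comm, h0, h1] using this

theorem tsum_dirichlet_eq_sum_riemannZeta_add (n J : ℕ) (c : ℕ → ℂ → ℂ) (v : ℕ → ℂ → ℂ)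
    (hb : ∀ R : ℝ, ∃ C : ℝ, ∀ (k : ℕ) (s : ℂ), ‖s‖ ≤ R →
      ‖v k s - ∑ j ∈ Finset.range J, c j s * ((k + 1 : ℂ)⁻¹) ^ j‖ ≤ C * ((k + 1 : ℝ)⁻¹) ^ J)
    {s : ℂ} (hs : 1 < (n * s).re) :
    HasSum (fun k : ℕ => (k + 1 : ℂ) ^ (-(n * s)) * v k s)
      (∑ j ∈ Finset.range J, c j s * riemannZeta (n * s + j) +
        ∑' k : ℕ, (k + 1 : ℂ) ^ (-(n * s)) *
          (v k s - ∑ j ∈ Finset.range J, c j s * ((k + 1 : ℂ)⁻¹) ^ j)) := by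
  have hre : (n * s).re = n * s.re := by simp
  have h2 := (summable_dirichlet n J
    (fun k s => v k s - ∑ j ∈ Finset.range J, c j s * ((k + 1 : ℂ)⁻¹) ^ j) hb (s := s)
    (by rw [← hre]; linarith [Nat.cast_nonneg (α := ℝ) J])).hasSum
  have h1 : ∀ j ∈ Finset.range J, HasSum
      (fun k : ℕ => c j s * ((k + 1 : ℂ) ^ (-(n * s)) * ((k + 1 : ℂ)⁻¹) ^ j))
      (c j s * riemannZeta (n * s + j)) := by
    intro j _
    refine HasSum.mul_left _ ?_
    have hj : 1 < (n * s + j).re := by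
      rw [Complex.add_re, Complex.natCast_re]; linarith [Nat.cast_nonneg (α := ℝ) j]
    rw [zeta_eq_tsum_one_div_nat_add_one_cpow hj]
    have hsum : Summable fun k : ℕ => 1 / (k + 1 : ℂ) ^ (n * s + j) := by
      have := (summable_nat_add_iff 1).2 (Complex.summable_one_div_nat_cpow.2 hj)
      simpa using this
    refine hsum.hasSum.congr_fun fun k => ?_
    have hk : (k + 1 : ℂ) ≠ 0 := Nat.cast_add_one_ne_zero k
    rw [Complex.cpow_add _ _ hk, Complex.cpow_neg, Complex.cpow_natCast, inv_pow]
    field_simp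
  refine ((hasSum_sum h1).add h2).congr_fun fun k => ?_
  rw [mul_sub, Finset.mul_sum]
  have : ∀ j, c j s * ((k + 1 : ℂ) ^ (-(n * s)) * ((k + 1 : ℂ)⁻¹) ^ j) =
    (k + 1 : ℂ) ^ (-(n * s)) * (c j s * ((k + 1 : ℂ)⁻¹) ^ j) := fun j => by ring
  simp only [this]
  ring

theorem exists_differentiableOn_inv_Gamma_mul (n J : ℕ) (c : ℕ → ℂ → ℂ) (v : ℕ → ℂ → ℂ)
    (hc : ∀ j, Differentiable ℂ (c j)) (hv : ∀ k, Differentiable ℂ (v k))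
    (hb : ∀ R : ℝ, ∃ C : ℝ, ∀ (k : ℕ) (s : ℂ), ‖s‖ ≤ R →
      ‖v k s - ∑ j ∈ Finset.range J, c j s * ((k + 1 : ℂ)⁻¹) ^ j‖ ≤ C * ((k + 1 : ℝ)⁻¹) ^ J) :
    ∃ F : ℂ → ℂ, DifferentiableOn ℂ F {s | 1 < n * s.re + J} ∧
      ∀ s : ℂ, (∀ j < J, n * s + j ≠ 1) → F s = (Complex.Gamma (n * s - 1))⁻¹ *
        (∑ j ∈ Finset.range J, c j s * riemannZeta (n * s + j) +
        ∑' k : ℕ, (k + 1 : ℂ) ^ (-(n * s)) *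
          (v k s - ∑ j ∈ Finset.range J, c j s * ((k + 1 : ℂ)⁻¹) ^ j)) := by
  choose E hE hEeq using exists_entire_inv_Gamma_mul_riemannZeta
  refine ⟨fun s => ∑ j ∈ Finset.range J, c j s * E j (n * s) +
    (Complex.Gamma (n * s - 1))⁻¹ * ∑' k : ℕ, (k + 1 : ℂ) ^ (-(n * s)) *
      (v k s - ∑ j ∈ Finset.range J, c j s * ((k + 1 : ℂ)⁻¹) ^ j), ?_, fun s hs => ?_⟩
  · refine DifferentiableOn.add (Differentiable.differentiableOn (by fun_prop))
      (DifferentiableOn.mul ?_ ?_)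
    · exact (Complex.differentiable_one_div_Gamma.comp
        ((differentiable_id.const_mul _).sub_const 1)).differentiableOn
    · exact differentiableOn_tsum_dirichlet n J
        (fun k s => v k s - ∑ j ∈ Finset.range J, c j s * ((k + 1 : ℂ)⁻¹) ^ j)
        (fun k => by fun_prop) hb
  · simp only
    rw [mul_add, Finset.mul_sum]
    congr 1
    refine Finset.sum_congr rfl fun j hj => ?_
    rw [hEeq j _ (hs j (Finset.mem_range.1 hj))]
    ring

theorem exists_entire_of_forall_halfPlane (f : ℂ → ℂ)
    (h : ∀ R : ℕ, ∃ F : ℂ → ℂ, DifferentiableOn ℂ F {s | -(R : ℝ) < s.re} ∧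
      ∀ s : ℂ, 1 < s.re → F s = f s) :
    ∃ H : ℂ → ℂ, Differentiable ℂ H ∧ ∀ s : ℂ, 1 < s.re → H s = f s := by
  choose F hF hFf using h
  have hopen : ∀ r : ℝ, IsOpen {s : ℂ | r < s.re} := fun r =>
    isOpen_lt continuous_const Complex.continuous_re
  have hle : ∀ R T : ℕ, R ≤ T → Set.EqOn (F R) (F T) {s | -(R : ℝ) < s.re} := by
    intro R T hRT
    have hRT' : (R : ℝ) ≤ T := by exact_mod_cast hRT
    refine AnalyticOnNhd.eqOn_of_preconnected_of_eventuallyEq (z₀ := 2)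
      ((hF R).analyticOnNhd (hopen _))
      (((hF T).mono fun s (hs : -(R : ℝ) < s.re) =>
        show -(T : ℝ) < s.re by linarith).analyticOnNhd (hopen _))
      (convex_halfSpace_re_gt _).isPreconnected ?_ ?_
    · change -(R : ℝ) < (2 : ℂ).re
      rw [Complex.re_ofNat]
      linarith [Nat.cast_nonneg (α := ℝ) R]
    · filter_upwards [(hopen 1).mem_nhds (show (1 : ℝ) < (2 : ℂ).re by simp)] with s hs
      rw [hFf R s hs, hFf T s hs]
  have hex : ∀ s : ℂ, ∃ R : ℕ, -(R : ℝ) < s.re := fun s => by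
    obtain ⟨R, hR⟩ := exists_nat_gt (-s.re)
    exact ⟨R, by linarith⟩
  choose N hN using hex
  have hEq : ∀ (R : ℕ) (s : ℂ), -(R : ℝ) < s.re → F (N s) s = F R s := by
    intro R s hs
    rcases le_total (N s) R with hle' | hle'
    · exact hle _ _ hle' (hN s)
    · exact (hle _ _ hle' hs).symm
  refine ⟨fun s => F (N s) s, fun s => ?_, fun s hs => hFf _ s hs⟩
  have hs := (hopen (-(N s : ℝ))).mem_nhds (hN s)
  refine ((hF (N s)).differentiableAt hs).congr_of_eventuallyEq ?_
  filter_upwards [hs] with t ht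
  exact hEq (N s) t ht

section factored

variable {n : ℕ} {a : ℕ → ℝ} {x : Fin n → ℂ}

theorem ofReal_Pval
    (hfact : ∀ z : ℂ, (∑ i ∈ Finset.range (n + 1), (a i : ℂ) * z ^ i)
      = (a n : ℂ) * ∏ i : Fin n, (z - x i)) (t : ℝ) :
    (Pval n a t : ℂ) = a n * ∏ i, ((t : ℂ) - x i) := by
  rw [← hfact, Pval]
  push_cast
  rfl

theorem prod_one_sub_mul_inv
    (hfact : ∀ z : ℂ, (∑ i ∈ Finset.range (n + 1), (a i : ℂ) * z ^ i)
      = (a n : ℂ) * ∏ i : Fin n, (z - x i)) (han : 0 < a n) {t : ℝ} (ht : 0 < t) :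
    ∏ i, (1 - x i * (t : ℂ)⁻¹) = ((Pval n a t / (a n * t ^ n) : ℝ) : ℂ) := by
  have ht' : (t : ℂ) ≠ 0 := by exact_mod_cast ht.ne'
  have ha' : (a n : ℂ) ≠ 0 := by exact_mod_cast han.ne'
  have h1 : ∀ i, 1 - x i * (t : ℂ)⁻¹ = (t - x i) * (t : ℂ)⁻¹ := fun i => by field_simp
  push_cast
  rw [ofReal_Pval hfact, Finset.prod_congr rfl fun i _ => h1 i, Finset.prod_mul_distrib]
  simp
  field_simp

theorem Pval_pos
    (hfact : ∀ z : ℂ, (∑ i ∈ Finset.range (n + 1), (a i : ℂ) * z ^ i)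
      = (a n : ℂ) * ∏ i : Fin n, (z - x i)) (han : 0 < a n) (hre : ∀ i, (x i).re < 0)
    {t : ℝ} (ht : 0 ≤ t) : 0 < Pval n a t := by
  have hne : ∀ t : ℝ, 0 ≤ t → Pval n a t ≠ 0 := by
    intro t ht h
    have h' := ofReal_Pval hfact t
    rw [h, Complex.ofReal_zero, eq_comm, mul_eq_zero, Finset.prod_eq_zero_iff] at h'
    rcases h' with h' | ⟨i, -, hi⟩
    · exact han.ne' (by exact_mod_cast h')
    · have := congrArg Complex.re hi
      simp only [Complex.sub_re, Complex.ofReal_re, Complex.zero_re] at this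
      linarith [hre i]
  have hpos : ∀ t : ℝ, 0 < t → 0 < Pval n a t := by
    intro t ht
    let r : ℝ → ℝ := fun w => (∏ i, (1 - x i * (w : ℂ))).re
    have hr : Continuous r := by fun_prop
    have hrt : ∀ u : ℝ, 0 < u → r u⁻¹ = Pval n a u / (a n * u ^ n) := fun u hu => by
      simp only [r, Complex.ofReal_inv]
      rw [prod_one_sub_mul_inv hfact han hu, Complex.ofReal_re]
    by_contra hcon
    have hle : r t⁻¹ ≤ 0 := by
      rw [hrt t ht]
      exact div_nonpos_of_nonpos_of_nonneg (not_lt.1 hcon) (by positivity)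
    obtain ⟨w, hw, hw0⟩ := intermediate_value_Icc' (inv_nonneg.2 ht.le) hr.continuousOn
      (show (0 : ℝ) ∈ Set.Icc (r t⁻¹) (r 0) from ⟨hle, by simp [r]⟩)
    rcases hw.1.eq_or_lt with rfl | hw1
    · simp [r] at hw0
    · have := hrt w⁻¹ (inv_pos.2 hw1)
      rw [inv_inv, hw0, eq_comm, div_eq_zero_iff] at this
      rcases this with h | h
      · exact hne _ (inv_nonneg.2 hw.1) h
      · have : 0 < a n * w⁻¹ ^ n := by positivity
        exact this.ne' h
  rcases ht.eq_or_lt with rfl | ht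
  · by_contra hcon
    have hc : Continuous (Pval n a) := by unfold Pval; fun_prop
    obtain ⟨w, hw, hw0⟩ := intermediate_value_Icc zero_le_one hc.continuousOn
      (show (0 : ℝ) ∈ Set.Icc (Pval n a 0) (Pval n a 1) from ⟨not_lt.1 hcon, (hpos 1 one_pos).le⟩)
    exact hne w hw.1 hw0
  · exact hpos t ht

theorem exp_neg_mul_log_Pval
    (hfact : ∀ z : ℂ, (∑ i ∈ Finset.range (n + 1), (a i : ℂ) * z ^ i)
      = (a n : ℂ) * ∏ i : Fin n, (z - x i)) (han : 0 < a n) (hre : ∀ i, (x i).re < 0)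
    (k : ℕ) (s : ℂ) :
    Complex.exp (-s * (Real.log (Pval n a ((k + 1 : ℕ) : ℝ)) : ℂ)) =
      Complex.exp (-s * (Real.log (a n) : ℂ)) * ((k + 1 : ℂ) ^ (-(n * s)) *
        Complex.exp (s * -Complex.log (∏ i, (1 - x i * (k + 1 : ℂ)⁻¹)))) := by
  have ht : (0 : ℝ) < ((k + 1 : ℕ) : ℝ) := by positivity
  have hP := Pval_pos hfact han hre ht.le
  have hk : (k + 1 : ℂ) = (((k + 1 : ℕ) : ℝ) : ℂ) := by push_cast; rfl
  rw [hk, prod_one_sub_mul_inv hfact han ht, ← Complex.ofReal_log (by positivity),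
    Complex.cpow_def_of_ne_zero (by exact_mod_cast ht.ne'), ← Complex.ofReal_log ht.le,
    Real.log_div hP.ne' (by positivity), Real.log_mul han.ne' (by positivity), Real.log_pow,
    ← Complex.exp_add, ← Complex.exp_add]
  congr 1
  push_cast
  ring

theorem sum_roots_eq (hn : 1 ≤ n)
    (hfact : ∀ z : ℂ, (∑ i ∈ Finset.range (n + 1), (a i : ℂ) * z ^ i)
      = (a n : ℂ) * ∏ i : Fin n, (z - x i)) (han : 0 < a n) :
    ∑ i, x i = -((a (n - 1) / a n : ℝ) : ℂ) := by
  have hpoly : ∑ i ∈ Finset.range (n + 1), Polynomial.C (a i : ℂ) * Polynomial.X ^ i =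
      Polynomial.C (a n : ℂ) * ∏ i, (Polynomial.X - Polynomial.C (x i)) := by
    refine Polynomial.funext fun z => ?_
    simpa [Polynomial.eval_finsetSum, Polynomial.eval_prod] using hfact z
  have hco := congrArg (Polynomial.coeff · (n - 1)) hpoly
  have hv := Polynomial.prod_X_sub_C_coeff_card_pred Finset.univ x (by simpa using Nat.pos_of_ne_zero (by omega))
  rw [Finset.card_univ, Fintype.card_fin] at hv
  simp only [Polynomial.finsetSum_coeff, Polynomial.coeff_C_mul, hv, Polynomial.coeff_X_pow] at hco
  rw [Finset.sum_eq_single (n - 1) (fun i _ hi => by simp [hi.symm])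
    (fun h => absurd (Finset.mem_range.2 (by omega)) h)] at hco
  have ha' : (a n : ℂ) ≠ 0 := by exact_mod_cast han.ne'
  push_cast
  field_simp
  simp at hco
  linear_combination hco

end factored

section gammaProduct

theorem GammaSeq_eq_prod {z : ℂ} (N : ℕ) :
    Complex.GammaSeq z N =
      (N : ℂ) ^ z * z⁻¹ * ∏ k ∈ Finset.range N, (1 + z * (k + 1 : ℂ)⁻¹)⁻¹ := by
  have h : ∀ N : ℕ, ((N.factorial : ℂ)) / ∏ j ∈ Finset.range (N + 1), (z + j) =
      z⁻¹ * ∏ k ∈ Finset.range N, (1 + z * (k + 1 : ℂ)⁻¹)⁻¹ := by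
    intro N
    induction N with
    | zero => simp
    | succ N ih =>
      rw [Finset.prod_range_succ (fun j : ℕ => z + (j : ℂ)) (N + 1),
        Finset.prod_range_succ (fun k : ℕ => (1 + z * (k + 1 : ℂ)⁻¹)⁻¹), ← mul_assoc, ← ih,
        Nat.factorial_succ]
      have hN : (N + 1 : ℂ) ≠ 0 := Nat.cast_add_one_ne_zero N
      have : (1 + z * (N + 1 : ℂ)⁻¹)⁻¹ = (N + 1) * (z + (N + 1))⁻¹ := by
        have : 1 + z * (N + 1 : ℂ)⁻¹ = (z + (N + 1)) * (N + 1 : ℂ)⁻¹ := by field_simp; ring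
        rw [this, mul_inv, inv_inv, mul_comm]
      rw [this]
      push_cast
      simp only [div_eq_mul_inv, mul_inv]
      ring
  rw [Complex.GammaSeq, mul_div_assoc, h, mul_assoc]

theorem exp_tsum_eq_prod_Gamma {n : ℕ} {x : Fin n → ℂ} (hre : ∀ i, (x i).re < 0) {D : ℂ}
    (hD : HasSum (fun k : ℕ => -Complex.log (∏ i, (1 - x i * (k + 1 : ℂ)⁻¹)) -
      (∑ i, x i) * (k + 1 : ℂ)⁻¹) D) :
    Complex.exp (D + (∑ i, x i) * Real.eulerMascheroniConstant) * ∏ i, (-x i)⁻¹ =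
      ∏ i, Complex.Gamma (-x i) := by
  have hne : ∀ (k : ℕ) (i : Fin n), 1 - x i * (k + 1 : ℂ)⁻¹ ≠ 0 := by
    intro k i h
    have hk : (k + 1 : ℂ) ≠ 0 := Nat.cast_add_one_ne_zero k
    have h1 : x i = ((k + 1 : ℝ) : ℂ) := by
      field_simp at h
      push_cast
      linear_combination -h
    have h2 := hre i
    rw [h1, Complex.ofReal_re] at h2
    linarith [Nat.cast_nonneg (α := ℝ) k]
  have hlim : Tendsto (fun N : ℕ => ∏ i, Complex.GammaSeq (-x i) N) atTop
      (𝓝 (∏ i, Complex.Gamma (-x i))) :=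
    tendsto_finsetProd _ fun i _ => Complex.GammaSeq_tendsto_Gamma _
  refine tendsto_nhds_unique ?_ hlim
  have hγ : Tendsto (fun N : ℕ => ((harmonic N - Real.log N : ℝ) : ℂ)) atTop
      (𝓝 (Real.eulerMascheroniConstant : ℂ)) :=
    (Complex.continuous_ofReal.tendsto _).comp Real.tendsto_harmonic_sub_log
  have hS := (((hD.tendsto_sum_nat.add (hγ.const_mul (∑ i, x i))).cexp).mul_const (∏ i, (-x i)⁻¹))
  refine hS.congr' ?_
  filter_upwards [eventually_ne_atTop 0] with N hN
  have hN' : (N : ℂ) ≠ 0 := by exact_mod_cast hN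
  have hharm : ((harmonic N : ℝ) : ℂ) = ∑ k ∈ Finset.range N, (k + 1 : ℂ)⁻¹ := by
    simp [harmonic]
  have hlog : ((Real.log N : ℝ) : ℂ) = Complex.log N := by
    rw [Complex.ofReal_log (by positivity)]; simp
  simp only [GammaSeq_eq_prod, Finset.prod_mul_distrib]
  rw [Finset.prod_comm]
  have h1 : ∏ i, (N : ℂ) ^ (-x i) = Complex.exp (-(∑ i, x i) * Complex.log N) := by
    simp only [Complex.cpow_def_of_ne_zero hN', ← Complex.exp_sum]
    rw [← Finset.mul_sum, Finset.sum_neg_distrib, mul_comm]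
  have h2 : ∀ k : ℕ, ∏ i, (1 + -x i * (k + 1 : ℂ)⁻¹)⁻¹ =
      Complex.exp (-Complex.log (∏ i, (1 - x i * (k + 1 : ℂ)⁻¹))) := by
    intro k
    rw [Complex.exp_neg, Complex.exp_log (Finset.prod_ne_zero_iff.2 fun i _ => hne k i),
      Finset.prod_inv_distrib]
    simp [sub_eq_add_neg]
  simp only [h1, h2, ← Complex.exp_sum]
  rw [mul_right_comm, ← Complex.exp_add]
  congr 2
  rw [Complex.ofReal_sub, hharm, hlog, Finset.sum_sub_distrib, ← Finset.mul_sum]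
  ring

end gammaProduct

theorem analyticAt_neg_log_prod_one_sub {n : ℕ} (x : Fin n → ℂ) :
    AnalyticAt ℂ (fun w : ℂ => -Complex.log (∏ i, (1 - x i * w))) 0 := by
  have h : Differentiable ℂ fun w : ℂ => ∏ i, (1 - x i * w) := by fun_prop
  exact ((h.analyticAt 0).clog (by simp)).neg

theorem deriv_neg_log_prod_one_sub {n : ℕ} (x : Fin n → ℂ) :
    deriv (fun w : ℂ => -Complex.log (∏ i, (1 - x i * w))) 0 = ∑ i, x i := by
  have h : HasDerivAt (fun w : ℂ => ∏ i, (1 - x i * w)) (-∑ i, x i) 0 := by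
    have := HasDerivAt.fun_finsetProd (u := Finset.univ) (f := fun i (w : ℂ) => 1 - x i * w)
      (f' := fun i => -(x i)) (x := 0) fun i _ => by
        simpa using ((hasDerivAt_id (0 : ℂ)).const_mul (x i)).const_sub 1
    simpa using this
  simpa using ((h.clog (by simp)).neg).deriv

theorem tsum_exp_neg_mul_log_Pval {n : ℕ} (hn : 1 ≤ n) {a : ℕ → ℝ} {x : Fin n → ℂ}
    (hfact : ∀ z : ℂ, (∑ i ∈ Finset.range (n + 1), (a i : ℂ) * z ^ i)
      = (a n : ℂ) * ∏ i : Fin n, (z - x i)) (han : 0 < a n) (hre : ∀ i, (x i).re < 0)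
    {J : ℕ} {c : ℕ → ℂ → ℂ} {v : ℕ → ℂ → ℂ}
    (hv : ∀ k s, v k s = Complex.exp (s * -Complex.log (∏ i, (1 - x i * (k + 1 : ℂ)⁻¹))))
    (hb : ∀ R : ℝ, ∃ C : ℝ, ∀ (k : ℕ) (s : ℂ), ‖s‖ ≤ R →
      ‖v k s - ∑ j ∈ Finset.range J, c j s * ((k + 1 : ℂ)⁻¹) ^ j‖ ≤ C * ((k + 1 : ℝ)⁻¹) ^ J)
    {s : ℂ} (hs : 1 < s.re) :
    ∑' k : ℕ, Complex.exp (-s * (Real.log (Pval n a k) : ℂ)) =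
      Complex.exp (-s * (Real.log (Pval n a 0) : ℂ)) + Complex.exp (-s * (Real.log (a n) : ℂ)) *
        (∑ j ∈ Finset.range J, c j s * riemannZeta (n * s + j) +
          ∑' k : ℕ, (k + 1 : ℂ) ^ (-(n * s)) *
            (v k s - ∑ j ∈ Finset.range J, c j s * ((k + 1 : ℂ)⁻¹) ^ j)) := by
  have hn' : (1 : ℝ) ≤ n := by exact_mod_cast hn
  have hns : 1 < (n * s).re := by
    have : (n * s).re = n * s.re := by simp
    rw [this]
    nlinarith
  have h := ((tsum_dirichlet_eq_sum_riemannZeta_add n J c v hb hns).mul_left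
    (Complex.exp (-s * (Real.log (a n) : ℂ)))).congr_fun
      (g := fun k : ℕ => Complex.exp (-s * (Real.log (Pval n a ((k + 1 : ℕ) : ℝ)) : ℂ)))
      fun k => by rw [exp_neg_mul_log_Pval hfact han hre k s, hv]
  have h' := (hasSum_nat_add_iff'
    (f := fun k : ℕ => Complex.exp (-s * (Real.log (Pval n a k) : ℂ))) 1).1
      (by simpa only [Finset.sum_range_one, Nat.cast_zero, add_sub_cancel_left] using h :
        HasSum _ (Complex.exp (-s * (Real.log (Pval n a 0) : ℂ)) +
          Complex.exp (-s * (Real.log (a n) : ℂ)) * _ - _))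
  exact h'.tsum_eq

theorem eventuallyEq_riemannZeta_expansion {n : ℕ} (hn : 1 ≤ n) {a : ℕ → ℝ} {x : Fin n → ℂ}
    (hfact : ∀ z : ℂ, (∑ i ∈ Finset.range (n + 1), (a i : ℂ) * z ^ i)
      = (a n : ℂ) * ∏ i : Fin n, (z - x i)) (han : 0 < a n) (hre : ∀ i, (x i).re < 0)
    {U : Set ℂ} {Z : ℂ → ℂ} (hU : IsOpen U) (hUc : IsConnected U) (h0U : (0 : ℂ) ∈ U)
    (hUsub : {s : ℂ | 1 < s.re} ⊆ U) (hZ : DifferentiableOn ℂ Z U)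
    (hZeq : ∀ s : ℂ, 1 < s.re →
      Z s = ∑' k : ℕ, Complex.exp (-s * (Real.log (Pval n a k) : ℂ)))
    {J : ℕ} (hJ : 1 < J) {c : ℕ → ℂ → ℂ} (hc : ∀ j, Differentiable ℂ (c j)) {v : ℕ → ℂ → ℂ}
    (hv : ∀ k s, v k s = Complex.exp (s * -Complex.log (∏ i, (1 - x i * (k + 1 : ℂ)⁻¹))))
    (hb : ∀ R : ℝ, ∃ C : ℝ, ∀ (k : ℕ) (s : ℂ), ‖s‖ ≤ R →
      ‖v k s - ∑ j ∈ Finset.range J, c j s * ((k + 1 : ℂ)⁻¹) ^ j‖ ≤ C * ((k + 1 : ℝ)⁻¹) ^ J) :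
    ∀ᶠ s in 𝓝[≠] 0, Z s =
      Complex.exp (-s * (Real.log (Pval n a 0) : ℂ)) + Complex.exp (-s * (Real.log (a n) : ℂ)) *
        (∑ j ∈ Finset.range J, c j s * riemannZeta (n * s + j) +
          ∑' k : ℕ, (k + 1 : ℂ) ^ (-(n * s)) *
            (v k s - ∑ j ∈ Finset.range J, c j s * ((k + 1 : ℂ)⁻¹) ^ j)) := by
  have hn0 : (0 : ℝ) < n := by exact_mod_cast hn
  have hv' : ∀ k, Differentiable ℂ (v k) := fun k => by
    have : v k = _ := funext (hv k)
    rw [this]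
    fun_prop
  have hg : Differentiable ℂ fun s : ℂ => (Complex.Gamma (n * s - 1))⁻¹ :=
    Complex.differentiable_one_div_Gamma.comp ((differentiable_id.const_mul _).sub_const 1)
  have hopen : IsOpen {s : ℂ | 1 < s.re} := isOpen_lt continuous_const Complex.continuous_re
  have hopenJ : ∀ J : ℕ, IsOpen {s : ℂ | 1 < n * s.re + J} := fun J =>
    isOpen_lt continuous_const (by fun_prop)
  have h2 : {s : ℂ | 1 < s.re} ∈ 𝓝 (2 : ℂ) :=
    hopen.mem_nhds (show (1 : ℝ) < (2 : ℂ).re by simp)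
  have hcont : ∀ (J : ℕ) (c : ℕ → ℂ → ℂ), (∀ j, Differentiable ℂ (c j)) →
      (∀ R : ℝ, ∃ C : ℝ, ∀ (k : ℕ) (s : ℂ), ‖s‖ ≤ R →
        ‖v k s - ∑ j ∈ Finset.range J, c j s * ((k + 1 : ℂ)⁻¹) ^ j‖
          ≤ C * ((k + 1 : ℝ)⁻¹) ^ J) →
      ∃ F : ℂ → ℂ, DifferentiableOn ℂ F {s | 1 < n * s.re + J} ∧
        (∀ s : ℂ, (∀ j < J, n * s + j ≠ 1) → F s = (Complex.Gamma (n * s - 1))⁻¹ *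
          (Complex.exp (-s * (Real.log (Pval n a 0) : ℂ)) +
            Complex.exp (-s * (Real.log (a n) : ℂ)) *
            (∑ j ∈ Finset.range J, c j s * riemannZeta (n * s + j) +
              ∑' k : ℕ, (k + 1 : ℂ) ^ (-(n * s)) *
                (v k s - ∑ j ∈ Finset.range J, c j s * ((k + 1 : ℂ)⁻¹) ^ j)))) ∧
        ∀ s : ℂ, 1 < s.re → F s = (Complex.Gamma (n * s - 1))⁻¹ * Z s := by
    intro J c hc hb
    obtain ⟨F, hF, hFeq⟩ := exists_differentiableOn_inv_Gamma_mul n J c v hc hv' hb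
    have key : ∀ s : ℂ, (∀ j < J, n * s + j ≠ 1) →
        (Complex.Gamma (n * s - 1))⁻¹ * Complex.exp (-s * (Real.log (Pval n a 0) : ℂ)) +
          Complex.exp (-s * (Real.log (a n) : ℂ)) * F s = (Complex.Gamma (n * s - 1))⁻¹ *
          (Complex.exp (-s * (Real.log (Pval n a 0) : ℂ)) +
            Complex.exp (-s * (Real.log (a n) : ℂ)) *
            (∑ j ∈ Finset.range J, c j s * riemannZeta (n * s + j) +
              ∑' k : ℕ, (k + 1 : ℂ) ^ (-(n * s)) *
                (v k s - ∑ j ∈ Finset.range J, c j s * ((k + 1 : ℂ)⁻¹) ^ j))) := by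
      intro s hs
      rw [hFeq s hs]
      ring
    refine ⟨_, ((hg.mul (by fun_prop)).differentiableOn).add
      (DifferentiableOn.mul (by fun_prop) hF), key, fun s hs => ?_⟩
    rw [hZeq s hs, tsum_exp_neg_mul_log_Pval hn hfact han hre hv hb hs]
    refine key s fun j _ h => ?_
    have h' := congrArg Complex.re h
    have hn' : (1 : ℝ) ≤ n := by exact_mod_cast hn
    simp at h'
    nlinarith [Nat.cast_nonneg (α := ℝ) j]
  obtain ⟨H, hH, hHZ⟩ := exists_entire_of_forall_halfPlane
    (fun s => (Complex.Gamma (n * s - 1))⁻¹ * Z s) fun R => by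
      obtain ⟨c', hc', hb'⟩ := exists_exp_mul_expansion _ (analyticAt_neg_log_prod_one_sub x)
        (by simp) (n * R + 1)
      obtain ⟨F, hF, -, hFZ⟩ := hcont (n * R + 1) c' hc' (by simpa only [hv] using hb')
      refine ⟨F, hF.mono fun s (hs : -(R : ℝ) < s.re) => ?_, hFZ⟩
      change 1 < n * s.re + ((n * R + 1 : ℕ) : ℝ)
      push_cast
      nlinarith
  obtain ⟨F, hF, hFeq, hFZ⟩ := hcont J c hc hb
  have hHU : Set.EqOn H (fun s => (Complex.Gamma (n * s - 1))⁻¹ * Z s) U := by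
    refine AnalyticOnNhd.eqOn_of_preconnected_of_eventuallyEq (z₀ := 2)
      (hH.differentiableOn.analyticOnNhd hU) ((hg.differentiableOn.mul hZ).analyticOnNhd hU)
      hUc.isPreconnected (hUsub (by simp)) ?_
    filter_upwards [h2] with s hs using hHZ s hs
  have hHF : Set.EqOn H F {s | 1 < n * s.re + J} := by
    refine AnalyticOnNhd.eqOn_of_preconnected_of_eventuallyEq (z₀ := 2)
      (hH.differentiableOn.analyticOnNhd (hopenJ J)) (hF.analyticOnNhd (hopenJ J)) ?_ ?_ ?_
    · have : {s : ℂ | 1 < n * s.re + J} = {s : ℂ | (1 - J) / n < s.re} := by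
        ext s
        change 1 < n * s.re + J ↔ (1 - J) / n < s.re
        rw [div_lt_iff₀' hn0, sub_lt_iff_lt_add]
      rw [this]
      exact (convex_halfSpace_re_gt _).isPreconnected
    · change 1 < n * (2 : ℂ).re + J
      have : (1 : ℝ) < J := by exact_mod_cast hJ
      rw [Complex.re_ofNat]
      linarith
    · filter_upwards [h2] with s hs
      rw [hHZ s hs, hFZ s hs]
  have h0J : (0 : ℂ) ∈ {s : ℂ | 1 < n * s.re + J} := by
    change 1 < n * (0 : ℂ).re + (J : ℝ)
    simpa using hJ
  have hball : Metric.ball (0 : ℂ) (1 / n) ∈ 𝓝 (0 : ℂ) := Metric.ball_mem_nhds _ (by positivity)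
  filter_upwards [mem_nhdsWithin_of_mem_nhds (hU.mem_nhds h0U),
    mem_nhdsWithin_of_mem_nhds ((hopenJ J).mem_nhds h0J), mem_nhdsWithin_of_mem_nhds hball,
    self_mem_nhdsWithin] with s hsU hsJ hsb hs0
  have hns : ‖(n : ℂ) * s‖ < 1 := by
    rw [mem_ball_zero_iff, lt_div_iff₀' hn0] at hsb
    simpa using hsb
  have hns0 : (n : ℂ) * s ≠ 0 := mul_ne_zero (by exact_mod_cast hn0.ne') hs0
  have hns_ne : ∀ m : ℤ, (n : ℂ) * s ≠ m := by
    intro m hm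
    rw [hm, Complex.norm_intCast] at hns
    have : m = 0 := Int.abs_lt_one_iff.1 (by exact_mod_cast hns)
    exact hns0 (by rw [hm, this, Int.cast_zero])
  have hΓ : (Complex.Gamma (n * s - 1))⁻¹ ≠ 0 := by
    refine inv_ne_zero (Complex.Gamma_ne_zero fun m h => hns_ne (1 - m) ?_)
    push_cast
    linear_combination h
  have hpole : ∀ j < J, n * s + j ≠ 1 := fun j _ h => hns_ne (1 - j) (by
    push_cast
    linear_combination h)
  exact mul_left_cancel₀ hΓ (((hHU hsU).symm.trans (hHF hsJ)).trans (hFeq s hpole))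

/-- If `Z` is a holomorphic extension of `ζ^{(0)}_P` to an open connected set containing `0`
and `{s : Re s > 1}`, then
`exp(Z′(0)) = aₙ^{−(1/2 − a_{n−1}/(n·aₙ))} · (2π)^{−n/2} · ∏ᵢ Γ(−xᵢ)`,
where the powers of the positive reals `aₙ` and `2π` are real powers. -/
theorem exp_polyZeta_deriv_at_zero
    (n : ℕ) (hn : 1 ≤ n) (a : ℕ → ℝ) (han : 0 < a n) (ha0 : a 0 ≠ 0)
    (x : Fin n → ℂ)
    (hfact : ∀ z : ℂ, (∑ i ∈ Finset.range (n + 1), (a i : ℂ) * z ^ i)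
      = (a n : ℂ) * ∏ i : Fin n, (z - x i))
    (hre : ∀ i, (x i).re < 0)
    (U : Set ℂ) (Z : ℂ → ℂ)
    (hU : IsOpen U) (hUc : IsConnected U) (h0U : (0 : ℂ) ∈ U)
    (hUsub : {s : ℂ | 1 < s.re} ⊆ U)
    (hZ : DifferentiableOn ℂ Z U)
    (hZeq : ∀ s : ℂ, 1 < s.re →
      Z s = ∑' k : ℕ, Complex.exp (-s * (Real.log (Pval n a k) : ℂ))) :
    Complex.exp (deriv Z 0)
      = ((Real.rpow (a n) (-(1 / 2 - a (n - 1) / (n * a n))) : ℝ) : ℂ)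
        * ((Real.rpow (2 * Real.pi) (-(n : ℝ) / 2) : ℝ) : ℂ)
        * ∏ i : Fin n, Complex.Gamma (-(x i)) := by
  set p : ℂ := ∑ i, x i with hp
  set v : ℕ → ℂ → ℂ := fun k s =>
    Complex.exp (s * -Complex.log (∏ i, (1 - x i * (k + 1 : ℂ)⁻¹))) with hv
  set c : ℕ → ℂ → ℂ := fun j s => if j = 0 then 1 else s * p with hc
  have hcd : ∀ j, Differentiable ℂ (c j) := fun j => by
    rcases eq_or_ne j 0 with rfl | hj
    · simp [hc]
    · simp only [hc, hj, if_false]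
      fun_prop
  have hvd : ∀ k, Differentiable ℂ (v k) := fun k => by simp only [hv]; fun_prop
  have hb : ∀ R : ℝ, ∃ C : ℝ, ∀ (k : ℕ) (s : ℂ), ‖s‖ ≤ R →
      ‖v k s - ∑ j ∈ Finset.range 2, c j s * ((k + 1 : ℂ)⁻¹) ^ j‖
        ≤ C * ((k + 1 : ℝ)⁻¹) ^ 2 := by
    simpa only [deriv_neg_log_prod_one_sub] using
      exp_mul_expansion_two _ (analyticAt_neg_log_prod_one_sub x) (by simp)
  have hn0 : (n : ℂ) ≠ 0 := by exact_mod_cast (by omega : n ≠ 0)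
  have ha' : (a n : ℂ) ≠ 0 := by exact_mod_cast han.ne'
  obtain ⟨D, hD, hDeriv⟩ := hasDerivAt_zero_tsum_dirichlet n 2 one_lt_two
    (fun k s => v k s - ∑ j ∈ Finset.range 2, c j s * ((k + 1 : ℂ)⁻¹) ^ j)
    (fun k => by fun_prop) (fun k => by simp [hv, hc]) hb
  have hderiv : ∀ k : ℕ, deriv (fun s => v k s -
      ∑ j ∈ Finset.range 2, c j s * ((k + 1 : ℂ)⁻¹) ^ j) 0 =
      -Complex.log (∏ i, (1 - x i * (k + 1 : ℂ)⁻¹)) - p * (k + 1 : ℂ)⁻¹ := by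
    intro k
    have h1 : HasDerivAt (v k) (-Complex.log (∏ i, (1 - x i * (k + 1 : ℂ)⁻¹))) 0 := by
      have := ((hasDerivAt_id (0 : ℂ)).mul_const
        (-Complex.log (∏ i, (1 - x i * (k + 1 : ℂ)⁻¹)))).cexp
      simpa only [id, zero_mul, Complex.exp_zero, one_mul] using! this
    have h2 : HasDerivAt (fun s : ℂ => 1 + s * (p * (k + 1 : ℂ)⁻¹)) (p * (k + 1 : ℂ)⁻¹) 0 := by
      simpa using ((hasDerivAt_id (0 : ℂ)).mul_const (p * (k + 1 : ℂ)⁻¹)).const_add 1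
    have := (h1.sub h2).deriv
    simpa [hc, Finset.sum_range_succ, mul_assoc] using! this
  have hprod := exp_tsum_eq_prod_Gamma hre (hD.congr_fun fun k => (hderiv k).symm)
  have hev := eventuallyEq_riemannZeta_expansion hn hfact han hre hU hUc h0U hUsub hZ hZeq
    one_lt_two hcd (v := v) (fun _ _ => rfl) hb
  set r : ℂ → ℂ := fun s => ∑' k : ℕ, (k + 1 : ℂ) ^ (-(n * s)) *
    (v k s - ∑ j ∈ Finset.range 2, c j s * ((k + 1 : ℂ)⁻¹) ^ j) with hr
  have hr0 : r 0 = 0 := by simp [hr, hv, hc, Finset.sum_range_succ]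
  have hinner : HasDerivAt (fun s : ℂ => riemannZeta (n * s) +
      p / n * riemannZeta₁ (n * s + 1) + r s)
      (n * (-Complex.log (2 * Real.pi) / 2) + p * Real.eulerMascheroniConstant + D) 0 := by
    have hlin : HasDerivAt (fun s : ℂ => n * s) n 0 := by
      simpa using (hasDerivAt_id (0 : ℂ)).const_mul (n : ℂ)
    have h1 : HasDerivAt riemannZeta (-Complex.log (2 * Real.pi) / 2) (n * 0) := by
      rw [mul_zero, ← deriv_riemannZeta_zero]
      exact (differentiableAt_riemannZeta zero_ne_one).hasDerivAt
    have h2 : HasDerivAt riemannZeta₁ Real.eulerMascheroniConstant (n * 0 + 1) := by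
      rw [mul_zero, zero_add, ← deriv_riemannZeta₁_one]
      exact differentiable_riemannZeta₁.differentiableAt.hasDerivAt
    have h1' := h1.comp (0 : ℂ) hlin
    have h2' := (h2.comp (0 : ℂ) (hlin.add_const 1)).const_mul (p / n)
    convert! (h1'.add h2').add hDeriv using 1
    field_simp
  have hexp : ∀ t : ℂ, HasDerivAt (fun s : ℂ => Complex.exp (-s * t)) (-t) 0 := fun t => by
    simpa using ((hasDerivAt_id (0 : ℂ)).neg.mul_const t).cexp
  have hG := (hexp (Real.log (Pval n a 0))).add ((hexp (Real.log (a n))).mul hinner)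
  have hZc : ContinuousAt Z 0 := (hZ.differentiableAt (hU.mem_nhds h0U)).continuousAt
  have hZG := (hZc.eventuallyEq_nhds_iff_eventuallyEq_nhdsNE hG.continuousAt).1 (by
    filter_upwards [hev, self_mem_nhdsWithin] with s hs hs0
    have hs0' : s ≠ 0 := hs0
    have hne : (n : ℂ) * s + 1 ≠ 1 := by simpa using ⟨by omega, hs0'⟩
    have hsum : ∑ j ∈ Finset.range 2, c j s * riemannZeta (n * s + j) =
        riemannZeta (n * s) + p / n * riemannZeta₁ (n * s + 1) := by
      simp only [Finset.sum_range_succ' _ 1, Finset.sum_range_one, hc, if_true, zero_add,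
        one_ne_zero, if_false, Nat.cast_zero, Nat.cast_one, add_zero, one_mul]
      rw [riemannZeta_eq_inv_sub_mul hne, add_sub_cancel_right]
      field_simp
      ring
    rw [hs, hsum]
    rfl)
  have hrpow : ∀ b : ℝ, 0 < b → ∀ t : ℝ, ((Real.rpow b t : ℝ) : ℂ) =
      Complex.exp (Real.log b * t) := fun b hb t => by
    rw [Real.rpow_eq_pow, Real.rpow_def_of_pos hb]
    push_cast
    rfl
  have hP0 : Complex.exp (-(Real.log (Pval n a 0) : ℂ)) =
      Complex.exp (-(Real.log (a n) : ℂ)) * ∏ i, (-(x i))⁻¹ := by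
    rw [Complex.exp_neg, Complex.exp_neg, ← Complex.ofReal_exp, ← Complex.ofReal_exp,
      Real.exp_log han, Real.exp_log (Pval_pos hfact han hre le_rfl), ofReal_Pval hfact,
      mul_inv, ← Finset.prod_inv_distrib]
    simp
  have hlog : Complex.log (2 * Real.pi) = (Real.log (2 * Real.pi) : ℂ) := by
    rw [Complex.ofReal_log (by positivity)]
    push_cast
    rfl
  rw [hZG.deriv_eq, hG.deriv, hr0, hrpow _ han, hrpow _ (by positivity), ← hprod, Complex.exp_add,
    hP0, mul_zero, zero_add, riemannZeta_zero, riemannZeta₁_one, hlog, neg_zero, zero_mul,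
    Complex.exp_zero]
  have hpa : p = -((a (n - 1) : ℂ) / a n) := by
    rw [hp, sum_roots_eq hn hfact han]
    push_cast
    rfl
  rw [mul_right_comm, ← Complex.exp_add, ← Complex.exp_add, ← mul_assoc, ← Complex.exp_add]
  congr 2
  push_cast
  rw [← hp, hpa]
  field_simp
  ring
end
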